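/- arXiv:1103.2838 — 5 statements merged into one kernel-verified Lean document; each statement's English description precedes it below -/
import Mathlib

section
/- For every singular cardinal λ with cf(λ) > ω, there exists a function rts : [λ⁺]² → [λ⁺]² such that for all cofinal subsets A, B of λ⁺ and every cardinal θ < λ, there exists a stationary subset S* ⊆ E^{λ⁺}_{>θ} with rts[A ⊛ B] ⊇ [S*]². -/
open Ordinal Cardinal Set

/-- `C` is closed in the ordinal `o`: every limit point of `C` below `o` belongs to `C`. -/
def IsClosedIn (C : Set Ordinal) (o : Ordinal) : Prop :=
  ∀ p, p < o → p ≠ 0 → (∀ q < p, ∃ r ∈ C, q < r ∧ r < p) → p ∈ C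

/-- `C` is a club (closed unbounded) subset of the ordinal `o`. -/
def IsClubIn (C : Set Ordinal) (o : Ordinal) : Prop :=
  C ⊆ Set.Iio o ∧ IsClosedIn C o ∧ ∀ p < o, ∃ q ∈ C, p ≤ q

/-- `S` is stationary in the ordinal `o`: it meets every club subset of `o`. -/
def IsStationaryIn (S : Set Ordinal) (o : Ordinal) : Prop :=
  S ⊆ Set.Iio o ∧ ∀ C, IsClubIn C o → (S ∩ C).Nonempty

/-- `A` is a cofinal (unbounded) subset of the ordinal `o`. -/
def IsCofinalIn (A : Set Ordinal) (o : Ordinal) : Prop :=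
  A ⊆ Set.Iio o ∧ ∀ p < o, ∃ q ∈ A, p ≤ q

/-- A cardinal is singular if it is infinite and its cofinality is smaller than itself. -/
def IsSingular (c : Cardinal) : Prop :=
  Cardinal.aleph0 ≤ c ∧ c.ord.cof < c

universe u

/-- A well-order-like type of regular uncountable size `μ`. -/
structure IsReg (O : Type u) [LinearOrder O] (μ : Cardinal.{u}) : Prop where
  unc : ℵ₀ < μ
  bdd : ∀ s : Set O, #s < μ → ∃ b, ∀ x ∈ s, x < b
  small : ∀ x : O, #(Iio x) < μ
  card : #O = μ

/-- `x` has a cofinal set of predecessors of size at most `θ`. -/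
def HasCofLE {O : Type u} [LinearOrder O] (x : O) (θ : Cardinal.{u}) : Prop :=
  ∃ s ⊆ Iio x, #s ≤ θ ∧ ∀ y < x, ∃ z ∈ s, y ≤ z

/-- Closed unbounded subsets of a linear order. -/
structure Club {O : Type u} [LinearOrder O] (E : Set O) : Prop where
  unb : ∀ p, ∃ q ∈ E, p ≤ q
  cl : ∀ p, ¬IsMin p → (∀ q < p, ∃ r ∈ E, q < r ∧ r < p) → p ∈ E

lemma exists_wf_rec {T : Type*} [LinearOrder T] [WellFoundedLT T] {X : Type*}
    (R : (ξ : T) → (Iio ξ → X) → X → Prop) (h : ∀ ξ f, ∃ q, R ξ f q) :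
    ∃ x : T → X, ∀ ξ, R ξ (fun η => x η) (x ξ) := by
  choose F hF using h
  let x : T → X := (wellFounded_lt (α := T)).fix (fun ξ f => F ξ (fun η => f η.1 η.2))
  refine ⟨x, fun ξ => ?_⟩
  have : x ξ = F ξ (fun η => x η) := (wellFounded_lt (α := T)).fix_eq _ _
  rw [this]
  exact hF _ _

lemma isReg_ord_toType {μ : Cardinal.{u}} (hμ : μ.IsRegular) (h : ℵ₀ < μ) :
    IsReg μ.ord.ToType μ where
  unc := h
  bdd s hs := by
    by_contra hcon
    push Not at hcon
    have : IsCofinal s := fun b => by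
      obtain ⟨x, hx, hb⟩ := hcon b
      exact ⟨x, hx, hb⟩
    have h2 := Order.cof_le this
    rw [Ordinal.cof_toType, hμ.cof_ord] at h2
    exact absurd hs (not_lt.2 h2)
  small x := by
    have := mk_Iio_lt (α := μ.ord.ToType) x (by simp)
    simpa using this
  card := mk_ord_toType μ

namespace IsReg

variable {O : Type u} [LinearOrder O] {μ : Cardinal.{u}}

lemma bddRange (hO : IsReg O μ) {K : Type u} (f : K → O) (hK : #K < μ) : ∃ b, ∀ k, f k < b := by
  obtain ⟨b, hb⟩ := hO.bdd (range f) (mk_range_le.trans_lt hK)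
  exact ⟨b, fun k => hb _ ⟨k, rfl⟩⟩

lemma exists_gt (hO : IsReg O μ) (p : O) : ∃ q, p < q := by
  obtain ⟨b, hb⟩ := hO.bdd {p} (by simpa using one_lt_aleph0.trans hO.unc)
  exact ⟨b, hb p rfl⟩

lemma exists_elt (hO : IsReg O μ) : Nonempty O := by
  obtain ⟨b, -⟩ := hO.bdd ∅ (by simpa using aleph0_pos.trans hO.unc)
  exact ⟨b⟩

lemma small_Iic (hO : IsReg O μ) (x : O) : #(Iic x) < μ := by
  obtain ⟨y, hy⟩ := hO.exists_gt x
  exact (mk_le_mk_of_subset (fun z hz => lt_of_le_of_lt hz hy)).trans_lt (hO.small y)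

lemma small_mul (hO : IsReg O μ) {a b : Cardinal.{u}} (ha : a < μ) (hb : b < μ) : a * b < μ :=
  mul_lt_of_lt hO.unc.le ha hb

lemma club_Ioi (hO : IsReg O μ) (p : O) : Club (Ioi p) where
  unb q := by
    obtain ⟨r, hr⟩ := hO.exists_gt (max p q)
    exact ⟨r, (le_max_left _ _).trans_lt hr, (le_max_right _ _).trans hr.le⟩
  cl q hq h := by
    rw [not_isMin_iff] at hq
    obtain ⟨y, hy⟩ := hq
    obtain ⟨r, hr, -, h2⟩ := h y hy
    exact lt_trans hr h2

lemma pigeonhole (hO : IsReg O μ) {K : Type u} (hK : #K < μ) {A : Set O}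
    (hA : ∀ p, ∃ α ∈ A, p ≤ α) (R : O → K → Prop) (q : O) (h : ∀ α ∈ A, q ≤ α → ∃ k, R α k) :
    ∃ k, ∀ p, ∃ α ∈ A, p ≤ α ∧ R α k := by
  by_contra hcon
  push Not at hcon
  choose p hp using hcon
  obtain ⟨b, hb⟩ := hO.bddRange p hK
  obtain ⟨α, hα, hle⟩ := hA (max b q)
  obtain ⟨k, hk⟩ := h α hα ((le_max_right _ _).trans hle)
  exact hp k α hα ((hb k).le.trans ((le_max_left _ _).trans hle)) hk

variable [WellFoundedLT O]

lemma exists_lsub (hO : IsReg O μ) {K : Type u} (f : K → O) (hK : #K < μ) :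
    ∃ b, (∀ k, f k < b) ∧ ∀ y < b, ∃ k, y ≤ f k := by
  obtain ⟨b, hb, hmin⟩ := WellFounded.has_min (wellFounded_lt (α := O)) {b | ∀ k, f k < b}
    (hO.bddRange f hK)
  refine ⟨b, hb, fun y hy => ?_⟩
  by_contra hcon
  push Not at hcon
  exact hmin y hcon hy

lemma exists_closed_countable (hO : IsReg O μ) (G : O → O) (p : O) :
    ∃ x, p < x ∧ (∀ y < x, G y < x) ∧ HasCofLE x ℵ₀ := by
  have : ∀ z : O, ∃ b, z < b ∧ ∀ y ≤ z, G y < b := fun z => by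
    obtain ⟨b, hb⟩ := hO.bddRange (fun y : Iic z => max z (G y)) (hO.small_Iic z)
    exact ⟨b, (le_max_left _ _).trans_lt (hb ⟨z, le_rfl⟩),
      fun y hy => (le_max_right _ _).trans_lt (hb ⟨y, hy⟩)⟩
  choose H hH1 hH2 using this
  let x : ℕ → O := fun n => H^[n] p
  have hx : ∀ n, x (n+1) = H (x n) := fun n => Function.iterate_succ_apply' H n p
  obtain ⟨b, hb1, hb2⟩ := hO.exists_lsub (fun n : ULift.{u} ℕ => x n.down) (by simpa using hO.unc)
  refine ⟨b, hb1 ⟨0⟩, fun y hy => ?_, range (fun n : ULift.{u} ℕ => x n.down), ?_, ?_, ?_⟩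
  · obtain ⟨n, hn⟩ := hb2 y hy
    have := hb1 ⟨n.down + 1⟩
    simp only [hx] at this
    exact (hH2 _ _ hn).trans this
  · rintro _ ⟨n, rfl⟩
    exact hb1 n
  · exact mk_range_le.trans (by simp)
  · intro y hy
    obtain ⟨n, hn⟩ := hb2 y hy
    exact ⟨_, ⟨n, rfl⟩, hn⟩

lemma club_closed (hO : IsReg O μ) (G : O → O) : Club {x | ¬IsMin x ∧ ∀ y < x, G y < x} where
  unb p := by
    obtain ⟨x, hx, h, -⟩ := hO.exists_closed_countable G p
    exact ⟨x, ⟨fun h => h.not_lt hx, h⟩, hx.le⟩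
  cl p hp h := by
    refine ⟨hp, fun y hy => ?_⟩
    obtain ⟨r, hr, h1, h2⟩ := h y hy
    exact (hr.2 y h1).trans h2

lemma club_diag (hO : IsReg O μ) {K : Type u} (hK : #K < μ) {E : O → K → Set O}
    (hE : ∀ η k, Club (E η k)) : Club {x | ∀ η < x, ∀ k, x ∈ E η k} where
  unb p := by
    have : ∀ y : O, ∃ b, ∀ η ≤ y, ∀ k, ∃ r ∈ E η k, y < r ∧ r < b := fun y => by
      obtain ⟨y', hy'⟩ := hO.exists_gt y
      choose r hr hr' using fun η k => (hE η k).unb y'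
      obtain ⟨b, hb⟩ := hO.bddRange (fun z : Iic y × K => r z.1 z.2)
        (by simpa using hO.small_mul (hO.small_Iic y) hK)
      exact ⟨b, fun η hη k => ⟨r η k, hr _ _, hy'.trans_le (hr' _ _), hb (⟨η, hη⟩, k)⟩⟩
    choose G hG using this
    obtain ⟨x, hx, h, -⟩ := hO.exists_closed_countable G p
    refine ⟨x, fun η hη k => (hE η k).cl _ (fun h => h.not_lt hx) fun q hq => ?_, hx.le⟩
    obtain ⟨r, hr, h1, h2⟩ := hG (max q η) η (le_max_right _ _) k
    exact ⟨r, hr, (le_max_left _ _).trans_lt h1, h2.trans (h _ (max_lt hq hη))⟩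
  cl p hp h := by
    intro η hη k
    refine (hE η k).cl p hp fun q hq => ?_
    obtain ⟨r, hr, h1, h2⟩ := h (max q η) (max_lt hq hη)
    exact ⟨r, hr η ((le_max_right _ _).trans_lt h1) k, (le_max_left _ _).trans_lt h1, h2⟩

lemma club_iInter (hO : IsReg O μ) {K : Type u} (hK : #K < μ) {E : K → Set O}
    (hE : ∀ k, Club (E k)) : Club (⋂ k, E k) where
  unb p := by
    obtain ⟨p', hp'⟩ := hO.exists_gt p
    obtain ⟨x, hx, h⟩ := (hO.club_diag (E := fun _ => E) hK fun _ => hE).unb p'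
    exact ⟨x, mem_iInter.2 (hx p (hp'.trans_le h)), hp'.le.trans h⟩
  cl p hp h := by
    refine mem_iInter.2 fun k => (hE k).cl p hp fun q hq => ?_
    obtain ⟨r, hr, h1⟩ := h q hq
    exact ⟨r, mem_iInter.1 hr k, h1⟩

lemma club_inter (hO : IsReg O μ) {E F : Set O} (hE : Club E) (hF : Club F) : Club (E ∩ F) := by
  have := hO.club_iInter (K := ULift.{u} Bool) (E := fun b => cond b.down E F)
    (by simpa using (natCast_lt_aleph0 (n := 2)).trans hO.unc)
    (fun b => by rcases b with ⟨_ | _⟩ <;> assumption)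
  convert this using 1
  ext x
  simp [ULift.forall, and_comm]

/-- Pressing down. -/
lemma pressing_down (hO : IsReg O μ) {K : Type u} (hK : #K < μ) (P : O → K → O → Prop)
    (h : ∀ E, Club E → ∃ x ∈ E, ∃ η < x, ∃ k, P η k x) :
    ∃ η k, ∀ E, Club E → ∃ x ∈ E, η < x ∧ P η k x := by
  by_contra hcon
  push Not at hcon
  choose E hE hP using hcon
  obtain ⟨x, hx, η, hη, k, hk⟩ := h _ (hO.club_diag hK hE)
  exact hP η k x (hx η hη k) hη hk

/-- Limits of prescribed regular successor cofinality inside an unbounded set. -/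
lemma exists_limit (hO : IsReg O μ) {E : Set O} (hE : ∀ p, ∃ q ∈ E, p ≤ q) {θ : Cardinal.{u}}
    (hθ : ℵ₀ ≤ θ) (hθμ : Order.succ θ < μ) (p : O) :
    ∃ b, p < b ∧ ¬HasCofLE b θ ∧ HasCofLE b (Order.succ θ) ∧
      ∀ y < b, ∃ r ∈ E, y < r ∧ r < b := by
  have hT : IsReg (Order.succ θ).ord.ToType (Order.succ θ) :=
    isReg_ord_toType (isRegular_succ hθ) (hθ.trans_lt (Order.lt_succ θ))
  obtain ⟨x, hx⟩ := exists_wf_rec (T := (Order.succ θ).ord.ToType)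
    (fun ξ f q => q ∈ E ∧ p < q ∧ ∀ η, f η < q) (fun ξ f => by
      obtain ⟨b, hb⟩ := hO.bddRange f ((hT.small ξ).trans hθμ)
      obtain ⟨p', hp'⟩ := hO.exists_gt p
      obtain ⟨q, hq, h⟩ := hE (max b p')
      exact ⟨q, hq, hp'.trans_le ((le_max_right _ _).trans h),
        fun η => (hb η).trans_le ((le_max_left _ _).trans h)⟩)
  have hmono : ∀ ξ η, η < ξ → x η < x ξ := fun ξ η h => (hx ξ).2.2 ⟨η, h⟩
  obtain ⟨b, hb1, hb2⟩ := hO.exists_lsub x (by rw [hT.card]; exact hθμ)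
  obtain ⟨ξ0⟩ := hT.exists_elt
  refine ⟨b, (hx ξ0).2.1.trans (hb1 _), ?_, ?_, ?_⟩
  · rintro ⟨s, hs, hsθ, hcof⟩
    have := hT.exists_elt
    choose! i hi using fun z (hz : z ∈ s) => hb2 z (hs hz)
    obtain ⟨ξ, hξ⟩ := hT.bddRange (fun z : s => i z) (Order.lt_succ_of_le hsθ)
    obtain ⟨z, hz, hle⟩ := hcof _ (hb1 ξ)
    exact absurd (hle.trans (hi z hz)) (not_le.2 (hmono _ _ (hξ ⟨z, hz⟩)))
  · refine ⟨range x, by rintro _ ⟨n, rfl⟩; exact hb1 n, ?_, ?_⟩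
    · exact mk_range_le.trans hT.card.le
    · intro y hy
      obtain ⟨n, hn⟩ := hb2 y hy
      exact ⟨_, ⟨n, rfl⟩, hn⟩
  · intro y hy
    obtain ⟨ξ, hξ⟩ := hb2 y hy
    obtain ⟨ξ', h'⟩ := hT.exists_gt ξ
    exact ⟨_, (hx ξ').1, hξ.trans_lt (hmono _ _ h'), hb1 _⟩

end IsReg

lemma not_isMin_of_gt {O : Type u} [LinearOrder O] {p x : O} (h : p < x) : ¬IsMin x :=
  fun h' => h'.not_lt h

/-- Closed sets have a largest element below any bound above one of their members. -/
lemma Club.exists_greatest {O : Type u} [LinearOrder O] [WellFoundedLT O] {E : Set O}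
    (hE : Club E) {γ e : O} (he : e ∈ E) (heγ : e ≤ γ) : ∃ z, IsGreatest (E ∩ Iic γ) z := by
  obtain ⟨z, hz, hmin⟩ := WellFounded.has_min (wellFounded_lt (α := O))
    (upperBounds (E ∩ Iic γ)) ⟨γ, fun x hx => hx.2⟩
  refine ⟨z, ⟨?_, ?_⟩, hz⟩
  · by_contra hzE
    have hez : e < z := lt_of_le_of_ne (hz ⟨he, heγ⟩) (fun h => hzE (h ▸ he))
    refine hzE (hE.cl z (not_isMin_of_gt hez) fun q hq => ?_)
    have : q ∉ upperBounds (E ∩ Iic γ) := fun h => hmin q h hq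
    simp only [upperBounds, mem_ofPred_eq, not_forall, not_le] at this
    obtain ⟨r, hr, hqr⟩ := this
    exact ⟨r, hr.1, hqr, lt_of_le_of_ne (hz hr) (fun h => hzE (h ▸ hr.1))⟩
  · by_contra hzγ
    exact hmin γ (fun x hx => hx.2) (not_le.1 hzγ)

lemma mk_biUnion_le_of_infinite {α β : Type u} {s : Set α} {A : α → Set β} {Λ : Cardinal.{u}}
    (hΛ : ℵ₀ ≤ Λ) (hs : #s ≤ Λ) (hA : ∀ x ∈ s, #(A x) ≤ Λ) : #(⋃ x ∈ s, A x) ≤ Λ := by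
  refine (mk_biUnion_le A s).trans ?_
  calc #s * ⨆ x : s, #(A x) ≤ Λ * Λ := by
        gcongr
        exact ciSup_le' fun x => hA x x.2
    _ = Λ := mul_eq_self hΛ

lemma mk_iUnion_le_of_infinite {α β : Type u} {A : α → Set β} {Λ : Cardinal.{u}}
    (hΛ : ℵ₀ ≤ Λ) (hs : #α ≤ Λ) (hA : ∀ x, #(A x) ≤ Λ) : #(⋃ x, A x) ≤ Λ := by
  have := mk_biUnion_le_of_infinite (s := univ) (A := A) hΛ (by simpa using hs) (fun x _ => hA x)
  simpa using this

section
variable {O : Type u} [LinearOrder O]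

/-- Stages of the closure of `{δ}` under `y ↦ max (E ∩ Iic γ)` for `γ ∈ e y`. -/
def guessStage (e : O → Set O) (E : Set O) (δ : O) : ℕ → Set O
  | 0 => {δ}
  | n + 1 => ⋃ y ∈ guessStage e E δ n, ⋃ γ ∈ e y, {z | IsGreatest (E ∩ Iic γ) z}

def guessClosure (e : O → Set O) (E : Set O) (δ : O) : Set O := ⋃ n, guessStage e E δ n

lemma self_mem_guessClosure (e : O → Set O) (E : Set O) (δ : O) : δ ∈ guessClosure e E δ :=
  mem_iUnion.2 ⟨0, rfl⟩

lemma guessClosure_step {e : O → Set O} {E : Set O} {δ y γ z : O} (hy : y ∈ guessClosure e E δ)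
    (hγ : γ ∈ e y) (hz : IsGreatest (E ∩ Iic γ) z) : z ∈ guessClosure e E δ := by
  obtain ⟨n, hn⟩ := mem_iUnion.1 hy
  refine mem_iUnion.2 ⟨n + 1, ?_⟩
  simp only [guessStage, mem_iUnion]
  exact ⟨y, hn, γ, hγ, hz⟩

lemma mk_setOf_isGreatest_le (s : Set O) : #{z | IsGreatest s z} ≤ 1 := by
  rw [mk_le_one_iff_set_subsingleton]
  exact fun x hx y hy => hx.unique hy

lemma mk_guessClosure_le {e : O → Set O} {Λ : Cardinal.{u}} (hΛ : ℵ₀ ≤ Λ) (he : ∀ y, #(e y) ≤ Λ)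
    (E : Set O) (δ : O) : #(guessClosure e E δ) ≤ Λ := by
  have h1 : (1 : Cardinal) ≤ Λ := one_le_aleph0.trans hΛ
  have : ∀ n, #(guessStage e E δ n) ≤ Λ := fun n => by
    induction n with
    | zero => simpa [guessStage] using h1
    | succ n ih =>
      exact mk_biUnion_le_of_infinite hΛ ih fun y _ => mk_biUnion_le_of_infinite hΛ (he y)
        fun γ _ => (mk_setOf_isGreatest_le _).trans h1
  have h := mk_iUnion_le_of_infinite (A := fun n : ULift.{u} ℕ => guessStage e E δ n.down) hΛ
    (by simpa using hΛ) (fun n => this _)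
  refine le_trans (mk_le_mk_of_subset ?_) h
  exact iUnion_subset fun n => subset_iUnion_of_subset ⟨n⟩ subset_rfl

end

section
variable {O : Type u} [LinearOrder O] [WellFoundedLT O] {μ : Cardinal.{u}}

lemma IsReg.exists_club_iter (hO : IsReg O μ) {Ω : Type u} [LinearOrder Ω] [WellFoundedLT Ω]
    (hΩ : #Ω < μ) (Φ : Set O → Set O) (hΦ : ∀ E, Club E → Club (Φ E)) :
    ∃ E : Ω → Set O, (∀ ξ, Club (E ξ)) ∧ (∀ ξ η, η ≤ ξ → E ξ ⊆ E η) ∧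
      ∀ ξ η, η < ξ → E ξ ⊆ Φ (E η) := by
  obtain ⟨E, hE⟩ := exists_wf_rec (T := Ω) (X := Set O)
    (fun ξ f q => q = ⋂ η : Iio ξ, Φ (f η)) (fun ξ f => ⟨_, rfl⟩)
  refine ⟨E, fun ξ => ?_, fun ξ η h => ?_, fun ξ η h => ?_⟩
  · induction ξ using WellFoundedLT.induction with
    | ind ξ ih =>
      rw [hE ξ]
      exact hO.club_iInter ((mk_set_le _).trans_lt hΩ) fun η => hΦ _ (ih η η.2)
  · rw [hE ξ, hE η]
    exact subset_iInter fun ζ => iInter_subset_of_subset ⟨ζ, ζ.2.trans_le h⟩ subset_rfl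
  · rw [hE ξ]
    exact iInter_subset_of_subset ⟨η, h⟩ subset_rfl

lemma exists_stable {Ω : Type u} [LinearOrder Ω] {E : Ω → Set O}
    (hE : ∀ ξ, Club (E ξ)) (hanti : ∀ ξ η, η ≤ ξ → E ξ ⊆ E η) [Nonempty Ω] (γ : O) :
    ∃ ξ0, ∀ z ξ, ξ0 ≤ ξ → IsGreatest (E ξ ∩ Iic γ) z →
      ∀ ξ', ξ0 ≤ ξ' → IsGreatest (E ξ' ∩ Iic γ) z := by
  by_cases h : ∃ ξ, E ξ ∩ Iic γ = ∅
  · obtain ⟨ξ0, h0⟩ := h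
    refine ⟨ξ0, fun z ξ hξ hz => ?_⟩
    have : z ∈ E ξ0 ∩ Iic γ := ⟨hanti _ _ hξ hz.1.1, hz.1.2⟩
    simp [h0] at this
  · have : ∀ ξ, ∃ z, IsGreatest (E ξ ∩ Iic γ) z := fun ξ => by
      obtain ⟨e, he⟩ := nonempty_iff_ne_empty.2 (fun h' => h ⟨ξ, h'⟩)
      exact (hE ξ).exists_greatest he.1 he.2
    choose Z hZ using this
    obtain ⟨_, ⟨ξ0, rfl⟩, hmin⟩ := WellFounded.has_min (wellFounded_lt (α := O)) (range Z)
      (range_nonempty Z)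
    have key : ∀ ξ, ξ0 ≤ ξ → Z ξ = Z ξ0 := fun ξ hξ => by
      refine le_antisymm ?_ (not_lt.1 (hmin _ ⟨ξ, rfl⟩))
      exact (hZ ξ0).2 ⟨hanti _ _ hξ (hZ ξ).1.1, (hZ ξ).1.2⟩
    refine ⟨ξ0, fun z ξ hξ hz ξ' hξ' => ?_⟩
    rw [hz.unique (hZ ξ), key ξ hξ, ← key ξ' hξ']
    exact hZ ξ'

/-- Club guessing at all points of a sequence of cofinalities simultaneously. -/
lemma IsReg.club_guess (hO : IsReg O μ) {I : Type u} {κ : Cardinal.{u}} (hκ : ℵ₀ ≤ κ)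
    (hI : #I ≤ κ) (hκμ : Order.succ κ < μ) (Λ : I → Cardinal.{u}) (hΛ : ∀ i, ℵ₀ ≤ Λ i)
    (hΛμ : ∀ i, Order.succ (Λ i) < μ) :
    ∃ C : O → I → Set O, (∀ δ i, #(C δ i) ≤ Λ i) ∧ ∀ E, Club E → ∃ δ, ¬IsMin δ ∧
      ∀ i, ∀ γ < δ, ∃ b ∈ C δ i, b ∈ E ∧ γ < b ∧ b < δ ∧ ¬HasCofLE b (Λ i) := by
  have : ∀ (i : I) (y : O), ∃ s : Set O, #s ≤ Λ i ∧
      (HasCofLE y (Λ i) → s ⊆ Iio y ∧ ∀ x < y, ∃ z ∈ s, x ≤ z) := fun i y => by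
    by_cases h : HasCofLE y (Λ i)
    · obtain ⟨s, hs, hc, h'⟩ := h
      exact ⟨s, hc, fun _ => ⟨hs, h'⟩⟩
    · exact ⟨∅, by simp, fun h' => absurd h' h⟩
  choose e he hecof using this
  by_contra hcon
  have hbad : ∀ E : Set O, ∃ F, Club F ∧ (Club E → ∀ δ, ¬IsMin δ → ∃ i, ∃ γ < δ,
      ∀ b ∈ guessClosure (e i) E δ, b ∈ F → γ < b → b < δ → HasCofLE b (Λ i)) := fun E => by
    by_contra hE
    refine hcon ⟨fun δ i => guessClosure (e i) E δ,
      fun δ i => mk_guessClosure_le (hΛ i) (he i) E δ, fun F hF => ?_⟩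
    by_contra hF'
    refine hE ⟨F, hF, fun _ δ hδ => ?_⟩
    by_contra h
    push Not at h
    exact hF' ⟨δ, hδ, h⟩
  choose Φ hΦ hΦbad using hbad
  have hΩ : IsReg (Order.succ κ).ord.ToType (Order.succ κ) :=
    isReg_ord_toType (isRegular_succ hκ) (hκ.trans_lt (Order.lt_succ κ))
  set Ω := (Order.succ κ).ord.ToType with hΩdef
  have hΩne : Nonempty Ω := hΩ.exists_elt
  have hΩμ : #Ω < μ := by rw [hΩ.card]; exact hκμ
  obtain ⟨E, hE, hanti, hEΦ⟩ := hO.exists_club_iter (Ω := Ω) hΩμ Φ fun E _ => hΦ E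
  have hlim := hO.club_iInter hΩμ hE
  have hIμ : #I < μ := hI.trans_lt ((Order.lt_succ κ).trans hκμ)
  have : ∀ γ, ∃ g, ∀ i, ∃ b ∈ ⋂ ξ, E ξ, γ < b ∧ b < g ∧ ¬HasCofLE b (Λ i) := fun γ => by
    have : ∀ i, ∃ b ∈ ⋂ ξ, E ξ, γ < b ∧ ¬HasCofLE b (Λ i) := fun i => by
      obtain ⟨b, h1, h2, -, h3⟩ := hO.exists_limit hlim.unb (hΛ i) (hΛμ i) γ
      exact ⟨b, hlim.cl b (not_isMin_of_gt h1) h3, h1, h2⟩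
    choose b h1 h2 h3 using this
    obtain ⟨g, hg⟩ := hO.bddRange b hIμ
    exact ⟨g, fun i => ⟨b i, h1 i, h2 i, hg i, h3 i⟩⟩
  choose G hG using this
  obtain ⟨p⟩ := hO.exists_elt
  obtain ⟨δ, hpδ, hδG, hδcof⟩ := hO.exists_closed_countable G p
  have hδ := not_isMin_of_gt hpδ
  obtain ⟨s, hs, hsc, hscof⟩ := id hδcof
  obtain ⟨⟨i, γ⟩, hγ⟩ := hΩ.pigeonhole (K := I × s)
    (by
      rw [← mul_def]
      exact hΩ.small_mul (Order.lt_succ_of_le hI) (hsc.trans_lt hΩ.unc)) (A := univ)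
    (fun p => ⟨p, trivial, le_rfl⟩)
    (fun ξ k => ∀ b ∈ guessClosure (e k.1) (E ξ) δ, b ∈ Φ (E ξ) → k.2.1 < b → b < δ →
      HasCofLE b (Λ k.1)) hΩne.some (fun ξ _ _ => by
        obtain ⟨i, γ, hγ, h⟩ := hΦbad (E ξ) (hE ξ) δ hδ
        obtain ⟨γ', h1, h2⟩ := hscof γ hγ
        exact ⟨(i, ⟨γ', h1⟩), fun b hb hbF hlt => h b hb hbF (h2.trans_lt hlt)⟩)
  obtain ⟨b, hbE, hγb, hbG, hbcof⟩ := hG γ.1 i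
  have hbδ : b < δ := hbG.trans (hδG _ (hs γ.2))
  have main : ∀ y, (y = δ ∨ y ∈ ⋂ ξ, E ξ) → b ≤ y → y ≤ δ →
      (∃ ξ0, ∀ ξ, ξ0 ≤ ξ → y ∈ guessClosure (e i) (E ξ) δ) →
      ∃ y', y' ∈ ⋂ ξ, E ξ ∧ b ≤ y' ∧ y' < δ ∧ ¬HasCofLE y' (Λ i) ∧
      (∃ ξ0, ∀ ξ, ξ0 ≤ ξ → y' ∈ guessClosure (e i) (E ξ) δ) := fun y => by
    induction y using WellFoundedLT.induction with
    | ind y ih =>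
      rintro hyE hby hyδ ⟨ξ1, hξ1⟩
      by_cases hy : HasCofLE y (Λ i)
      · have hlt : b < y := lt_of_le_of_ne hby fun h => hbcof (h ▸ hy)
        obtain ⟨h1, h2⟩ := hecof i y hy
        obtain ⟨γ', hγ', hle⟩ := h2 b hlt
        obtain ⟨ξ0, hξ0⟩ := exists_stable hE hanti γ'
        obtain ⟨z, hz⟩ := (hE ξ0).exists_greatest (mem_iInter.1 hbE ξ0) hle
        have hz' := hξ0 z ξ0 le_rfl hz
        have hzy : z < y := lt_of_le_of_lt hz.1.2 (h1 hγ')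
        refine ih z hzy (Or.inr (mem_iInter.2 fun ξ => ?_))
          (hz.2 ⟨mem_iInter.1 hbE ξ0, hle⟩) (hzy.le.trans hyδ)
          ⟨max ξ0 ξ1, fun ξ hξ => ?_⟩
        · exact hanti _ _ (le_max_right ξ0 ξ) (hz' _ (le_max_left _ _)).1.1
        · exact guessClosure_step (hξ1 ξ ((le_max_right _ _).trans hξ)) hγ'
            (hz' _ ((le_max_left _ _).trans hξ))
      · have hne : y ≠ δ := by
          rintro rfl
          obtain ⟨s, h1, h2, h3⟩ := hδcof
          exact hy ⟨s, h1, h2.trans (hΛ i), h3⟩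
        exact ⟨y, hyE.resolve_left hne, hby, lt_of_le_of_ne hyδ hne, hy, ξ1, hξ1⟩
  obtain ⟨y, hyE, hby, hyδ, hy, ξ0, hξ0⟩ := main δ (Or.inl rfl) hbδ.le le_rfl
    ⟨hΩne.some, fun ξ _ => self_mem_guessClosure _ _ _⟩
  obtain ⟨ξ, -, hξ, h⟩ := hγ ξ0
  obtain ⟨ξ', hξ'⟩ := hΩ.exists_gt ξ
  exact hy (h y (hξ0 ξ hξ) (hEΦ _ _ hξ' (mem_iInter.1 hyE ξ')) (hγb.trans_le hby) hyδ)

end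

/-- Club guessing by sets in which every subset of size at most `ν` has a strict upper bound. -/
lemma IsReg.club_guess_directed {O : Type u} [LinearOrder O] [WellFoundedLT O] {μ : Cardinal.{u}}
    (hO : IsReg O μ) {ν : Cardinal.{u}} (hν : ℵ₀ ≤ ν) (hνμ : Order.succ (Order.succ ν) < μ) :
    ∃ C : O → Set O, ∀ D, Club D → ∃ α, C α ⊆ D ∧
      ∀ s ⊆ C α, #s ≤ ν → ∃ c ∈ C α, ∀ x ∈ s, x < c := by
  set τ := Order.succ ν with hτdef
  have hτ : ℵ₀ ≤ τ := hν.trans (Order.le_succ ν)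
  have : ∀ (y : O), ∃ s : Set O, #s ≤ τ ∧
      (HasCofLE y τ → s ⊆ Iio y ∧ ∀ x < y, ∃ z ∈ s, x ≤ z) := fun y => by
    by_cases h : HasCofLE y τ
    · obtain ⟨s, hs, hc, h'⟩ := h
      exact ⟨s, hc, fun _ => ⟨hs, h'⟩⟩
    · exact ⟨∅, by simp, fun h' => absurd h' h⟩
  choose e he hecof using this
  by_contra hcon
  have hbad : ∀ E : Set O, ∃ F, Club F ∧ (Club E → ∀ α,
      {z | ∃ γ ∈ e α, IsGreatest (E ∩ Iic γ) z} ⊆ F →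
      ∃ s ⊆ {z | ∃ γ ∈ e α, IsGreatest (E ∩ Iic γ) z}, #s ≤ ν ∧
        ∀ c ∈ {z | ∃ γ ∈ e α, IsGreatest (E ∩ Iic γ) z}, ∃ x ∈ s, c ≤ x) := fun E => by
    by_contra hE
    refine hcon ⟨fun α => {z | ∃ γ ∈ e α, IsGreatest (E ∩ Iic γ) z}, fun F hF => ?_⟩
    by_contra hF'
    refine hE ⟨F, hF, fun _ α hα => ?_⟩
    by_contra h
    push Not at h
    exact hF' ⟨α, hα, h⟩
  choose Φ hΦ hΦbad using hbad
  have hΩ : IsReg (Order.succ τ).ord.ToType (Order.succ τ) :=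
    isReg_ord_toType (isRegular_succ hτ) (hτ.trans_lt (Order.lt_succ τ))
  set Ω := (Order.succ τ).ord.ToType with hΩdef
  have hΩne : Nonempty Ω := hΩ.exists_elt
  have hΩμ : #Ω < μ := by rw [hΩ.card]; exact hνμ
  obtain ⟨E, hE, hanti, hEΦ⟩ := hO.exists_club_iter (Ω := Ω) hΩμ Φ fun E _ => hΦ E
  have hlim := hO.club_iInter hΩμ hE
  obtain ⟨p⟩ := hO.exists_elt
  obtain ⟨α, -, hα1, hα2, hα3⟩ := hO.exists_limit hlim.unb hν ((Order.lt_succ τ).trans hνμ) p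
  obtain ⟨heα, heαcof⟩ := hecof α hα2
  choose ξ0 hξ0 using exists_stable hE hanti
  obtain ⟨ξ, hξ⟩ := hΩ.bddRange (fun γ : e α => ξ0 γ) (Order.lt_succ_of_le (he α))
  obtain ⟨ξ', hξ'⟩ := hΩ.exists_gt ξ
  obtain ⟨s, hs, hsν, hscof⟩ := hΦbad (E ξ) (hE ξ) α (by
    rintro z ⟨γ, hγ, hz⟩
    refine hEΦ _ _ hξ' (hξ0 γ z ξ (hξ ⟨γ, hγ⟩).le hz ξ' ((hξ ⟨γ, hγ⟩).trans hξ').le).1.1)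
  refine hα1 ⟨s, fun z hz => ?_, hsν, fun y hy => ?_⟩
  · obtain ⟨γ, hγ, hz⟩ := hs hz
    exact lt_of_le_of_lt hz.1.2 (heα hγ)
  · obtain ⟨r, hr, hyr, hrα⟩ := hα3 y hy
    obtain ⟨γ, hγ, hrγ⟩ := heαcof r hrα
    obtain ⟨z, hz⟩ := (hE ξ).exists_greatest (mem_iInter.1 hr ξ) hrγ
    obtain ⟨x, hx, hzx⟩ := hscof z ⟨γ, hγ, hz⟩
    exact ⟨x, hx, (hyr.le.trans (hz.2 ⟨mem_iInter.1 hr ξ, hrγ⟩)).trans hzx⟩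

lemma exists_increasing_cover {α K : Type u} [LinearOrder K] {κ : Cardinal.{u}}
    (hK : #K ≤ κ) (hκ : ℵ₀ ≤ κ) (w : K → Cardinal.{u}) (hmono : Monotone w) (hw : ∀ j, κ ≤ w j)
    (s : Set α) (hs : #s ≤ Cardinal.sum w) :
    ∃ Y : K → Set α, (∀ j, Y j ⊆ s) ∧ (∀ j, #(Y j) ≤ w j) ∧ Monotone Y ∧
      ∀ x ∈ s, ∃ j, x ∈ Y j := by
  have : #s ≤ #(Σ j, (w j).out) := by simpa using hs
  obtain ⟨e⟩ := this
  refine ⟨fun j => {x | ∃ h : x ∈ s, (e ⟨x, h⟩).1 ≤ j}, fun j x hx => hx.1, fun j => ?_,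
    fun j j' h x hx => ⟨hx.1, hx.2.trans h⟩, fun x hx => ⟨_, hx, le_rfl⟩⟩
  let F : {x | ∃ h : x ∈ s, (e ⟨x, h⟩).1 ≤ j} → Σ k : Iic j, (w k).out :=
    fun x => ⟨⟨(e ⟨x, x.2.1⟩).1, x.2.2⟩, (e ⟨x, x.2.1⟩).2⟩
  have hF : Function.Injective F := by
    intro x y h
    have h' : e ⟨x, x.2.1⟩ = e ⟨y, y.2.1⟩ := by
      have h1 := congrArg (fun z : Σ k : Iic j, (w k).out => (⟨z.1.1, z.2⟩ : Σ k, (w k).out)) h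
      exact h1
    have h2 := e.injective h'
    exact Subtype.ext (Subtype.mk.inj h2)
  refine (mk_le_of_injective hF).trans ?_
  rw [mk_sigma]
  simp only [mk_out]
  refine (sum_le_sum _ (fun _ => w j) fun k => hmono k.2).trans ?_
  rw [sum_const']
  calc #(Iic j) * w j ≤ w j * w j := by
        gcongr
        exact (mk_set_le _).trans (hK.trans (hw j))
    _ = w j := mul_eq_self (hκ.trans (hw j))

/-- Two interleaved sequences of cardinals exhausting the singular cardinal `lam`. -/
structure Levels (lam κ : Cardinal.{u}) (I : Type u) [LinearOrder I]
    (l Λ : I → Cardinal.{u}) : Prop where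
  reg : IsReg I κ
  lim : ∀ c < lam, Order.succ c < lam
  succ_le : ∀ i, Order.succ κ ≤ Λ i
  lt : ∀ i, Λ i < lam
  lt' : ∀ i, l i < lam
  le' : ∀ i, κ ≤ l i
  mono' : Monotone l
  step : ∀ i j, i < j → Order.succ (Λ i) ≤ Λ j
  ev : ∀ c < lam, ∀ᶠ i in Filter.atTop, c ≤ Λ i
  cover : ∀ i, ¬IsMin i → Λ i ≤ Cardinal.sum fun j : Iio i => l j

lemma exists_levels {lam : Cardinal.{u}} (hcof : ℵ₀ < lam.ord.cof) (hsing : lam.ord.cof < lam) :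
    ∃ l Λ : lam.ord.cof.ord.ToType → Cardinal.{u},
      Levels lam lam.ord.cof lam.ord.cof.ord.ToType l Λ := by
  have hlam : ℵ₀ < lam := hcof.trans hsing
  have hreg : lam.ord.cof.IsRegular := isRegular_cof (isSuccLimit_ord hlam.le)
  set κ := lam.ord.cof with hκdef
  have hI : IsReg κ.ord.ToType κ := isReg_ord_toType hreg hcof
  have hne := hI.exists_elt
  have hlim : ∀ c < lam, Order.succ c < lam := fun c hc => by
    refine lt_of_le_of_ne (Order.succ_le_of_lt hc) fun h => ?_
    have hc : ℵ₀ ≤ c := by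
      rw [← h] at hlam
      exact Order.le_of_lt_succ hlam
    have := (isRegular_succ hc).cof_ord
    rw [h] at this
    exact hsing.ne this
  obtain ⟨s, hs, hsκ⟩ := Order.exists_cof_eq lam.ord.ToType
  rw [Ordinal.cof_toType, ← hκdef] at hsκ
  obtain ⟨eqv⟩ : Nonempty (κ.ord.ToType ≃ s) := by
    rw [← Cardinal.eq, hsκ, mk_ord_toType]
  let g : κ.ord.ToType → Cardinal.{u} := fun i => (Ordinal.ToType.toOrd (eqv i).1).1.card
  have hg : ∀ i, g i < lam := fun i => lt_ord.1 (Ordinal.ToType.toOrd (eqv i).1).2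
  have hg2 : ∀ c < lam, ∃ i, c ≤ g i := fun c hc => by
    obtain ⟨y, hy, hle⟩ := hs (Ordinal.ToType.mk ⟨c.ord, ord_lt_ord.2 hc⟩)
    refine ⟨eqv.symm ⟨y, hy⟩, ?_⟩
    simp only [g, Equiv.apply_symm_apply]
    rw [← ord_le]
    have := Ordinal.ToType.mk.symm.monotone hle
    rw [OrderIso.symm_apply_apply] at this
    exact this
  obtain ⟨l, hl⟩ := exists_wf_rec (T := κ.ord.ToType) (X := Cardinal.{u})
    (fun j f q => q = Order.succ (max (max (Order.succ κ) (g j)) (⨆ j', f j')))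
    (fun _ _ => ⟨_, rfl⟩)
  have hsup : ∀ i j, j < i → l j ≤ ⨆ j' : Iio i, l j' := fun i j h =>
    le_ciSup (f := fun j' : Iio i => l j') (bddAbove_of_small) ⟨j, h⟩
  have hl1 : ∀ j, Order.succ (max (Order.succ κ) (⨆ j' : Iio j, l j')) ≤ l j := fun j => by
    rw [hl j]
    exact Order.succ_le_succ (max_le_max (le_max_left _ _) le_rfl)
  have hlκ : ∀ j, Order.succ κ ≤ l j := fun j =>
    (le_max_left _ _).trans ((Order.le_succ _).trans (hl1 j))
  have hltsup : ∀ i, (∀ j < i, l j < lam) → ⨆ j' : Iio i, l j' < lam := fun i h =>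
    iSup_lt_of_lt_cof_ord (by simpa using hI.small i) (fun j => h j j.2)
  have hltl : ∀ j, l j < lam := fun j => by
    induction j using WellFoundedLT.induction with
    | ind j ih =>
      rw [hl j]
      exact hlim _ (max_lt (max_lt (hlim _ hsing) (hg j)) (hltsup j ih))
  refine ⟨l, fun i => max (Order.succ κ) (⨆ j : Iio i, l j), hI, hlim, fun i => le_max_left _ _,
    fun i => max_lt (hlim _ hsing) (hltsup i fun j _ => hltl j), hltl,
    fun j => (Order.le_succ κ).trans (hlκ j), fun i j hij => ?_,
    fun i j hij => ?_, fun c hc => ?_, fun i hi => ?_⟩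
  · rcases hij.eq_or_lt with rfl | h
    · rfl
    · exact (hsup _ _ h).trans ((le_max_right _ _).trans ((Order.le_succ _).trans (hl1 j)))
  · exact (hl1 i).trans ((hsup _ _ hij).trans (le_max_right _ _))
  · obtain ⟨i, hi⟩ := hg2 c hc
    obtain ⟨i', hi'⟩ := hI.exists_gt i
    refine Filter.eventually_atTop.2 ⟨i', fun j hj => hi.trans ?_⟩
    refine le_trans ?_ ((hsup _ _ (hi'.trans_le hj)).trans (le_max_right _ _))
    rw [hl i]
    exact ((le_max_right _ _).trans (le_max_left _ _)).trans (Order.le_succ _)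
  · obtain ⟨j, hj⟩ := not_isMin_iff.1 hi
    have : ∀ k : Iio i, l k ≤ Cardinal.sum fun j : Iio i => l j :=
      fun k => le_sum (fun j : Iio i => l j) k
    exact max_le ((hlκ j).trans (this ⟨j, hj⟩)) (ciSup_le' this)

namespace Levels

variable {lam κ : Cardinal.{u}} {I : Type u} [LinearOrder I] {l Λ : I → Cardinal.{u}}

lemma infinite (h : Levels lam κ I l Λ) (i : I) : ℵ₀ ≤ Λ i :=
  h.reg.unc.le.trans ((Order.le_succ κ).trans (h.succ_le i))

lemma mono (h : Levels lam κ I l Λ) : Monotone Λ := fun i j hij => by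
  rcases hij.eq_or_lt with rfl | h'
  · rfl
  · exact (Order.le_succ _).trans (h.step _ _ h')

lemma le_sum (h : Levels lam κ I l Λ) : lam ≤ Cardinal.sum Λ := by
  by_contra hcon
  push Not at hcon
  have := h.reg.exists_elt
  obtain ⟨i, hi⟩ := (h.ev _ hcon).exists
  obtain ⟨j, hj⟩ := h.reg.exists_gt i
  exact absurd ((h.step _ _ hj).trans ((Cardinal.le_sum Λ j).trans hi))
    (not_le.2 (Order.lt_succ _))

lemma filtration (h : Levels lam κ I l Λ) {O : Type u} (s : Set O) (hs : #s ≤ lam) :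
    ∃ t : I → Set O, (∀ i, t i ⊆ s) ∧ (∀ i, #(t i) ≤ Λ i) ∧
      ∀ x ∈ s, ∀ᶠ i in Filter.atTop, x ∈ t i := by
  have := h.reg.exists_elt
  obtain ⟨Y, h1, h2, h3, h4⟩ := exists_increasing_cover h.reg.card.le h.reg.unc.le Λ h.mono
    (fun i => (Order.le_succ κ).trans (h.succ_le i)) s (hs.trans h.le_sum)
  refine ⟨Y, h1, h2, fun x hx => ?_⟩
  obtain ⟨j, hj⟩ := h4 x hx
  exact Filter.eventually_atTop.2 ⟨j, fun i hi => h3 hi hj⟩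

lemma split (h : Levels lam κ I l Λ) {X : Type u} {i : I} (hi : ¬IsMin i) (s : Set X)
    (hs : #s ≤ Λ i) : ∃ Y : I → Set X, (∀ j, #(Y j) ≤ l j) ∧ (∀ j, Y j ⊆ s) ∧
      ∀ x ∈ s, ∃ j < i, ∀ j' < i, j ≤ j' → x ∈ Y j' := by
  obtain ⟨Y, h1, h2, h3, h4⟩ := exists_increasing_cover (K := Iio i)
    ((mk_set_le _).trans h.reg.card.le) h.reg.unc.le (fun j => l j)
    (fun a b hab => h.mono' hab) (fun j => h.le' j) s (hs.trans (h.cover i hi))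
  refine ⟨fun j => {x | ∃ hj : j < i, x ∈ Y ⟨j, hj⟩}, fun j => ?_,
    fun j x hx => h1 _ hx.2, fun x hx => ?_⟩
  · by_cases hj : j < i
    · exact (mk_le_mk_of_subset fun x hx => hx.2).trans (h2 ⟨j, hj⟩)
    · have : {x | ∃ hj : j < i, x ∈ Y ⟨j, hj⟩} = ∅ := by
        ext x
        simp [hj]
      exact (mk_le_mk_of_subset this.le).trans (by simp)
  · obtain ⟨j, hj⟩ := h4 x hx
    exact ⟨j, j.2, fun j' hj' hle => ⟨hj', h3 (a := j) (b := ⟨j', hj'⟩) hle hj⟩⟩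

end Levels

/-- The initial ordinal of `Λ⁺` as a type. -/
abbrev SuccType (Λ : Cardinal.{u}) : Type u := (Order.succ Λ).ord.ToType

lemma isReg_succType {Λ : Cardinal.{u}} (h : ℵ₀ ≤ Λ) : IsReg (SuccType Λ) (Order.succ Λ) :=
  isReg_ord_toType (isRegular_succ h) (h.trans_lt (Order.lt_succ Λ))

/-- `E` is a closed cofinal subset of `Iio δ` of size less than `lam`. -/
structure ClosedCofinal {O : Type u} [LinearOrder O] (lam : Cardinal.{u}) (E : Set O) (δ : O) :
    Prop where
  sub : E ⊆ Iio δ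
  card : #E < lam
  cof : ∀ y < δ, ∃ z ∈ E, y ≤ z
  cl : ∀ p < δ, ¬IsMin p → (∀ q < p, ∃ r ∈ E, q < r ∧ r < p) → p ∈ E

section
variable {lam κ : Cardinal.{u}} {I : Type u} [LinearOrder I] {l Λ : I → Cardinal.{u}}
  {O : Type u} [LinearOrder O]

/-- A sequence increasing modulo bounded sets, continuous in a weak sense. -/
structure IsScale (lam : Cardinal.{u}) (Λ : I → Cardinal.{u}) (f : O → ∀ i, SuccType (Λ i)) :
    Prop where
  lt : ∀ ξ δ, ξ < δ → ∀ᶠ i in Filter.atTop, f ξ i < f δ i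
  dom : ∀ δ, (∃ E, ClosedCofinal lam E δ) →
    ∃ E, ClosedCofinal lam E δ ∧ ∀ᶠ i in Filter.atTop, ∀ ξ ∈ E, f ξ i < f δ i

lemma IsScale.le {f : O → ∀ i, SuccType (Λ i)} (hf : IsScale lam Λ f) {ξ δ : O} (h : ξ ≤ δ) :
    ∀ᶠ i in Filter.atTop, f ξ i ≤ f δ i := by
  rcases h.eq_or_lt with rfl | h
  · exact Filter.Eventually.of_forall fun i => le_rfl
  · exact (hf.lt _ _ h).mono fun i hi => hi.le

variable [WellFoundedLT O]

lemma Levels.exists_isScale (h : Levels lam κ I l Λ) (hO : IsReg O (Order.succ lam)) :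
    ∃ f : O → ∀ i, SuccType (Λ i), IsScale lam Λ f := by
  have : ∀ δ : O, ∃ E : Set O, E ⊆ Iio δ ∧ #E < lam ∧
      ((∃ E, ClosedCofinal lam E δ) → ClosedCofinal lam E δ) := fun δ => by
    by_cases hE : ∃ E, ClosedCofinal lam E δ
    · obtain ⟨E, hE⟩ := hE
      exact ⟨E, hE.sub, hE.card, fun _ => hE⟩
    · refine ⟨∅, by simp, ?_, fun h => absurd h hE⟩
      obtain ⟨i⟩ := h.reg.exists_elt
      simpa using aleph0_pos.trans_le ((h.infinite i).trans (h.lt i).le)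
  choose E hE hEc hE' using this
  choose t ht htc hte using fun δ : O => h.filtration (Iio δ) (Order.le_of_lt_succ (hO.small δ))
  let a : O → I → Set O := fun δ i => t δ i ∪ {x | x ∈ E δ ∧ #(E δ) ≤ Λ i}
  have ha : ∀ δ i, #(a δ i) ≤ Λ i := fun δ i => by
    refine (mk_union_le _ _).trans ?_
    refine add_le_of_le (h.infinite i) (htc δ i) ?_
    by_cases hc : #(E δ) ≤ Λ i
    · exact (mk_le_mk_of_subset fun x hx => hx.1).trans hc
    · have : {x | x ∈ E δ ∧ #(E δ) ≤ Λ i} ⊆ ∅ := fun x hx => absurd hx.2 hc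
      exact (mk_le_mk_of_subset this).trans (by simp)
  have ha' : ∀ δ i, a δ i ⊆ Iio δ := fun δ i => union_subset (ht δ i) fun x hx => hE δ hx.1
  obtain ⟨f, hf⟩ := exists_wf_rec (T := O) (X := ∀ i, SuccType (Λ i))
    (fun δ f q => ∀ i, ∀ ξ : Iio δ, ξ.1 ∈ a δ i → f ξ i < q i) (fun δ f => by
      have : ∀ i, ∃ q : SuccType (Λ i), ∀ ξ : Iio δ, ξ.1 ∈ a δ i → f ξ i < q := fun i => by
        obtain ⟨q, hq⟩ := (isReg_succType (h.infinite i)).bddRange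
          (fun ξ : a δ i => f ⟨ξ, ha' δ i ξ.2⟩ i) (Order.lt_succ_of_le (ha δ i))
        exact ⟨q, fun ξ hξ => hq ⟨ξ, hξ⟩⟩
      choose q hq using this
      exact ⟨q, hq⟩)
  refine ⟨f, fun ξ δ hξ => ?_, fun δ hδ => ⟨E δ, hE' δ hδ, ?_⟩⟩
  · filter_upwards [hte δ ξ hξ] with i hi
    exact hf δ i ⟨ξ, hξ⟩ (Or.inl hi)
  · filter_upwards [h.ev _ (hEc δ)] with i hi ξ hξ
    exact hf δ i ⟨ξ, hE δ hξ⟩ (Or.inr ⟨hξ, hi⟩)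

/-- The cuts determined by a scale in small sets stabilize. -/
lemma IsScale.stable (h : Levels lam κ I l Λ) (hO : IsReg O (Order.succ lam))
    {f : O → ∀ i, SuccType (Λ i)} (hf : IsScale lam Λ f) {ν : Cardinal.{u}} (hκν : κ ≤ ν)
    (hν : ν < lam) (z : ∀ i, Set (SuccType (Λ i))) (hz : ∀ i, #(z i) ≤ ν) :
    ∃ β0, ∀ β, β0 ≤ β → ∀ᶠ i in Filter.atTop, ∀ x ∈ z i, (f β0 i ≤ x ↔ f β i ≤ x) := by
  by_contra hcon
  simp only [not_exists, not_forall, exists_prop] at hcon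
  have hνω : ℵ₀ ≤ ν := h.reg.unc.le.trans hκν
  have hJ : IsReg (SuccType (Order.succ (Order.succ ν))) _ :=
    isReg_succType (hνω.trans ((Order.le_succ _).trans (Order.le_succ _)))
  set J := SuccType (Order.succ (Order.succ ν))
  obtain ⟨C, hC⟩ := hJ.club_guess_directed hνω (Order.lt_succ _)
  have hJlam : #J < lam := by rw [hJ.card]; exact h.lim _ (h.lim _ (h.lim _ hν))
  have hJO : #J < Order.succ lam := hJlam.trans (Order.lt_succ _)
  obtain ⟨x, hx⟩ := exists_wf_rec (T := J) (X := O × O)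
    (fun ε g q => (∀ ε', (g ε').2 ≤ q.1) ∧ (∀ y < q.1, ∃ ε', y < (g ε').2) ∧ q.1 < q.2 ∧
      (∀ α : J, (∃ η, ∀ᶠ i in Filter.atTop, ∀ ε' : Iio ε, ε'.1 ∈ C α → f (g ε').1 i < f η i) →
        ∃ η ≤ q.2, ∀ᶠ i in Filter.atTop, ∀ ε' : Iio ε, ε'.1 ∈ C α → f (g ε').1 i < f η i) ∧
      ∃ β ≤ q.2, q.1 ≤ β ∧ ¬∀ᶠ i in Filter.atTop, ∀ x ∈ z i, (f q.1 i ≤ x ↔ f β i ≤ x))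
    (fun ε g => by
      obtain ⟨b0, hb0⟩ := hO.bddRange (fun ε' => (g ε').2) ((mk_set_le _).trans_lt hJO)
      obtain ⟨q1, h1, hmin⟩ := WellFounded.has_min (wellFounded_lt (α := O))
        {b | ∀ ε', (g ε').2 ≤ b} ⟨b0, fun ε' => (hb0 ε').le⟩
      obtain ⟨β, hβ, hβ'⟩ := hcon q1
      have : ∀ α : J, ∃ η,
          (∃ η, ∀ᶠ i in Filter.atTop, ∀ ε' : Iio ε, ε'.1 ∈ C α → f (g ε').1 i < f η i) →
          ∀ᶠ i in Filter.atTop, ∀ ε' : Iio ε, ε'.1 ∈ C α → f (g ε').1 i < f η i := fun α => by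
        by_cases hα :
          ∃ η, ∀ᶠ i in Filter.atTop, ∀ ε' : Iio ε, ε'.1 ∈ C α → f (g ε').1 i < f η i
        · obtain ⟨η, hη⟩ := hα
          exact ⟨η, fun _ => hη⟩
        · exact ⟨q1, fun h => absurd h hα⟩
      choose η hη using this
      obtain ⟨b1, hb1⟩ := hO.bddRange η hJO
      obtain ⟨q2, hq2⟩ := hO.exists_gt (max b1 (max q1 β))
      rw [max_lt_iff, max_lt_iff] at hq2
      refine ⟨(q1, q2), h1, fun y hy => ?_, hq2.2.1,
        fun α hα => ⟨η α, ((hb1 α).trans hq2.1).le, hη α hα⟩, β, hq2.2.2.le, hβ, hβ'⟩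
      by_contra hy'
      push Not at hy'
      exact hmin y hy' hy)
  have hnx : ∀ ε' ε, ε' < ε → (x ε').2 ≤ (x ε).1 := fun ε' ε hε => (hx ε).1 ⟨ε', hε⟩
  have hlt : ∀ ε' ε, ε' < ε → (x ε').1 < (x ε).1 := fun ε' ε hε =>
    (hx ε').2.2.1.trans_le (hnx _ _ hε)
  have hmono : StrictMono fun ε => (x ε).1 := fun ε' ε hε => hlt _ _ hε
  have hcont : ∀ ε, ∀ y < (x ε).1, ∃ ε' < ε, y < (x ε').2 := fun ε y hy => by
    obtain ⟨ε', h'⟩ := (hx ε).2.1 y hy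
    exact ⟨ε', ε'.2, h'⟩
  obtain ⟨δ, hδ1, hδ2⟩ := hO.exists_lsub (fun ε => (x ε).1) hJO
  obtain ⟨E, hE, hEdom⟩ := hf.dom δ ⟨range fun ε => (x ε).1, by
    refine ⟨by rintro _ ⟨ε, rfl⟩; exact hδ1 ε, mk_range_le.trans_lt hJlam, fun y hy => ?_,
      fun p hp _ hlim => ?_⟩
    · obtain ⟨ε, hε⟩ := hδ2 y hy
      exact ⟨_, ⟨ε, rfl⟩, hε⟩
    · obtain ⟨ε, hε, hmin⟩ := WellFounded.has_min (wellFounded_lt (α := J)) {ε | p ≤ (x ε).1}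
        (hδ2 p hp)
      rcases (show p ≤ (x ε).1 from hε).eq_or_lt with h' | h'
      · exact ⟨ε, h'.symm⟩
      · obtain ⟨ε', hε', hp'⟩ := hcont ε p h'
        have : (x ε').1 < p := not_le.1 fun h'' => hmin ε' h'' hε'
        obtain ⟨_, ⟨ε'', rfl⟩, h1, h2⟩ := hlim _ this
        exact absurd (hp'.trans_le (hnx _ _ (hmono.lt_iff_lt.1 h1))) h2.le.not_gt⟩
  have : ∀ ε, ∃ g, ∃ e ∈ E, (x ε).1 ≤ e ∧ e < (x g).1 := fun ε => by
    obtain ⟨e, he, hle⟩ := hE.cof _ (hδ1 ε)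
    obtain ⟨g, hg⟩ := hδ2 e (hE.sub he)
    obtain ⟨g', hg'⟩ := hJ.exists_gt g
    exact ⟨g', e, he, hle, hg.trans_lt (hlt _ _ hg')⟩
  choose G hG using this
  have hGgt : ∀ ε, ε < G ε := fun ε => by
    obtain ⟨e, -, h1, h2⟩ := hG ε
    exact hmono.lt_iff_lt.1 (h1.trans_lt h2)
  obtain ⟨α, hα, hdir⟩ := hC _ (hJ.club_closed G)
  have hCE : ∀ ε ∈ C α, (x ε).1 ∈ E := fun ε hε => by
    obtain ⟨hmin, hcl⟩ := hα hε
    obtain ⟨ε0, hε0⟩ := not_isMin_iff.1 hmin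
    refine hE.cl _ (hδ1 ε) (not_isMin_of_gt (hlt _ _ hε0)) fun q hq => ?_
    obtain ⟨ε', hε', hq'⟩ := hcont ε q hq
    obtain ⟨e, he, h1, h2⟩ := hG (G ε')
    exact ⟨e, he, (hq'.trans_le (hnx _ _ (hGgt ε'))).trans_le h1,
      h2.trans (hlt _ _ (hcl _ (hcl _ hε')))⟩
  have : ∀ w : (Σ i, z i), ∃ ε, (∃ ε ∈ C α, w.2.1 < f (x ε).1 w.1) →
      ε ∈ C α ∧ w.2.1 < f (x ε).1 w.1 := fun w => by
    by_cases hw : ∃ ε ∈ C α, w.2.1 < f (x ε).1 w.1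
    · obtain ⟨ε, hε⟩ := hw
      exact ⟨ε, fun _ => hε⟩
    · obtain ⟨ε⟩ := hJ.exists_elt
      exact ⟨ε, fun h => absurd h hw⟩
  choose r hr using this
  have hcard : #(Σ i, z i) ≤ ν := by
    rw [mk_sigma]
    refine (sum_le_sum _ (fun _ => ν) hz).trans ?_
    rw [sum_const', h.reg.card]
    exact (mul_le_mul_left hκν _).trans (mul_eq_self hνω).le
  obtain ⟨ε2, hε2, hr2⟩ := hdir (range r ∩ C α) inter_subset_right
    ((mk_le_mk_of_subset inter_subset_left).trans (mk_range_le.trans hcard))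
  have hnext : ∀ ε ∈ C α, ∃ ε' ∈ C α, ε < ε' := fun ε hε => by
    obtain ⟨ε', h1, h2⟩ := hdir {ε} (by simpa using hε) (by simpa using one_le_aleph0.trans hνω)
    exact ⟨ε', h1, h2 ε rfl⟩
  obtain ⟨ε3, hε3, h23⟩ := hnext _ hε2
  obtain ⟨ε4, hε4, h34⟩ := hnext _ hε3
  obtain ⟨η, hη, hηdom⟩ := (hx ε2).2.2.2.1 α ⟨δ, hEdom.mono fun i hi ε' hε' => hi _ (hCE _ hε')⟩
  obtain ⟨β, hβ, hβ', hne⟩ := (hx ε3).2.2.2.2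
  refine hne ?_
  filter_upwards [hηdom, hf.le (hη.trans (hnx _ _ h23)), hf.le hβ', hf.le (hβ.trans (hnx _ _ h34))]
    with i h1 h2 h3 h4 y hy
  refine ⟨fun hle => h4.trans ?_, fun hle => h3.trans hle⟩
  by_contra hlt'
  obtain ⟨h5, h6⟩ := hr ⟨i, y, hy⟩ ⟨ε4, hε4, not_le.1 hlt'⟩
  have h7 := h1 ⟨r ⟨i, y, hy⟩, hr2 _ ⟨⟨_, rfl⟩, h5⟩⟩ h5
  exact absurd (h6.trans h7) (h2.trans hle).not_gt

lemma IsScale.unbounded [WellFoundedLT I] (h : Levels lam κ I l Λ) (hO : IsReg O (Order.succ lam))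
    {f : O → ∀ i, SuccType (Λ i)} (hf : IsScale lam Λ f) (χ : ∀ i, SuccType (Λ i)) (b : O) :
    ∃ β, b ≤ β ∧ ∃ᶠ i in Filter.atTop, χ i < f β i := by
  by_contra hcon
  push Not at hcon
  have : ∀ i, ∃ Y : I → Set (SuccType (Λ i)), (∀ j, #(Y j) ≤ l j) ∧
      (¬IsMin i → ∀ x ≤ χ i, ∃ j < i, x ∈ Y j) := fun i => by
    by_cases hi : IsMin i
    · exact ⟨fun _ => ∅, by simp, fun h => absurd hi h⟩
    · obtain ⟨Y, h1, -, h2⟩ := h.split hi (Iic (χ i))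
        (Order.le_of_lt_succ ((isReg_succType (h.infinite i)).small_Iic _))
      refine ⟨Y, h1, fun _ x hx => ?_⟩
      obtain ⟨j, hj, hj'⟩ := h2 x hx
      exact ⟨j, hj, hj' j hj le_rfl⟩
  choose Y hY hY' using this
  choose B hB using fun j => hf.stable h hO (h.le' j) (h.lt' j) (fun i => Y i j) (fun i => hY i j)
  have hκlam : κ < Order.succ lam := by
    obtain ⟨i⟩ := h.reg.exists_elt
    exact (h.le' i).trans_lt ((h.lt' i).trans (Order.lt_succ _))
  obtain ⟨β0, hβ0⟩ := hO.bddRange B (by rw [h.reg.card]; exact hκlam)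
  set β := max β0 b
  obtain ⟨β', hβ'⟩ := hO.exists_gt β
  have hne := h.reg.exists_elt
  obtain ⟨i0, hi0⟩ := Filter.eventually_atTop.1 (hcon β (le_max_right _ _))
  obtain ⟨j, -, hj⟩ := h.reg.pressing_down (K := PUnit.{u+1})
    (by simpa using one_lt_aleph0.trans h.reg.unc) (fun j _ i => f β i ∈ Y i j) (fun E hE => by
      obtain ⟨i1, hi1⟩ := h.reg.exists_gt i0
      obtain ⟨i, hi, hle⟩ := hE.unb i1
      obtain ⟨j, hj, h'⟩ := hY' i (not_isMin_of_gt (hi1.trans_le hle)) _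
        (hi0 i (hi1.le.trans hle))
      exact ⟨i, hi, j, hj, PUnit.unit, h'⟩)
  have hBβ : B j ≤ β := (hβ0 j).le.trans (le_max_left _ _)
  obtain ⟨i2, hi2⟩ := Filter.eventually_atTop.1
    (((hB j β hBβ).and (hB j β' (hBβ.trans hβ'.le))).and (hf.lt _ _ hβ'))
  obtain ⟨i, hi, -, hmem⟩ := hj _ (h.reg.club_Ioi i2)
  obtain ⟨⟨h1, h2⟩, h3⟩ := hi2 i (le_of_lt hi)
  exact absurd ((h2 _ hmem).1 ((h1 _ hmem).2 le_rfl)) h3.not_ge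

/-- A sequence of functions which, on an unbounded set of coordinates, eventually dominates
every function. -/
lemma Levels.exists_dominating [WellFoundedLT I] (h : Levels lam κ I l Λ)
    (hO : IsReg O (Order.succ lam)) :
    ∃ (f : O → ∀ i, SuccType (Λ i)) (D : Set I), (∃ᶠ i in Filter.atTop, i ∈ D) ∧
      ∀ χ : ∀ i, SuccType (Λ i), ∃ b, ∀ β, b ≤ β → ∀ᶠ i in Filter.atTop, i ∈ D → χ i < f β i := by
  obtain ⟨f, hf⟩ := h.exists_isScale hO
  have hne := h.reg.exists_elt
  have hκlam : Order.succ κ < lam := by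
    obtain ⟨i⟩ := hne
    exact (h.succ_le i).trans_lt (h.lt i)
  have hM := fun i => isReg_succType (h.infinite i)
  choose B hB using fun χ : ∀ i, SuccType (Λ i) => hf.stable h hO le_rfl
    ((Order.lt_succ κ).trans hκlam) (fun i => {χ i})
    (fun i => by simpa using one_le_aleph0.trans h.reg.unc.le)
  let D : (∀ i, SuccType (Λ i)) → Set I := fun χ => {i | χ i < f (B χ) i}
  have hD : ∀ χ β, B χ ≤ β → ∀ᶠ i in Filter.atTop, (i ∈ D χ ↔ χ i < f β i) := fun χ β hβ => by
    filter_upwards [hB χ β hβ] with i hi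
    have := hi (χ i) rfl
    show χ i < f (B χ) i ↔ _
    rw [← not_le, ← not_le, this]
  have hDfreq : ∀ χ, ∃ᶠ i in Filter.atTop, i ∈ D χ := fun χ => by
    obtain ⟨β, hβ, hfr⟩ := hf.unbounded h hO χ (B χ)
    exact (hfr.and_eventually (hD χ β hβ)).mono fun i hi => hi.2.2 hi.1
  have key : ∃ χ0, ∀ χ : ∀ i, SuccType (Λ i), (∀ i, χ0 i ≤ χ i) →
      ∀ᶠ i in Filter.atTop, i ∈ D χ0 → i ∈ D χ := by
    by_contra hcon
    push Not at hcon
    choose Ψ hΨ hΨ' using hcon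
    obtain ⟨χ, hχ⟩ := exists_wf_rec (T := SuccType κ) (X := ∀ i, SuccType (Λ i))
      (fun ξ g q => ∀ i η, Ψ (g η) i < q i) (fun ξ g => by
        have : ∀ i, ∃ q, ∀ η, Ψ (g η) i < q := fun i =>
          (hM i).bddRange _ (((isReg_succType h.reg.unc.le).small ξ).trans_le
            ((h.succ_le i).trans (Order.le_succ _)))
        choose q hq using this
        exact ⟨q, hq⟩)
    have hTlam : #(SuccType κ) < Order.succ lam := by
      rw [(isReg_succType h.reg.unc.le).card]
      exact hκlam.trans (Order.lt_succ _)
    obtain ⟨b1, hb1⟩ := hO.bddRange (fun ξ => B (χ ξ)) hTlam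
    obtain ⟨b2, hb2⟩ := hO.bddRange (fun ξ => B (Ψ (χ ξ))) hTlam
    have : ∀ ξ, ∃ i, χ ξ i < f (max b1 b2) i ∧ f (max b1 b2) i ≤ Ψ (χ ξ) i := fun ξ => by
      obtain ⟨i, ⟨h1, h2⟩, h3, h4⟩ := ((hΨ' (χ ξ)).and_eventually
        ((hD (χ ξ) _ ((hb1 ξ).le.trans (le_max_left _ b2))).and
          (hD (Ψ (χ ξ)) _ ((hb2 ξ).le.trans (le_max_right b1 _))))).exists
      exact ⟨i, h3.1 h1, not_lt.1 fun h => h2 (h4.2 h)⟩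
    choose k hk1 hk2 using this
    have hinj : Function.Injective k := by
      have aux : ∀ ξ ξ', ξ < ξ' → k ξ ≠ k ξ' := fun ξ ξ' hξ heq => by
        have h1 := hk2 ξ
        have h2 := hk1 ξ'
        rw [← heq] at h2
        exact absurd (h1.trans_lt ((hχ ξ' (k ξ) ⟨ξ, hξ⟩).trans h2)) (lt_irrefl _)
      intro ξ ξ' heq
      by_contra hne
      rcases lt_or_gt_of_ne hne with h' | h'
      · exact aux _ _ h' heq
      · exact aux _ _ h' heq.symm
    have := mk_le_of_injective hinj
    rw [(isReg_succType h.reg.unc.le).card, h.reg.card] at this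
    exact absurd this (not_le.2 (Order.lt_succ κ))
  obtain ⟨χ0, hχ0⟩ := key
  refine ⟨f, D χ0, hDfreq χ0, fun χ => ⟨B fun i => max (χ i) (χ0 i), fun β hβ => ?_⟩⟩
  filter_upwards [hχ0 (fun i => max (χ i) (χ0 i)) (fun i => le_max_right _ _), hD _ β hβ]
    with i h1 h2 hi
  exact (le_max_left _ _).trans_lt (h2.1 (h1 hi))

lemma IsReg.exists_frequent_map {K : Type u} (hI : IsReg I κ) (hK : #K ≤ κ) {D : Set I}
    (hD : ∃ᶠ i in Filter.atTop, i ∈ D) [Nonempty K] :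
    ∃ π : I → K, ∀ k, ∃ᶠ i in Filter.atTop, i ∈ D ∧ π i = k := by
  have hne := hI.exists_elt
  have hDc : #D = κ := by
    refine le_antisymm ((mk_set_le _).trans hI.card.le) (not_lt.1 fun hlt => ?_)
    obtain ⟨b, hb⟩ := hI.bdd D hlt
    obtain ⟨i, hi, hiD⟩ := Filter.frequently_atTop.1 hD b
    exact absurd (hb i hiD) (not_lt.2 hi)
  have : #(K × I) = #D := by
    rw [hDc, mk_prod, Cardinal.lift_id, Cardinal.lift_id, hI.card]
    exact mul_eq_right hI.unc.le hK (mk_ne_zero K)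
  obtain ⟨e⟩ := Cardinal.eq.1 this
  classical
  refine ⟨fun i => if hi : i ∈ D then (e.symm ⟨i, hi⟩).1 else Classical.arbitrary K,
    fun k => Filter.frequently_atTop.2 fun i0 => ?_⟩
  by_contra hcon
  push Not at hcon
  have hlt : ∀ t, (e (k, t)).1 < i0 := fun t => by
    by_contra hge
    refine hcon (e (k, t)) (not_lt.1 hge) (e (k, t)).2 ?_
    simp
  have hinj : Function.Injective fun t => (⟨(e (k, t)).1, hlt t⟩ : Iio i0) := fun t t' h => by
    have := e.injective (Subtype.ext (Subtype.mk.inj h))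
    exact (Prod.mk.inj this).2
  exact absurd (mk_le_of_injective hinj) (not_le.2 (by rw [hI.card]; exact hI.small i0))

/-- A colouring of pairs taking all values on `A × {β}` for every unbounded `A` and large `β`. -/
lemma Levels.exists_colouring [WellFoundedLT I] (h : Levels lam κ I l Λ)
    (hO : IsReg O (Order.succ lam)) :
    ∃ c : O → O → I × I, ∀ A : Set O, (∀ p, ∃ α ∈ A, p ≤ α) →
      ∃ b, ∀ β, b ≤ β → ∀ k, ∃ α ∈ A, α < b ∧ c α β = k := by
  obtain ⟨f, D, hD, hdom⟩ := h.exists_dominating hO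
  have hne := h.reg.exists_elt
  have hM := fun i => isReg_succType (h.infinite i)
  have hKc : #(I × I) ≤ κ := by
    rw [← mul_def, h.reg.card]
    exact (mul_eq_self h.reg.unc.le).le
  obtain ⟨π, hπ⟩ := h.reg.exists_frequent_map hKc hD
  classical
  refine ⟨fun α β => if hi : ∃ i, IsGreatest {i | i ∈ D ∧ f β i ≤ f α i} i then π hi.choose
    else Classical.arbitrary _, fun A hA => ?_⟩
  obtain ⟨α0, hα0, -⟩ := hA (hO.exists_elt.some)
  have : ∀ i (m : SuccType (Λ i)), ∃ α ∈ A, (∃ α ∈ A, m ≤ f α i) → m ≤ f α i := fun i m => by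
    by_cases hm : ∃ α ∈ A, m ≤ f α i
    · obtain ⟨α, h1, h2⟩ := hm
      exact ⟨α, h1, fun _ => h2⟩
    · exact ⟨α0, hα0, fun h => absurd h hm⟩
  choose n hnA hn using this
  have hunb : ∀ᶠ i in Filter.atTop, i ∈ D → ∀ m, ∃ α ∈ A, m ≤ f α i := by
    have : ∀ i, ∃ m, (∃ α ∈ A, m ≤ f α i) → ∀ m, ∃ α ∈ A, m ≤ f α i := fun i => by
      by_cases hi : ∀ m, ∃ α ∈ A, m ≤ f α i
      · exact ⟨f α0 i, fun _ => hi⟩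
      · push Not at hi
        obtain ⟨m, hm⟩ := hi
        exact ⟨m, fun ⟨α, h1, h2⟩ => absurd h2 (not_le.2 (hm α h1))⟩
    choose χ hχ using this
    obtain ⟨b, hb⟩ := hdom χ
    obtain ⟨β, hβA, hβ⟩ := hA b
    filter_upwards [hb β hβ] with i hi hiD
    exact hχ i ⟨β, hβA, (hi hiD).le⟩
  have : ∀ j, ∃ χ : SuccType (Λ j), ∀ i < j, ∀ m, f (n i m) j < χ := fun j => by
    obtain ⟨χ, hχ⟩ := (hM j).bddRange (fun w : Σ i : Iio j, SuccType (Λ i) => f (n w.1 w.2) j) (by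
      rw [mk_sigma]
      refine lt_of_le_of_lt ((sum_le_sum _ (fun _ => Λ j) fun i => ?_).trans ?_) (Order.lt_succ _)
      · rw [(hM i).card]
        exact h.step _ _ i.2
      · rw [sum_const']
        exact (mul_le_mul_left ((mk_set_le _).trans (h.reg.card.le.trans
          ((Order.le_succ κ).trans (h.succ_le j)))) _).trans (mul_eq_self (h.infinite j)).le)
    exact ⟨χ, fun i hi m => hχ ⟨⟨i, hi⟩, m⟩⟩
  choose χ hχ using this
  obtain ⟨b1, hb1⟩ := hdom χ
  obtain ⟨b2, hb2⟩ := hO.bddRange (fun w : Σ i, SuccType (Λ i) => n w.1 w.2) (by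
    rw [mk_sigma]
    refine lt_of_le_of_lt ((sum_le_sum _ (fun _ => lam) fun i => ?_).trans ?_) (Order.lt_succ _)
    · rw [(hM i).card]
      exact Order.succ_le_of_lt (h.lt i)
    · rw [sum_const', h.reg.card]
      obtain ⟨i⟩ := hne
      have := ((Order.le_succ κ).trans (h.succ_le i)).trans (h.lt i).le
      exact (mul_le_mul_left this _).trans (mul_eq_self (h.reg.unc.le.trans this)).le)
  refine ⟨max b1 b2, fun β hβ k => ?_⟩
  obtain ⟨i, ⟨hiD, hik⟩, hi1, hi2⟩ := ((hπ k).and_eventually (hunb.and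
    (Filter.eventually_atTop.2 ((Filter.eventually_atTop.1
      (hb1 β ((le_max_left _ _).trans hβ))).imp fun i0 h0 i hi j (hj : i ≤ j) =>
        h0 j (hi.trans hj))))).exists
  refine ⟨n i (f β i), hnA _ _, (hb2 ⟨i, _⟩).trans_le (le_max_right _ _), ?_⟩
  have hgr : IsGreatest {j | j ∈ D ∧ f β j ≤ f (n i (f β i)) j} i :=
    ⟨⟨hiD, hn i _ (hi1 hiD _)⟩, fun j hj => not_lt.1 fun hlt =>
      absurd hj.2 (not_le.2 ((hχ j i hlt _).trans (hi2 j hlt.le hj.1)))⟩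
  have hex : ∃ i', IsGreatest {j | j ∈ D ∧ f β j ≤ f (n i (f β i)) j} i' := ⟨i, hgr⟩
  show (if hi : ∃ i', IsGreatest {j | j ∈ D ∧ f β j ≤ f (n i (f β i)) j} i' then π hi.choose
    else Classical.arbitrary _) = k
  rw [dif_pos hex, hex.choose_spec.unique hgr, hik]

end

section
variable {O : Type u} [LinearOrder O]

lemma HasCofLE.mono {x : O} {θ θ' : Cardinal.{u}} (h : HasCofLE x θ) (hθ : θ ≤ θ') :
    HasCofLE x θ' := by
  obtain ⟨s, h1, h2, h3⟩ := h
  exact ⟨s, h1, h2.trans hθ, h3⟩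

lemma exists_bound_of_not_hasCofLE {b : O} {θ : Cardinal.{u}} (h : ¬HasCofLE b θ) {s : Set O}
    (hs : #s ≤ θ) : ∃ y < b, ∀ z ∈ s, z < b → z ≤ y := by
  by_contra hcon
  push Not at hcon
  refine h ⟨s ∩ Iio b, inter_subset_right, (mk_le_mk_of_subset inter_subset_left).trans hs,
    fun y hy => ?_⟩
  obtain ⟨z, hz, hzb, hyz⟩ := hcon y hy
  exact ⟨z, ⟨hz, hzb⟩, hyz.le⟩

open Classical in
/-- The least element of `s`, or the default value `d` if there is none. -/
noncomputable def leastOr (d : O) (s : Set O) : O :=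
  if h : ∃ x, IsLeast s x then h.choose else d

lemma leastOr_eq {d x : O} {s : Set O} (h : IsLeast s x) : leastOr d s = x := by
  have h' : ∃ x, IsLeast s x := ⟨x, h⟩
  rw [leastOr, dif_pos h', h'.choose_spec.unique h]

/-- Decode a pair of ordinals from `α`, `β` and a pair of indices. -/
noncomputable def decode {I : Type u} (a : O → I → Set O) (α β : O) (k : I × I) : O × O :=
  let x := leastOr α (a β k.1 ∩ Ici α)
  let b := leastOr α (a x k.2 ∩ Ici α)
  let η := leastOr α (upperBounds ((a β k.1 ∪ a x k.2) ∩ Iio α))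
  let x' := leastOr α (a α k.1 ∩ Ioi η)
  (leastOr α (a x' k.2 ∩ Ioi η), b)

lemma decode_eq {I : Type u} {a : O → I → Set O} {α β xa xb u v η τ : O} {i j : I}
    (hητ : η ≤ τ) (hτu : τ < u) (hu : u < xa) (hxα : xa < α) (hαv : α < v) (hv : v < xb)
    (h1 : xb ∈ a β i) (h1' : ∀ z ∈ a β i, z < xb → z ≤ η)
    (h2 : xa ∈ a α i) (h2' : ∀ z ∈ a α i, z < xa → z ≤ η)
    (h3 : v ∈ a xb j) (h3' : IsLUB (a xb j ∩ Iio v) τ)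
    (h4 : u ∈ a xa j) (h4' : IsLUB (a xa j ∩ Iio u) τ) : decode a α β (i, j) = (u, v) := by
  have hτα : τ < α := (hτu.trans hu).trans hxα
  have e1 : leastOr α (a β i ∩ Ici α) = xb := leastOr_eq ⟨⟨h1, (hαv.trans hv).le⟩, fun z hz =>
    not_lt.1 fun hlt => absurd ((h1' z hz.1 hlt).trans hητ) (hτα.trans_le hz.2).not_ge⟩
  have e2 : leastOr α (a xb j ∩ Ici α) = v := leastOr_eq ⟨⟨h3, hαv.le⟩, fun z hz =>
    not_lt.1 fun hlt => absurd (h3'.1 ⟨hz.1, hlt⟩) (hτα.trans_le hz.2).not_ge⟩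
  have e3 : leastOr α (upperBounds ((a β i ∪ a xb j) ∩ Iio α)) = τ := by
    refine leastOr_eq ⟨?_, fun w hw => h3'.2 fun z hz => hw ⟨Or.inr hz.1, ?_⟩⟩
    · rintro z ⟨hz | hz, hzα⟩
      · exact (h1' z hz (lt_trans hzα (hαv.trans hv))).trans hητ
      · exact h3'.1 ⟨hz, lt_trans hzα hαv⟩
    · exact (h3'.1 hz).trans_lt hτα
  have e4 : leastOr α (a α i ∩ Ioi τ) = xa := leastOr_eq ⟨⟨h2, hτu.trans hu⟩, fun z hz =>
    not_lt.1 fun hlt => absurd ((h2' z hz.1 hlt).trans hητ) (not_le.2 hz.2)⟩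
  have e5 : leastOr α (a xa j ∩ Ioi τ) = u := leastOr_eq ⟨⟨h4, hτu⟩, fun z hz =>
    not_lt.1 fun hlt => absurd (h4'.1 ⟨hz.1, hlt⟩) (not_le.2 hz.2)⟩
  simp only [decode, e1, e2, e3, e4, e5]

end

section
variable {lam κ : Cardinal.{u}} {I : Type u} [LinearOrder I] [WellFoundedLT I]
  {l Λ : I → Cardinal.{u}} {O : Type u} [LinearOrder O] [WellFoundedLT O]

/-- The main result on an abstract copy of `lam⁺`. -/
theorem Levels.rectangles (h : Levels lam κ I l Λ) (hO : IsReg O (Order.succ lam)) :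
    ∃ rts : O → O → O × O, ∀ A B : Set O, (∀ p, ∃ α ∈ A, p ≤ α) → (∀ p, ∃ β ∈ B, p ≤ β) →
      ∀ θ < lam, ∃ S : Set O, (∀ E, Club E → (S ∩ E).Nonempty) ∧ (∀ ε ∈ S, ¬HasCofLE ε θ) ∧
        ∀ a ∈ S, ∀ b ∈ S, a < b → ∃ α ∈ A, ∃ β ∈ B, α < β ∧ rts α β = (a, b) := by
  have hne := h.reg.exists_elt
  have hκlam : Order.succ κ < Order.succ lam := by
    obtain ⟨i⟩ := hne
    exact (h.succ_le i).trans_lt ((h.lt i).trans (Order.lt_succ _))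
  have hIlam : #I < Order.succ lam := by
    rw [h.reg.card]
    exact (Order.lt_succ κ).trans hκlam
  obtain ⟨C, hCc, hC⟩ := hO.club_guess h.reg.unc.le h.reg.card.le hκlam Λ h.infinite
    fun i => (h.lim _ (h.lt i)).trans (Order.lt_succ _)
  choose t ht htc hte using fun x : O => h.filtration (Iic x) (Order.le_of_lt_succ (hO.small_Iic x))
  obtain ⟨a, haeq⟩ : ∃ a : O → I → Set O, a = fun x i => ⋃ δ ∈ t x i, C δ i := ⟨_, rfl⟩
  have ha : ∀ x i, #(a x i) ≤ Λ i := fun x i => by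
    rw [haeq]
    exact mk_biUnion_le_of_infinite (h.infinite i) (htc x i) fun δ _ => hCc δ i
  have hCa : ∀ δ x, δ ≤ x → ∀ᶠ i in Filter.atTop, C δ i ⊆ a x i := fun δ x hx => by
    filter_upwards [hte x δ hx] with i hi
    rw [haeq]
    exact subset_biUnion_of_mem (u := fun δ => C δ i) hi
  obtain ⟨c, hc⟩ := h.exists_colouring hO
  refine ⟨fun α β => decode a α β (c α β), fun A B hA hB θ hθ => ?_⟩
  let Tr : O → I → O → O → Prop := fun η i x α =>
    x < α ∧ x ∈ a α i ∧ ∀ z ∈ a α i, z < x → z ≤ η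
  obtain ⟨η0, i1, hX⟩ := hO.pressing_down (K := I) hIlam
    (fun η i x => (∀ p, ∃ α ∈ A, p ≤ α ∧ Tr η i x α) ∧ ∃ β ∈ B, Tr η i x β) (fun E hE => by
      obtain ⟨δ, hδ, hδE⟩ := hC E hE
      obtain ⟨q, hq⟩ := hO.exists_gt δ
      obtain ⟨i0, hi0⟩ := hO.pigeonhole hIlam hA
        (fun α i => δ < α ∧ ∀ j, i ≤ j → C δ j ⊆ a α j) q (fun α _ hqα => by
          obtain ⟨i, hi⟩ := Filter.eventually_atTop.1 (hCa δ α (hq.le.trans hqα))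
          exact ⟨i, hq.trans_le hqα, hi⟩)
      obtain ⟨β, hβB, hqβ⟩ := hB q
      obtain ⟨i0', hi0'⟩ := Filter.eventually_atTop.1 (hCa δ β (hq.le.trans hqβ))
      obtain ⟨γ, hγ⟩ := not_isMin_iff.1 hδ
      obtain ⟨b, hbC, hbE, -, hbδ, hb⟩ := hδE (max i0 i0') γ hγ
      obtain ⟨η, hη⟩ := hO.pigeonhole (K := Iio b)
        (A := {α ∈ A | δ < α ∧ ∀ j, i0 ≤ j → C δ j ⊆ a α j}) (hO.small b)
        (fun p => by
          obtain ⟨α, h1, h2, h3⟩ := hi0 p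
          exact ⟨α, ⟨h1, h3⟩, h2⟩)
        (fun α η => α ∈ A ∧ (δ < α ∧ ∀ j, i0 ≤ j → C δ j ⊆ a α j) ∧
          ∀ z ∈ a α (max i0 i0'), z < b → z ≤ η) b (fun α hα _ => by
            obtain ⟨y, hy, hy'⟩ := exists_bound_of_not_hasCofLE hb (ha α (max i0 i0'))
            exact ⟨⟨y, hy⟩, hα.1, hα.2, hy'⟩)
      obtain ⟨y, hy, hy'⟩ := exists_bound_of_not_hasCofLE hb (ha β (max i0 i0'))
      refine ⟨b, hbE, max η y, max_lt η.2 hy, max i0 i0', fun p => ?_, β, hβB,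
        hbδ.trans (hq.trans_le hqβ), hi0' _ (le_max_right _ _) hbC,
        fun z hz hzb => (hy' z hz hzb).trans (le_max_right _ _)⟩
      obtain ⟨α, -, hpα, hαA, ⟨hδα, h1⟩, h2⟩ := hη p
      exact ⟨α, hαA, hpα, hbδ.trans hδα, h1 _ (le_max_left _ _) hbC,
        fun z hz hzb => (h2 z hz hzb).trans (le_max_left _ _)⟩)
  obtain ⟨τ, i2, hS⟩ := hO.pressing_down (K := I) hIlam
    (fun τ i b => ¬HasCofLE b θ ∧ η0 ≤ τ ∧ ∃ x, ((∀ p, ∃ α ∈ A, p ≤ α ∧ Tr η0 i1 x α) ∧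
      ∃ β ∈ B, Tr η0 i1 x β) ∧ b < x ∧ b ∈ a x i ∧ IsLUB (a x i ∩ Iio b) τ) (fun E hE => by
      obtain ⟨δ, hδ, hδE⟩ := hC _ (hO.club_inter hE (hO.club_Ioi η0))
      obtain ⟨x, hδx, -, hx⟩ := hX _ (hO.club_Ioi δ)
      obtain ⟨i, hi, hθi⟩ := ((hCa δ x (le_of_lt hδx)).and (h.ev θ hθ)).exists
      obtain ⟨γ, hγ⟩ := not_isMin_iff.1 hδ
      obtain ⟨b', hb'C, hb'E, -, hb'δ, -⟩ := hδE i γ hγ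
      obtain ⟨b, hbC, hbE, hb'b, hbδ, hb⟩ := hδE i b' hb'δ
      obtain ⟨y, hy, hy'⟩ := exists_bound_of_not_hasCofLE hb (ha x i)
      obtain ⟨τ, hτ, hmin⟩ := WellFounded.has_min (wellFounded_lt (α := O))
        (upperBounds (a x i ∩ Iio b)) ⟨y, fun z hz => hy' z hz.1 hz.2⟩
      have hlub : IsLUB (a x i ∩ Iio b) τ := ⟨hτ, fun z hz => not_lt.1 (hmin z hz)⟩
      exact ⟨b, hbE.1, τ, (hlub.2 fun z hz => hy' z hz.1 hz.2).trans_lt hy, i,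
        fun h' => hb (h'.mono hθi), (le_of_lt hb'E.2).trans (hτ ⟨hi hb'C, hb'b⟩),
        x, hx, hbδ.trans hδx, hi hbC, hlub⟩)
  have : ∀ u : O, ∃ x g, (∃ x, ((∀ p, ∃ α ∈ A, p ≤ α ∧ Tr η0 i1 x α) ∧
      ∃ β ∈ B, Tr η0 i1 x β) ∧ u < x ∧ u ∈ a x i2 ∧ IsLUB (a x i2 ∩ Iio u) τ) →
      (∃ β ∈ B, Tr η0 i1 x β) ∧ u < x ∧ u ∈ a x i2 ∧ IsLUB (a x i2 ∩ Iio u) τ ∧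
      ∀ β, g ≤ β → ∃ α ∈ A, Tr η0 i1 x α ∧ α < g ∧ c α β = (i1, i2) := fun u => by
    by_cases hu : ∃ x, ((∀ p, ∃ α ∈ A, p ≤ α ∧ Tr η0 i1 x α) ∧
      ∃ β ∈ B, Tr η0 i1 x β) ∧ u < x ∧ u ∈ a x i2 ∧ IsLUB (a x i2 ∩ Iio u) τ
    · obtain ⟨x, ⟨hxA, hxB⟩, hux, hx⟩ := hu
      obtain ⟨g, hg⟩ := hc {α | α ∈ A ∧ Tr η0 i1 x α} (fun p => by
        obtain ⟨α, h1, h2, h3⟩ := hxA p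
        exact ⟨α, ⟨h1, h3⟩, h2⟩)
      refine ⟨x, g, fun _ => ⟨hxB, hux, hx.1, hx.2, fun β hβ => ?_⟩⟩
      obtain ⟨α, ⟨h1, h2⟩, h3, h4⟩ := hg β hβ (i1, i2)
      exact ⟨α, h1, h2, h3, h4⟩
    · exact ⟨u, u, fun h => absurd h hu⟩
  choose X G hXG using this
  refine ⟨{b | ¬HasCofLE b θ ∧ τ < b ∧ (∀ y < b, G y < b) ∧
    ∃ x, ((∀ p, ∃ α ∈ A, p ≤ α ∧ Tr η0 i1 x α) ∧
      ∃ β ∈ B, Tr η0 i1 x β) ∧ b < x ∧ b ∈ a x i2 ∧ IsLUB (a x i2 ∩ Iio b) τ},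
    fun E hE => ?_, fun b hb => hb.1, fun u hu v hv huv => ?_⟩
  · obtain ⟨b, hb, hτb, h1, -, h2⟩ := hS _ (hO.club_inter hE (hO.club_closed G))
    exact ⟨b, ⟨h1, hτb, hb.2.2, h2⟩, hb.1⟩
  · have hη0τ : η0 ≤ τ := by
      obtain ⟨b, -, -, -, h2, -⟩ := hS _ (hO.club_Ioi τ)
      exact h2
    obtain ⟨-, hux, hua, hulub, hcol⟩ := hXG u hu.2.2.2
    obtain ⟨⟨β, hβB, hvβ, hβ1, hβ2⟩, hvx, hva, hvlub, -⟩ := hXG v hv.2.2.2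
    have hGv := hv.2.2.1 u huv
    obtain ⟨α, hαA, ⟨hxα, hα1, hα2⟩, hαG, hcα⟩ := hcol β ((hGv.trans hvx).trans hvβ).le
    refine ⟨α, hαA, β, hβB, (hαG.trans hGv).trans (hvx.trans hvβ), ?_⟩
    change decode a α β (c α β) = (u, v)
    rw [hcα]
    exact decode_eq hη0τ hu.2.1 hux hxα (hαG.trans hGv) hvx hβ1 hβ2 hα1 hα2 hva hvlub hua hulub

end

theorem rectangles_into_squares_case (lam : Cardinal)
    (hcof : Cardinal.aleph0 < lam.ord.cof) (hsing : lam.ord.cof < lam) :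
    ∃ rts : Ordinal → Ordinal → Ordinal × Ordinal,
      ∀ A B : Set Ordinal,
        IsCofinalIn A (Order.succ lam).ord → IsCofinalIn B (Order.succ lam).ord →
        ∀ θ : Cardinal, θ < lam →
          ∃ S : Set Ordinal, IsStationaryIn S (Order.succ lam).ord ∧
            (∀ ε ∈ S, θ < Ordinal.cof ε) ∧
            ∀ a ∈ S, ∀ b ∈ S, a < b →
              ∃ α ∈ A, ∃ β ∈ B, α < β ∧ rts α β = (a, b) := by
  obtain ⟨l, Λ, hL⟩ := exists_levels hcof hsing
  have hlam : ℵ₀ ≤ lam := (hcof.trans hsing).le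
  have hO := isReg_succType hlam
  obtain ⟨rts, hrts⟩ := hL.rectangles hO
  let φ : SuccType lam → Ordinal := fun x => (ToType.mk.symm x).1
  have hφo : ∀ x, φ x < (Order.succ lam).ord := fun x => (ToType.mk.symm x).2
  have hφ : ∀ x y, φ x < φ y ↔ x < y := fun x y => by
    rw [← (ToType.mk (o := (Order.succ lam).ord)).symm.lt_iff_lt]
    rfl
  have hφ' : ∀ x y, φ x ≤ φ y ↔ x ≤ y := fun x y => by
    rw [← not_lt, hφ, not_lt]
  have hsurj : ∀ p < (Order.succ lam).ord, ∃ x, φ x = p := fun p hp =>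
    ⟨ToType.mk ⟨p, hp⟩, by simp [φ]⟩
  have hinj : ∀ x y, φ x = φ y → x = y := fun x y hxy =>
    le_antisymm ((hφ' _ _).1 hxy.le) ((hφ' _ _).1 hxy.ge)
  have hcofin : ∀ A, IsCofinalIn A (Order.succ lam).ord → ∀ p, ∃ α ∈ φ ⁻¹' A, p ≤ α := by
    intro A hA p
    obtain ⟨q, hq, hpq⟩ := hA.2 _ (hφo p)
    obtain ⟨x, rfl⟩ := hsurj q (hA.1 hq)
    exact ⟨x, hq, (hφ' _ _).1 hpq⟩
  have : ∀ α β, ∃ r : Ordinal × Ordinal, ∀ x y, φ x = α → φ y = β →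
      r = (φ (rts x y).1, φ (rts x y).2) := fun α β => by
    by_cases hαβ : ∃ x y, φ x = α ∧ φ y = β
    · obtain ⟨x, y, rfl, rfl⟩ := hαβ
      refine ⟨(φ (rts x y).1, φ (rts x y).2), fun x' y' hx hy => ?_⟩
      rw [hinj _ _ hx, hinj _ _ hy]
    · exact ⟨(0, 0), fun x y hx hy => absurd ⟨x, y, hx, hy⟩ hαβ⟩
  choose r hr using this
  refine ⟨r, fun A B hA hB θ hθ => ?_⟩
  obtain ⟨S, hS, hScof, hSr⟩ := hrts _ _ (hcofin A hA) (hcofin B hB) θ hθ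
  refine ⟨φ '' S, ⟨by rintro _ ⟨x, -, rfl⟩; exact hφo x, fun C hC => ?_⟩, ?_, ?_⟩
  · obtain ⟨x, hxS, hxC⟩ := hS (φ ⁻¹' C) ⟨hcofin C ⟨hC.1, hC.2.2⟩, fun p hp hlim => by
      refine hC.2.1 _ (hφo p) (fun h0 => ?_) fun q hq => ?_
      · obtain ⟨y, hy⟩ := not_isMin_iff.1 hp
        rw [← hφ, h0] at hy
        exact not_lt_zero hy
      · obtain ⟨y, rfl⟩ := hsurj q (hq.trans (hφo p))
        obtain ⟨z, hz, h1, h2⟩ := hlim y ((hφ _ _).1 hq)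
        exact ⟨_, hz, (hφ _ _).2 h1, (hφ _ _).2 h2⟩⟩
    exact ⟨φ x, ⟨x, hxS, rfl⟩, hxC⟩
  · rintro _ ⟨x, hx, rfl⟩
    by_contra hle
    refine hScof x hx ?_
    obtain ⟨s, hs, hsc⟩ := Order.exists_cof_eq (φ x).ToType
    rw [Ordinal.cof_toType] at hsc
    have : ∀ y : (φ x).ToType, ∃ z, φ z = (ToType.mk.symm y).1 := fun y =>
      hsurj _ ((show (ToType.mk.symm y).1 < φ x from (ToType.mk.symm y).2).trans (hφo x))
    choose ψ hψ using this
    refine ⟨ψ '' s, ?_, (mk_image_le.trans hsc.le).trans (not_lt.1 hle), fun y hy => ?_⟩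
    · rintro _ ⟨y, -, rfl⟩
      rw [mem_Iio, ← hφ, hψ]
      exact (ToType.mk.symm y).2
    · obtain ⟨z, hz, hyz⟩ := hs (ToType.mk ⟨φ y, (hφ _ _).2 hy⟩)
      refine ⟨_, ⟨z, hz, rfl⟩, ?_⟩
      rw [← hφ', hψ]
      have := ToType.mk.symm.monotone hyz
      rw [OrderIso.symm_apply_apply] at this
      exact this
  · rintro _ ⟨x, hx, rfl⟩ _ ⟨y, hy, rfl⟩ hxy
    obtain ⟨α, hα, β, hβ, hαβ, heq⟩ := hSr x hx y hy ((hφ _ _).1 hxy)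
    refine ⟨φ α, hα, φ β, hβ, (hφ _ _).2 hαβ, ?_⟩
    rw [hr _ _ α β rfl rfl, heq]
end

section
/- For every cardinal λ with ω < cf(λ) < λ, there exists a sequence ⟨e_δ : δ ∈ E^{λ⁺}_{cf(λ)}⟩ such that: (1) for every δ ∈ E^{λ⁺}_{cf(λ)}, e_δ is a closed unbounded subset of δ of order type cf(λ); and (2) for every closed unbounded E ⊆ λ⁺, the set of δ ∈ E^{λ⁺}_{cf(λ)} for which sup{cf(α) : α ∈ e_δ ∩ E} = λ is stationary in λ⁺. -/
open Ordinal Cardinal Set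

namespace ClubGuessing

/-- Every ordinal is the limit of a monotone sequence of length its cofinality. -/
theorem exists_monotone_cofinal (o : Ordinal.{0}) :
    ∃ g : Ordinal.{0} → Ordinal.{0}, (∀ i < o.cof.ord, g i < o) ∧
      (∀ i j, i ≤ j → j < o.cof.ord → g i ≤ g j) ∧ ∀ b < o, ∃ i < o.cof.ord, b ≤ g i := by
  obtain ⟨f, hf⟩ := exists_isFundamentalSeq (o := o) rfl
  refine ⟨fun i ↦ if h : i < o.cof.ord then (f ⟨i, h⟩).1 else 0, ?_, ?_, ?_⟩
  · intro i hi
    simp only [hi, dite_true]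
    exact (f ⟨i, hi⟩).2
  · intro i j hij hj
    simp only [hj, hij.trans_lt hj, dite_true]
    exact hf.strictMono.monotone (a := ⟨i, hij.trans_lt hj⟩) (b := ⟨j, hj⟩) hij
  · intro b hb
    obtain ⟨_, ⟨i, rfl⟩, hi⟩ := hf.isCofinal_range ⟨b, hb⟩
    refine ⟨i.1, i.2, ?_⟩
    have hi' := i.2
    simp only [mem_Iio] at hi'
    simp only [hi', dite_true]
    exact hi

/-- A continuous increasing sequence below `o` whose successor entries satisfy prescribed
unbounded requirements. -/
theorem exists_normal_sequence {o : Ordinal.{0}} {κ : Cardinal.{0}} (hκ : ℵ₀ ≤ κ)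
    (hκo : κ ≤ o.cof) (Q : Ordinal.{0} → Ordinal.{0} → Prop)
    (hQ : ∀ j < κ.ord, ∀ s < o, ∃ α, s ≤ α ∧ α < o ∧ Q j α) :
    ∃ f : Ordinal.{0} → Ordinal.{0}, StrictMono f ∧ (∀ i < κ.ord, f i < o) ∧
      (∀ i, Order.IsSuccPrelimit i → ∀ q < f i, ∃ j < i, q < f j) ∧
      ∀ j < κ.ord, Q j (f (j + 1)) := by
  have hstep : ∀ i s : Ordinal.{0}, ∃ t, s ≤ t ∧ (s < o → t < o) ∧
      (Order.IsSuccPrelimit i → t = s) ∧ (s < o → ∀ j < κ.ord, i = j + 1 → Q j t) := by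
    intro i s
    by_cases h : s < o ∧ ∃ j < κ.ord, i = j + 1
    · obtain ⟨hs, j, hj, rfl⟩ := h
      obtain ⟨α, h1, h2, h3⟩ := hQ j hj s hs
      refine ⟨α, h1, fun _ ↦ h2, fun h ↦ ?_, fun _ j' _ h ↦ ?_⟩
      · exact absurd h (Order.not_isSuccPrelimit_succ j)
      · rwa [← Order.succ_injective h]
    · exact ⟨s, le_rfl, id, fun _ ↦ rfl, fun hs j hj hij ↦ (h ⟨hs, j, hj, hij⟩).elim⟩
  choose h hle hlt hlim hsucc using hstep
  let f : Ordinal.{0} → Ordinal.{0} :=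
    WellFoundedLT.fix fun i F ↦ h i (⨆ j : Iio i, F j.1 j.2 + 1)
  have hf : ∀ i, f i = h i (⨆ j : Iio i, f j.1 + 1) := fun i ↦ WellFoundedLT.fix_eq _ i
  have hmono : StrictMono f := by
    intro j i hji
    rw [hf i]
    refine lt_of_lt_of_le ?_ (hle _ _)
    exact (Order.lt_succ (f j)).trans_le
      (le_ciSup (f := fun j : Iio i ↦ f j.1 + 1) Ordinal.bddAbove_of_small ⟨j, hji⟩)
  have hsup : ∀ i < κ.ord, (∀ j < i, f j < o) → ⨆ j : Iio i, f j.1 + 1 < o := by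
    intro i hi hj
    refine lift_iSup_add_one_lt_of_lt_cof ?_ fun j ↦ hj j.1 j.2
    rw [← lift_cof, Cardinal.mk_Iio_ordinal, Cardinal.lift_uzero, Cardinal.lift_lt]
    exact (lt_ord.1 hi).trans_le hκo
  have hfo : ∀ i < κ.ord, f i < o := by
    intro i
    induction i using WellFoundedLT.induction with
    | ind i ih =>
      intro hi
      rw [hf i]
      exact hlt _ _ (hsup i hi fun j hj ↦ ih j hj (hj.trans hi))
  refine ⟨f, hmono, hfo, ?_, ?_⟩
  · intro i hi q hq
    rw [hf i, hlim i _ hi, Ordinal.lt_iSup_iff] at hq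
    obtain ⟨j, hj⟩ := hq
    exact ⟨j.1 + 1, hi.add_one_lt j.2, (Order.le_of_lt_succ hj).trans_lt (hmono (Order.lt_succ _))⟩
  · intro j hj
    have hj1 : j + 1 < κ.ord := (isSuccLimit_ord hκ).add_one_lt hj
    rw [hf (j + 1)]
    exact hsucc _ _ (hsup _ hj1 fun i hi ↦ hfo i (hi.trans hj1)) j hj rfl

theorem cof_eq_of_strictMono {κ : Cardinal.{0}} (hκ : κ.IsRegular) {f : Ordinal.{0} → Ordinal.{0}}
    (hf : StrictMono f) {δ : Ordinal.{0}} (hlt : ∀ i < κ.ord, f i < δ)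
    (hcof : ∀ b < δ, ∃ i < κ.ord, b ≤ f i) : δ.cof = κ := by
  have : δ = ⨆ i : Iio κ.ord, f i.1 + 1 := by
    apply le_antisymm
    · refine le_of_forall_lt fun b hb ↦ ?_
      obtain ⟨i, hi, hbi⟩ := hcof b hb
      rw [Ordinal.lt_iSup_iff]
      exact ⟨⟨i, hi⟩, Order.lt_succ_of_le hbi⟩
    · exact Ordinal.iSup_le fun i ↦ Order.succ_le_of_lt (hlt i.1 i.2)
  rw [this, cof_iSup_Iio_add_one (f := fun i : Iio κ.ord ↦ f i.1)
    (hf.comp (Subtype.strictMono_coe _)), hκ.cof_ord]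

/-- Every point of a suitable cofinality can be reached along a club set. -/
theorem exists_mem_club_cof_eq {o : Ordinal.{0}} {κ : Cardinal.{0}} (hκ : κ.IsRegular)
    (hκo : κ < o.cof) {E : Set Ordinal.{0}} (hE : IsClubIn E o)
    (Q : Ordinal.{0} → Ordinal.{0} → Prop)
    (hQ : ∀ j < κ.ord, ∀ s < o, ∃ α ∈ E, s ≤ α ∧ Q j α) {s : Ordinal.{0}} (hs : s < o) :
    ∃ δ ∈ E, s < δ ∧ δ.cof = κ ∧
      ∀ b < δ, ∀ i < κ.ord, ∃ j < κ.ord, i ≤ j ∧ ∃ α ∈ E, b < α ∧ α < δ ∧ Q j α := by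
  have hlim := isSuccLimit_ord hκ.aleph0_le
  obtain ⟨f, hf, hfo, -, hfQ⟩ := exists_normal_sequence hκ.aleph0_le hκo.le
    (fun j α ↦ s < α ∧ α ∈ E ∧ Q j α) (by
      intro j hj t ht
      have hoo : Order.succ (max s t) < o := by
        refine Order.IsSuccLimit.succ_lt ?_ (max_lt hs ht)
        rw [← one_lt_cof_iff, ← aleph0_le_cof_iff]
        exact hκ.aleph0_le.trans hκo.le
      obtain ⟨α, hα, h1, h2⟩ := hQ j hj _ hoo
      have := Order.succ_le_iff.1 h1
      exact ⟨α, (le_max_right _ _).trans this.le, hE.1 hα, (le_max_left _ _).trans_lt this, hα, h2⟩)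
  let δ := ⨆ i : Iio κ.ord, f i.1
  have hδo : δ < o := by
    refine lift_iSup_lt_of_lt_cof ?_ fun j ↦ hfo j.1 j.2
    rw [← lift_cof, Cardinal.mk_Iio_ordinal, Cardinal.lift_uzero, Cardinal.lift_lt, card_ord]
    exact hκo
  have hle : ∀ i < κ.ord, f i ≤ δ := fun i hi ↦
    le_ciSup (f := fun j : Iio κ.ord ↦ f j.1) Ordinal.bddAbove_of_small ⟨i, hi⟩
  have hlt : ∀ i < κ.ord, f i < δ := fun i hi ↦
    (hf (Order.lt_succ i)).trans_le (hle _ (hlim.succ_lt hi))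
  have hcof : ∀ b < δ, ∃ i < κ.ord, b < f i := by
    intro b hb
    obtain ⟨i, hi⟩ := (Ordinal.lt_iSup_iff).1 hb
    exact ⟨i.1, i.2, hi⟩
  have hs' : s < δ := (hfQ 0 hlim.bot_lt).1.trans (hlt _ (hlim.succ_lt hlim.bot_lt))
  have key : ∀ b < δ, ∀ i < κ.ord, ∃ j < κ.ord, i ≤ j ∧ ∃ α ∈ E, b < α ∧ α < δ ∧ Q j α := by
    intro b hb i hi
    obtain ⟨i', hi', hb'⟩ := hcof b hb
    have hm : max i i' < κ.ord := max_lt hi hi'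
    refine ⟨_, hm, le_max_left _ _, _, (hfQ _ hm).2.1, ?_, hlt _ (hlim.succ_lt hm), (hfQ _ hm).2.2⟩
    exact hb'.trans_le (hf.monotone ((le_max_right _ _).trans (Order.le_succ _)))
  refine ⟨δ, ?_, hs', cof_eq_of_strictMono hκ hf hlt fun b hb ↦ ?_, key⟩
  · refine hE.2.1 δ hδo (pos_of_gt hs').ne' fun q hq ↦ ?_
    obtain ⟨_, _, _, α, h⟩ := key q hq 0 hlim.bot_lt
    exact ⟨α, h.1, h.2.1, h.2.2.1⟩
  · obtain ⟨i, hi, h⟩ := hcof b hb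
    exact ⟨i, hi, h.le⟩

theorem isClubIn_iInter {o : Ordinal.{0}} (ho : ℵ₀ < o.cof) {ι : Type*} [Small.{0} ι]
    (F : ι → Set Ordinal.{0})
    (hι : Cardinal.lift.{0} #ι < (Ordinal.lift o).cof) (hF : ∀ i, IsClubIn (F i) o) :
    IsClubIn (Iio o ∩ ⋂ i, F i) o := by
  have hlim : Order.IsSuccLimit o := by
    rw [← one_lt_cof_iff, ← aleph0_le_cof_iff]
    exact ho.le
  refine ⟨inter_subset_left, fun p hp hp0 h ↦ ⟨hp, mem_iInter.2 fun i ↦ (hF i).2.1 p hp hp0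
    fun q hq ↦ ?_⟩, fun p hp ↦ ?_⟩
  · obtain ⟨r, hr, h⟩ := h q hq
    exact ⟨r, mem_iInter.1 hr.2 i, h⟩
  have hn : ∀ i, ∀ s : Iio o, ∃ t : Iio o, t.1 ∈ F i ∧ s.1 < t.1 := by
    intro i s
    obtain ⟨q, hq, h⟩ := (hF i).2.2 _ (hlim.succ_lt s.2)
    exact ⟨⟨q, (hF i).1 hq⟩, hq, Order.succ_le_iff.1 h⟩
  choose n hnF hn using hn
  let st : Iio o → Iio o := fun s ↦ ⟨max (Order.succ s.1) (⨆ i, (n i s).1), max_lt (hlim.succ_lt s.2)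
    (lift_iSup_lt_of_lt_cof hι fun i ↦ (n i s).2)⟩
  let x : ℕ → Iio o := fun k ↦ st^[k] ⟨p, hp⟩
  have hx : ∀ k, x (k + 1) = st (x k) := fun k ↦ Function.iterate_succ_apply' _ _ _
  have hnx : ∀ k i, (n i (x k)).1 ≤ (x (k + 1)).1 := by
    intro k i
    rw [hx]
    exact (le_ciSup (f := fun i ↦ (n i (x k)).1) Ordinal.bddAbove_of_small i).trans (le_max_right _ _)
  have hxs : ∀ k, (x k).1 < (x (k + 1)).1 := by
    intro k
    rw [hx]
    exact (Order.lt_succ _).trans_le (le_max_left _ _)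
  let q := ⨆ k, (x k).1
  have hle : ∀ k, (x k).1 ≤ q := fun k ↦ le_ciSup (f := fun k ↦ (x k).1) Ordinal.bddAbove_of_small k
  have hqo : q < o := iSup_lt_of_lt_cof (by simpa using ho) fun k ↦ (x k).2
  refine ⟨q, ⟨hqo, mem_iInter.2 fun i ↦ (hF i).2.1 q hqo ?_ fun r hr ↦ ?_⟩, hle 0⟩
  · exact (pos_of_gt ((hxs 0).trans_le (hle 1))).ne'
  · obtain ⟨k, hk⟩ := (Ordinal.lt_iSup_iff).1 hr
    exact ⟨_, hnF i (x k), hk.trans (hn i (x k)), (hnx k i).trans_lt ((hxs _).trans_le (hle _))⟩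

/-- `A ∩ δ` contains, cofinally in `δ`, points of cofinality above any bound below `μ`. -/
def IsHighIn (μ : Cardinal.{0}) (A : Set Ordinal.{0}) (δ : Ordinal.{0}) : Prop :=
  ∀ b < δ, ∀ θ < μ, ∃ α ∈ A, b < α ∧ α < δ ∧ θ < α.cof

theorem IsHighIn.mono {μ : Cardinal.{0}} {A B : Set Ordinal.{0}} {δ : Ordinal.{0}}
    (h : IsHighIn μ A δ) (hAB : A ⊆ B) : IsHighIn μ B δ := fun b hb θ hθ ↦
  let ⟨α, hα, h'⟩ := h b hb θ hθ
  ⟨α, hAB hα, h'⟩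

theorem cof_succ_ord {μ : Cardinal.{0}} (hμ : ℵ₀ ≤ μ) : (Order.succ μ).ord.cof = Order.succ μ :=
  (isRegular_succ hμ).cof_ord

theorem isRegular_cof_ord {μ : Cardinal.{0}} (hμ : ℵ₀ ≤ μ) : μ.ord.cof.IsRegular :=
  isRegular_cof (isSuccLimit_ord hμ)

theorem exists_mem_club_lt_cof {μ : Cardinal.{0}} (hμ : ℵ₀ < μ) {E : Set Ordinal.{0}}
    (hE : IsClubIn E (Order.succ μ).ord) {θ : Cardinal.{0}} (hθ : θ < μ) {s : Ordinal.{0}}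
    (hs : s < (Order.succ μ).ord) : ∃ α ∈ E, s < α ∧ θ < α.cof := by
  have hlt : Order.succ (max θ ℵ₀) < (Order.succ μ).ord.cof := by
    rw [cof_succ_ord hμ.le]
    exact Order.lt_succ_of_le (Order.succ_le_of_lt (max_lt hθ hμ))
  obtain ⟨δ, h1, h2, h3, -⟩ := exists_mem_club_cof_eq (isRegular_succ (le_max_right θ ℵ₀)) hlt hE
    (fun _ _ ↦ True) (fun j _ t ht ↦ by
      obtain ⟨q, hq, h⟩ := hE.2.2 t ht
      exact ⟨q, hq, h, trivial⟩) hs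
  refine ⟨δ, h1, h2, ?_⟩
  rw [h3]
  exact (le_max_left _ _).trans_lt (Order.lt_succ _)

theorem exists_mem_club_isHighIn {μ : Cardinal.{0}} (hμ : ℵ₀ < μ) {E : Set Ordinal.{0}}
    (hE : IsClubIn E (Order.succ μ).ord) :
    ∃ δ ∈ E, δ.cof = μ.ord.cof ∧ IsHighIn μ E δ := by
  obtain ⟨g, hg, hgm, hgc⟩ := exists_monotone_cofinal μ.ord
  have hlt : μ.ord.cof < (Order.succ μ).ord.cof := by
    rw [cof_succ_ord hμ.le]
    exact Order.lt_succ_of_le (cof_ord_le μ)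
  have h0 : 0 < (Order.succ μ).ord := by
    rw [← cof_pos, cof_succ_ord hμ.le]
    exact Order.bot_lt_succ μ
  obtain ⟨δ, h1, -, h3, h4⟩ := exists_mem_club_cof_eq (isRegular_cof_ord hμ.le) hlt hE
    (fun j α ↦ (g j).card < α.cof) (fun j hj t ht ↦ by
      obtain ⟨α, hα, h, h'⟩ := exists_mem_club_lt_cof hμ hE (lt_ord.1 (hg j hj)) ht
      exact ⟨α, hα, h.le, h'⟩) h0
  refine ⟨δ, h1, h3, fun b hb θ hθ ↦ ?_⟩
  obtain ⟨i, hi, hi'⟩ := hgc θ.ord (ord_lt_ord.2 hθ)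
  obtain ⟨j, hj, hij, α, hα, hbα, hαδ, h⟩ := h4 b hb i hi
  exact ⟨α, hα, hbα, hαδ, (ord_le.1 (hi'.trans (hgm i j hij hj))).trans_lt h⟩

theorem exists_cofinal_set (x : Ordinal.{0}) :
    ∃ e : Set Ordinal.{0}, #e ≤ Cardinal.lift.{1} x.cof ∧ ∀ b < x, ∃ y ∈ e, b ≤ y ∧ y < x := by
  obtain ⟨g, hg, -, hgc⟩ := exists_monotone_cofinal x
  refine ⟨g '' Iio x.cof.ord, mk_image_le.trans ?_, fun b hb ↦ ?_⟩
  · rw [Cardinal.mk_Iio_ordinal, card_ord]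
  · obtain ⟨i, hi, h⟩ := hgc b hb
    exact ⟨_, ⟨i, hi, rfl⟩, h, hg i hi⟩

/-- If `C` has no points of high cofinality in `E`, it can be refined so that between any point of
`C` and any lower point of `E` of high cofinality there is a point of the refinement. -/
theorem exists_refinement {μ κ : Cardinal.{0}} (hμ : ℵ₀ ≤ μ) {E : Set Ordinal.{0}}
    (hE : IsClubIn E (Order.succ μ).ord) {C : Ordinal.{0} → Set Ordinal.{0}}
    (hC : ∀ δ, δ.cof = κ → #(C δ) < Cardinal.lift.{1} μ)
    (hCE : ∀ δ ∈ E, δ.cof = κ → ¬ IsHighIn μ (C δ ∩ E) δ) :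
    ∃ C' : Ordinal.{0} → Set Ordinal.{0}, (∀ δ, δ.cof = κ → #(C' δ) < Cardinal.lift.{1} μ) ∧
      ∀ δ ∈ E, δ.cof = κ → ∃ b < δ, ∃ θ < μ, ∀ α ∈ E, b < α → α < δ → θ < α.cof →
        ∀ x ∈ C δ, α ≤ x → x < δ → ∃ y ∈ C' δ, α ≤ y ∧ y < x := by
  classical
  have hb : ∀ δ : Ordinal.{0}, ∃ b : Ordinal.{0}, ∃ θ < μ, δ ∈ E → δ.cof = κ →
      b < δ ∧ ∀ α ∈ C δ ∩ E, b < α → α < δ → α.cof ≤ θ := by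
    intro δ
    by_cases h : δ ∈ E ∧ δ.cof = κ
    · have := hCE δ h.1 h.2
      unfold IsHighIn at this
      push Not at this
      obtain ⟨b, hb, θ, hθ, h'⟩ := this
      exact ⟨b, θ, hθ, fun _ _ ↦ ⟨hb, h'⟩⟩
    · exact ⟨0, 0, aleph0_pos.trans_le hμ, fun h1 h2 ↦ (h ⟨h1, h2⟩).elim⟩
  choose b θ hθ hb using hb
  choose e hec he using exists_cofinal_set
  refine ⟨fun δ ↦ (fun x ↦ sSup (E ∩ Iio x)) '' C δ ∪
    ⋃ x ∈ C δ, if x.cof ≤ θ δ then e x else ∅, ?_, ?_⟩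
  · intro δ hδ
    have hμ' : ℵ₀ ≤ Cardinal.lift.{1} μ := by simpa using hμ
    refine (mk_union_le _ _).trans_lt (add_lt_of_lt hμ' (mk_image_le.trans_lt (hC δ hδ)) ?_)
    refine (mk_biUnion_le _ _).trans_lt (mul_lt_of_lt hμ' (hC δ hδ) ?_)
    refine lt_of_le_of_lt (ciSup_le' fun x ↦ ?_) (Cardinal.lift_lt.2 (hθ δ))
    split_ifs with h
    · exact (hec _).trans (Cardinal.lift_le.2 h)
    · simp
  · intro δ hδE hδ
    obtain ⟨hbδ, hδ'⟩ := hb δ hδE hδ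
    refine ⟨b δ, hbδ, θ δ, hθ δ, fun α hα hbα hαδ hαθ x hx hαx hxδ ↦ ?_⟩
    by_cases hxE : x ∈ E
    · have hxθ := hδ' x ⟨hx, hxE⟩ (hbα.trans_le hαx) hxδ
      have hlt : α < x := hαx.lt_of_ne fun h ↦ (h ▸ hαθ).not_ge hxθ
      obtain ⟨y, hy, h⟩ := he x α hlt
      exact ⟨y, Or.inr (mem_biUnion hx (by simpa [hxθ] using hy)), h⟩
    · have hlt : α < x := hαx.lt_of_ne fun h ↦ hxE (h ▸ hα)
      have hbdd : BddAbove (E ∩ Iio x) := ⟨x, fun y hy ↦ le_of_lt hy.2⟩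
      refine ⟨_, Or.inl ⟨x, hx, rfl⟩, le_csSup hbdd ⟨hα, hlt⟩, ?_⟩
      refine lt_of_le_of_ne (csSup_le (s := E ∩ Iio x) ⟨α, hα, hlt⟩ fun y hy ↦ le_of_lt hy.2) fun heq ↦ hxE ?_
      refine hE.2.1 x (hxδ.trans (hE.1 hδE)) (pos_of_gt hlt).ne' fun q hq ↦ ?_
      rw [← heq] at hq
      obtain ⟨r, hr, hqr⟩ := exists_lt_of_lt_csSup (s := E ∩ Iio x) ⟨α, hα, hlt⟩ hq
      exact ⟨r, hr.1, hqr, hr.2⟩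

/-- There is a system of sets of size less than `μ` guessing points of high cofinality in clubs. -/
theorem exists_guessing_small_sets {μ : Cardinal.{0}} (h1 : ℵ₀ < μ.ord.cof)
    (h2 : μ.ord.cof < μ) :
    ∃ C : Ordinal.{0} → Set Ordinal.{0},
      (∀ δ, δ.cof = μ.ord.cof → #(C δ) < Cardinal.lift.{1} μ) ∧
      ∀ E, IsClubIn E (Order.succ μ).ord →
        ∃ δ ∈ E, δ.cof = μ.ord.cof ∧ IsHighIn μ (C δ ∩ E) δ := by
  by_contra! hcon
  have hμ : ℵ₀ < μ := h1.trans h2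
  let T := {C : Ordinal.{0} → Set Ordinal.{0} //
    ∀ δ, δ.cof = μ.ord.cof → #(C δ) < Cardinal.lift.{1} μ}
  have hstep : ∀ C : T, ∃ C' : T, ∃ E, IsClubIn E (Order.succ μ).ord ∧
      ∀ δ ∈ E, δ.cof = μ.ord.cof → ∃ b < δ, ∃ θ < μ, ∀ α ∈ E, b < α → α < δ → θ < α.cof →
        ∀ x ∈ C.1 δ, α ≤ x → x < δ → ∃ y ∈ C'.1 δ, α ≤ y ∧ y < x := by
    intro C
    obtain ⟨E, hE, h⟩ := hcon C.1 C.2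
    obtain ⟨C', hC', h'⟩ := exists_refinement hμ.le hE C.2 h
    exact ⟨⟨C', hC'⟩, E, hE, h'⟩
  choose next E hE hnext using hstep
  choose e hec he using exists_cofinal_set
  let C0 : T := ⟨e, fun δ hδ ↦ (hec δ).trans_lt (Cardinal.lift_lt.2 (hδ ▸ h2))⟩
  let C : ℕ → T := fun n ↦ next^[n] C0
  have hCs : ∀ n, C (n + 1) = next (C n) := fun n ↦ Function.iterate_succ_apply' _ _ _
  have hcof := cof_succ_ord hμ.le
  have hclub : IsClubIn (Iio (Order.succ μ).ord ∩ ⋂ n, E (C n)) (Order.succ μ).ord := by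
    refine isClubIn_iInter ?_ _ ?_ fun n ↦ hE _
    · rw [hcof]
      exact hμ.trans (Order.lt_succ μ)
    · rw [← lift_cof, hcof]
      simpa using hμ.trans (Order.lt_succ μ)
  obtain ⟨δ, ⟨-, hδ⟩, hδκ, hhigh⟩ := exists_mem_club_isHighIn hμ hclub
  rw [mem_iInter] at hδ
  choose b hb θ hθ hstep using fun n ↦ hnext (C n) δ (hδ n) hδκ
  have hbs : ⨆ n, b n < δ := iSup_lt_of_lt_cof (by rw [hδκ]; simpa using h1) hb
  have hθs : ⨆ n, θ n < μ := iSup_lt_of_lt_cof_ord (by simpa using h1) hθ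
  obtain ⟨α, hα, hbα, hαδ, hαθ⟩ := hhigh _ hbs _ hθs
  have hdesc : ∀ x : Ordinal.{0}, ∀ n, x ∈ (C n).1 δ → α ≤ x → x < δ → False := by
    intro x
    induction x using WellFoundedLT.induction with
    | ind x ih =>
      intro n hx hαx hxδ
      obtain ⟨y, hy, hαy, hyx⟩ := hstep n α (mem_iInter.1 hα.2 n)
        ((le_ciSup Ordinal.bddAbove_of_small n).trans_lt hbα) hαδ
        ((le_ciSup Cardinal.bddAbove_of_small n).trans_lt hαθ) x hx hαx hxδ
      exact ih y hyx (n + 1) (by rwa [hCs]) hαy (hyx.trans hxδ)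
  obtain ⟨x, hx, hαx, hxδ⟩ := he δ α hαδ
  exact hdesc x 0 hx hαx hxδ

theorem exists_club_of_cof_eq {κ : Cardinal.{0}} (hκ : ℵ₀ ≤ κ) {δ : Ordinal.{0}}
    (hδ : δ.cof = κ) (Q : Ordinal.{0} → Ordinal.{0} → Prop)
    (hQ : ∀ j < κ.ord, ∀ s < δ, ∃ α, s ≤ α ∧ α < δ ∧ Q j α) :
    ∃ e, IsClubIn e δ ∧ Nonempty (e ≃o Iio κ.ord) ∧ ∀ j < κ.ord, ∃ α ∈ e, Q j α := by
  obtain ⟨g, hg, -, hgc⟩ := exists_monotone_cofinal δ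
  rw [hδ] at hg hgc
  obtain ⟨f, hf, hfδ, hflim, hfQ⟩ := exists_normal_sequence hκ hδ.ge
    (fun j α ↦ g j ≤ α ∧ Q j α) (fun j hj s hs ↦ by
      obtain ⟨α, h1, h2, h3⟩ := hQ j hj _ (max_lt hs (hg j hj))
      exact ⟨α, (le_max_left _ _).trans h1, h2, (le_max_right _ _).trans h1, h3⟩)
  have hsucc : ∀ j < κ.ord, j + 1 < κ.ord := fun j hj ↦ (isSuccLimit_ord hκ).succ_lt hj
  have hunb : ∀ p < δ, ∃ i < κ.ord, p ≤ f i := by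
    intro p hp
    obtain ⟨i, hi, h⟩ := hgc p hp
    exact ⟨i + 1, hsucc i hi, h.trans (hfQ i hi).1⟩
  refine ⟨f '' Iio κ.ord, ⟨?_, ?_, ?_⟩, ⟨((hf.strictMonoOn _).orderIso f _).symm⟩, ?_⟩
  · rintro _ ⟨i, hi, rfl⟩
    exact hfδ i hi
  · intro p hp _ hlim
    have hne := hunb p hp
    obtain ⟨i, ⟨hi, hpi⟩, hmin⟩ :=
      WellFounded.has_min (wellFounded_lt (α := Ordinal.{0})) {i | i < κ.ord ∧ p ≤ f i} hne
    have hmin' : ∀ j < i, f j < p := fun j hj ↦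
      lt_of_not_ge fun h ↦ hmin j ⟨hj.trans hi, h⟩ hj
    refine ⟨i, hi, (hpi.eq_of_not_lt fun hlt ↦ ?_).symm⟩
    by_cases hpre : Order.IsSuccPrelimit i
    · obtain ⟨j, hj, h⟩ := hflim i hpre p hlt
      exact (hmin' j hj).not_gt h
    · obtain ⟨j, rfl⟩ := Order.not_isSuccPrelimit_iff_mem_range_succ.1 hpre
      obtain ⟨_, ⟨k, -, rfl⟩, h1, h2⟩ := hlim _ (hmin' j (Order.lt_succ j))
      exact (Order.succ_le_of_lt (hf.lt_iff_lt.1 h1)).not_gt (hf.lt_iff_lt.1 (h2.trans hlt))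
  · intro p hp
    obtain ⟨i, hi, h⟩ := hunb p hp
    exact ⟨_, ⟨i, hi, rfl⟩, h⟩
  · exact fun j hj ↦ ⟨_, ⟨j + 1, hsucc j hj, rfl⟩, (hfQ j hj).2⟩

/-- A set of points of high cofinality can be thinned out to order type the cofinality of `δ`. -/
theorem exists_club_guessing {μ : Cardinal.{0}} (hμ : ℵ₀ ≤ μ) {δ : Ordinal.{0}}
    (hδ : δ.cof = μ.ord.cof) (A : Set Ordinal.{0}) :
    ∃ e, IsClubIn e δ ∧ Nonempty (e ≃o Iio μ.ord.cof.ord) ∧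
      (IsHighIn μ A δ → ∀ θ < μ, ∃ α ∈ e ∩ A, θ < α.cof) := by
  have hκ := (isRegular_cof_ord hμ).aleph0_le
  by_cases hA : IsHighIn μ A δ
  · obtain ⟨g, hg, -, hgc⟩ := exists_monotone_cofinal μ.ord
    obtain ⟨e, he, heo, heQ⟩ := exists_club_of_cof_eq hκ hδ
      (fun j α ↦ α ∈ A ∧ (g j).card < α.cof) (fun j hj s hs ↦ by
        obtain ⟨α, hα, h1, h2, h3⟩ := hA s hs _ (lt_ord.1 (hg j hj))
        exact ⟨α, h1.le, h2, hα, h3⟩)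
    refine ⟨e, he, heo, fun _ θ hθ ↦ ?_⟩
    obtain ⟨j, hj, hj'⟩ := hgc θ.ord (ord_lt_ord.2 hθ)
    obtain ⟨α, hα, h, h'⟩ := heQ j hj
    exact ⟨α, ⟨hα, h⟩, (ord_le.1 hj').trans_lt h'⟩
  · obtain ⟨e, he, heo, -⟩ := exists_club_of_cof_eq hκ hδ (fun _ _ ↦ True)
      (fun j _ s hs ↦ ⟨s, le_rfl, hs, trivial⟩)
    exact ⟨e, he, heo, fun h ↦ (hA h).elim⟩

end ClubGuessing

open ClubGuessing
theorem club_guessing_uncountable_cof (lam : Cardinal.{0})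
    (h1 : Cardinal.aleph0 < lam.ord.cof) (h2 : lam.ord.cof < lam) :
    ∃ e : Ordinal.{0} → Set Ordinal.{0},
      -- (1) each `e δ` is a club in `δ` of order type `cf(λ)`
      (∀ δ, δ < (Order.succ lam).ord → Ordinal.cof δ = lam.ord.cof →
        IsClubIn (e δ) δ ∧ Nonempty ((e δ) ≃o Set.Iio lam.ord.cof.ord)) ∧
      -- (2) for every club `E ⊆ λ⁺`, stationarily many `δ ∈ E^{λ⁺}_{cf(λ)}`
      -- satisfy `sup {cf α : α ∈ e δ ∩ E} = λ`
      (∀ E : Set Ordinal, IsClubIn E (Order.succ lam).ord →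
        IsStationaryIn
          {δ | δ < (Order.succ lam).ord ∧ Ordinal.cof δ = lam.ord.cof ∧
            sSup (Ordinal.cof '' (e δ ∩ E)) = lam}
          (Order.succ lam).ord) := by
  have hlam : ℵ₀ < lam := h1.trans h2
  have hcof := cof_succ_ord hlam.le
  have ho : ℵ₀ < (Order.succ lam).ord.cof := by
    rw [hcof]
    exact hlam.trans (Order.lt_succ lam)
  obtain ⟨C, hC, hguess⟩ := exists_guessing_small_sets h1 h2
  have hA : ∀ (E : Set Ordinal.{0}) (δ : Ordinal.{0}), ∃ e : Set Ordinal.{0},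
      δ.cof = lam.ord.cof → IsClubIn e δ ∧ Nonempty (e ≃o Iio lam.ord.cof.ord) ∧
      (IsHighIn lam (C δ ∩ E) δ → ∀ θ < lam, ∃ α ∈ e ∩ (C δ ∩ E), θ < α.cof) := by
    intro E δ
    by_cases hδ : δ.cof = lam.ord.cof
    · obtain ⟨e, he⟩ := exists_club_guessing hlam.le hδ (C δ ∩ E)
      exact ⟨e, fun _ ↦ he⟩
    · exact ⟨∅, fun h ↦ (hδ h).elim⟩
  choose A hA using hA
  by_contra hcon
  have hG : ∀ E : Set Ordinal.{0}, ∃ G, IsClubIn G (Order.succ lam).ord ∧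
      ∀ δ ∈ G, δ.cof = lam.ord.cof → ∃ θ < lam, ∀ α ∈ A E δ ∩ G, α.cof ≤ θ := by
    intro E
    have hE : ∃ F, IsClubIn F (Order.succ lam).ord ∧ ∃ D, IsClubIn D (Order.succ lam).ord ∧
        ∀ δ ∈ D, δ.cof = lam.ord.cof → sSup (Ordinal.cof '' (A E δ ∩ F)) ≠ lam := by
      by_contra! hE
      refine hcon ⟨A E, fun δ _ hδ ↦ ⟨(hA E δ hδ).1, (hA E δ hδ).2.1⟩, fun F hF ↦
        ⟨fun δ hδ ↦ hδ.1, fun D hD ↦ ?_⟩⟩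
      obtain ⟨δ, hδ, h⟩ := hE F hF D hD
      exact ⟨δ, ⟨hD.1 hδ, h⟩, hδ⟩
    obtain ⟨F, hF, D, hD, hFD⟩ := hE
    refine ⟨_, isClubIn_iInter ho (fun b : Bool ↦ if b then F else D) ?_ ?_, ?_⟩
    · rw [← lift_cof, Cardinal.lift_uzero, Cardinal.lift_uzero]
      exact (lt_aleph0_of_finite Bool).trans ho
    · rintro (_ | _)
      · simpa using hD
      · simpa using hF
    · rintro δ ⟨hδo, hδ⟩ hδκ
      have hδD : δ ∈ D := by simpa using mem_iInter.1 hδ false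
      have hle : ∀ c ∈ Ordinal.cof '' (A E δ ∩ F), c ≤ lam := by
        rintro _ ⟨α, ⟨hα, -⟩, rfl⟩
        have : α < (Order.succ lam).ord := ((hA E δ hδκ).1.1 hα).trans hδo
        exact (cof_le_card α).trans (Order.lt_succ_iff.1 (lt_ord.1 this))
      refine ⟨_, (csSup_le' hle).lt_of_ne (hFD δ hδD hδκ), fun α hα ↦ ?_⟩
      exact le_csSup ⟨lam, hle⟩ ⟨α, ⟨hα.1, by simpa using mem_iInter.1 hα.2.2 true⟩, rfl⟩
  choose G hGclub hG using hG
  let S : Ordinal.{0} → Set Ordinal.{0} :=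
    WellFoundedLT.fix fun ξ F ↦ Iio (Order.succ lam).ord ∩ ⋂ η : Iio ξ, G (F η.1 η.2)
  have hS : ∀ ξ, S ξ = Iio (Order.succ lam).ord ∩ ⋂ η : Iio ξ, G (S η.1) :=
    fun ξ ↦ WellFoundedLT.fix_eq _ ξ
  have hSG : ∀ η ξ, η < ξ → S ξ ⊆ G (S η) := by
    intro η ξ h x hx
    rw [hS] at hx
    exact mem_iInter.1 hx.2 ⟨η, h⟩
  have hSanti : ∀ η ξ, η < ξ → S ξ ⊆ S η := by
    intro η ξ h x hx
    rw [hS η]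
    rw [hS ξ] at hx
    exact ⟨hx.1, mem_iInter.2 fun ζ ↦ mem_iInter.1 hx.2 ⟨ζ.1, ζ.2.trans h⟩⟩
  have hclub : IsClubIn (S lam.ord) (Order.succ lam).ord := by
    rw [hS]
    refine isClubIn_iInter ho _ ?_ fun η ↦ hGclub _
    rw [← lift_cof, hcof, Cardinal.mk_Iio_ordinal, card_ord, Cardinal.lift_uzero,
      Cardinal.lift_lt]
    exact Order.lt_succ lam
  obtain ⟨δ, hδ, hδκ, hhigh⟩ := hguess _ hclub
  have hx : ∀ ξ : Iio lam.ord, ∃ x : C δ, x.1 ∈ S ξ.1 ∧ x.1 ∉ G (S ξ.1) := by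
    intro ξ
    obtain ⟨θ, hθ, hle⟩ := hG (S ξ.1) δ (hSG _ _ ξ.2 hδ) hδκ
    obtain ⟨α, ⟨hαA, hαC, hαS⟩, hαθ⟩ := (hA (S ξ.1) δ hδκ).2.2
      (hhigh.mono (inter_subset_inter_right _ (hSanti _ _ ξ.2))) θ hθ
    exact ⟨⟨α, hαC⟩, hαS, fun h ↦ (hle α ⟨hαA, h⟩).not_gt hαθ⟩
  choose x hxS hxG using hx
  have hinj : Function.Injective x := by
    have hne : ∀ η ξ : Iio lam.ord, η < ξ → x η ≠ x ξ := fun η ξ h heq ↦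
      hxG η (heq ▸ hSG _ _ h (hxS ξ))
    intro η ξ h
    by_contra h'
    rcases lt_or_gt_of_ne h' with h' | h'
    · exact hne _ _ h' h
    · exact hne _ _ h' h.symm
  have := mk_le_of_injective hinj
  rw [Cardinal.mk_Iio_ordinal, card_ord] at this
  exact this.not_gt (hC δ hδκ)
end

section
/- Let λ be a cardinal with ω < cf(λ) < λ and let ⟨e_δ : δ ∈ E^{λ⁺}_{cf(λ)}⟩ be a sequence such that each e_δ is a club in δ of order type cf(λ) and for every club E ⊆ λ⁺ there are stationarily many δ ∈ E^{λ⁺}_{cf(λ)} with sup{cf(α) : α ∈ e_δ ∩ E} = λ. Then there exists a sequence ⟨C_α : α < λ⁺⟩ such that for every α < λ⁺: (i) max(C_{α+1}) = α; (ii) C_α is a club in α of cardinality < λ; and (iii) if δ ∈ C_α ∩ E^{λ⁺}_{cf(λ)}, then e_δ ⊆ C_α. -/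
open Ordinal Cardinal Set

universe u

/-- The limit points of a set of ordinals: the nonzero ordinals below which it is unbounded. -/
def limitPoints (A : Set Ordinal.{u}) : Set Ordinal.{u} :=
  {p | p ≠ 0 ∧ ∀ q < p, ∃ r ∈ A, q < r ∧ r < p}

theorem mk_limitPoints_le {A : Set Ordinal.{u}} {μ : Cardinal.{u + 1}} (hμ : ℵ₀ ≤ μ)
    (hA : #A ≤ μ) : #(limitPoints A) ≤ μ := by
  classical
  let next (p : Ordinal.{u}) : Option A :=
    if h : ∃ r ∈ A, p ≤ r then some ⟨sInf {r ∈ A | p ≤ r}, (csInf_mem h).1⟩ else none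
  have next_ne {p q : Ordinal.{u}} (hq : q ∈ limitPoints A) (hpq : p < q) : next p ≠ next q := by
    obtain ⟨r, hrA, hpr, hrq⟩ := hq.2 p hpq
    have hp : ∃ r ∈ A, p ≤ r := ⟨r, hrA, hpr.le⟩
    intro h
    by_cases hq' : ∃ r ∈ A, q ≤ r
    · simp only [next, dif_pos hp, dif_pos hq', Option.some.injEq, Subtype.mk.injEq] at h
      have h₁ : sInf {r ∈ A | p ≤ r} ≤ r := csInf_le' ⟨hrA, hpr.le⟩
      have h₂ : q ≤ sInf {r ∈ A | q ≤ r} := (csInf_mem hq').2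
      exact (h₂.trans (h ▸ h₁)).not_gt hrq
    · simp [next, dif_pos hp, dif_neg hq'] at h
  have hinj : Function.Injective fun p : limitPoints A => next p := by
    intro p q h
    by_contra hne
    rcases lt_or_gt_of_ne (Subtype.coe_ne_coe.2 hne) with hlt | hlt
    · exact next_ne q.2 hlt h
    · exact next_ne p.2 hlt h.symm
  calc #(limitPoints A) ≤ #(Option A) := mk_le_of_injective hinj
    _ = #A + 1 := mk_option
    _ ≤ μ := add_le_of_le hμ hA (one_le_aleph0.trans hμ)

theorem isClosedIn_union_limitPoints (A : Set Ordinal.{u}) (o : Ordinal.{u}) :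
    IsClosedIn ((A ∪ limitPoints A) ∩ Iio o) o := by
  refine fun p hpo hp0 hp => ⟨Or.inr ⟨hp0, fun q hq => ?_⟩, hpo⟩
  obtain ⟨r, ⟨hr | hr, -⟩, hqr, hrp⟩ := hp q hq
  · exact ⟨r, hr, hqr, hrp⟩
  · obtain ⟨s, hs, hqs, hsr⟩ := hr.2 q hqr
    exact ⟨s, hs, hqs, hsr.trans hrp⟩

theorem mk_biUnion_le_of_forall_le {ι β : Type u} {s : Set ι} {f : ι → Set β} {μ : Cardinal.{u}}
    (hμ : ℵ₀ ≤ μ) (hs : #s ≤ μ) (hf : ∀ i ∈ s, #(f i) ≤ μ) : #(⋃ i ∈ s, f i) ≤ μ := by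
  refine (mk_biUnion_le f s).trans (mul_le_of_le hμ hs ?_)
  exact ciSup_le' fun i => hf i i.2

/-- A limit point of uncountable cofinality of the union of an increasing sequence of sets
is already a limit point of one of them. -/
theorem exists_mem_limitPoints_of_mem_limitPoints_iUnion {X : ℕ → Set Ordinal.{u}}
    {δ : Ordinal.{u}} (hcof : ℵ₀ < δ.cof) (hδ : δ ∈ limitPoints (⋃ n, X n)) :
    ∃ n, δ ∈ limitPoints (X n) := by
  by_contra! hn
  have hbound (n : ℕ) : ∃ q < δ, ∀ r ∈ X n, q < r → δ ≤ r := by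
    by_contra! h
    exact hn n ⟨hδ.1, h⟩
  choose q hqδ hq using hbound
  have hsup : ⨆ n, q n < δ := by
    refine lift_iSup_lt_of_lt_cof ?_ hqδ
    simpa using hcof
  obtain ⟨r, hr, hqr, hrδ⟩ := hδ.2 _ hsup
  obtain ⟨n, hrn⟩ := mem_iUnion.1 hr
  exact (hq n r hrn ((Ordinal.le_iSup q n).trans_lt hqr)).not_gt hrδ

/-- A set of ordinals below `α` has a superset of no larger infinite size that is closed in `α`
and contains `e δ` for each of its elements `δ` of cofinality `κ`. -/
theorem exists_isClosedIn_superset {κ : Cardinal.{u}} (hκ : ℵ₀ < κ)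
    {e : Ordinal.{u} → Set Ordinal.{u}} {α : Ordinal.{u}} {D : Set Ordinal.{u}}
    {μ : Cardinal.{u + 1}} (hμ : ℵ₀ ≤ μ) (hD : D ⊆ Iio α) (hDμ : #D ≤ μ)
    (he : ∀ δ < α, δ.cof = κ → e δ ⊆ Iio δ) (heμ : ∀ δ < α, δ.cof = κ → #(e δ) ≤ μ) :
    ∃ C, D ⊆ C ∧ C ⊆ Iio α ∧ IsClosedIn C α ∧ #C ≤ μ ∧ ∀ δ ∈ C, δ.cof = κ → e δ ⊆ C := by
  let step (X : Set Ordinal.{u}) : Set Ordinal.{u} :=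
    X ∪ (limitPoints X ∩ Iio α) ∪ ⋃ δ ∈ X ∩ {δ | δ.cof = κ}, e δ
  let X (n : ℕ) : Set Ordinal.{u} := step^[n] D
  have X_succ (n : ℕ) : X (n + 1) = step (X n) := Function.iterate_succ_apply' step n D
  have hX (n : ℕ) : X n ⊆ Iio α ∧ #(X n) ≤ μ := by
    induction n with
    | zero => exact ⟨hD, hDμ⟩
    | succ n ih =>
      obtain ⟨hsub, hcard⟩ := ih
      rw [X_succ]
      constructor
      · refine union_subset (union_subset hsub inter_subset_right) ?_
        exact iUnion₂_subset fun δ hδ => (he δ (hsub hδ.1) hδ.2).trans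
          (Iio_subset_Iio (hsub hδ.1).le)
      · refine (mk_union_le _ _).trans (add_le_of_le hμ ((mk_union_le _ _).trans
          (add_le_of_le hμ hcard ?_)) ?_)
        · exact (mk_le_mk_of_subset inter_subset_left).trans (mk_limitPoints_le hμ hcard)
        · exact mk_biUnion_le_of_forall_le hμ
            ((mk_le_mk_of_subset inter_subset_left).trans hcard)
            fun δ hδ => heμ δ (hsub hδ.1) hδ.2
  let U : Set Ordinal.{u} := ⋃ n, X n
  have hUα : U ⊆ Iio α := iUnion_subset fun n => (hX n).1
  have hUμ : #U ≤ μ := by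
    have h := mk_iUnion_le_lift X
    simp only [Cardinal.lift_uzero, mk_nat, Cardinal.lift_aleph0] at h
    exact h.trans (mul_le_of_le hμ hμ (ciSup_le' fun n => (hX n).2))
  have hUe (δ : Ordinal.{u}) (hδ : δ ∈ U) (hcof : δ.cof = κ) : e δ ⊆ U := by
    obtain ⟨n, hn⟩ := mem_iUnion.1 hδ
    refine subset_iUnion_of_subset (n + 1) ?_
    rw [X_succ]
    have hmem : δ ∈ X n ∩ {δ | δ.cof = κ} := ⟨hn, hcof⟩
    exact subset_union_of_subset_right (subset_biUnion_of_mem (u := e) hmem) _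
  have hUC : U ⊆ (U ∪ limitPoints U) ∩ Iio α := subset_inter subset_union_left hUα
  refine ⟨(U ∪ limitPoints U) ∩ Iio α, (subset_iUnion X 0).trans hUC, inter_subset_right,
    isClosedIn_union_limitPoints U α, ?_, ?_⟩
  · exact (mk_le_mk_of_subset inter_subset_left).trans
      ((mk_union_le _ _).trans (add_le_of_le hμ hUμ (mk_limitPoints_le hμ hUμ)))
  · rintro δ ⟨hδ | hδ, hδα⟩ hcof
    · exact (hUe δ hδ hcof).trans hUC
    · obtain ⟨n, hn⟩ := exists_mem_limitPoints_of_mem_limitPoints_iUnion (hcof ▸ hκ) hδ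
      refine (hUe δ (mem_iUnion.2 ⟨n + 1, ?_⟩) hcof).trans hUC
      rw [X_succ]
      exact Or.inl (Or.inr ⟨hn, hδα⟩)

theorem exists_isCofinalIn_mk_eq_cof (α : Ordinal.{u}) :
    ∃ D : Set Ordinal.{u}, IsCofinalIn D α ∧ #D = Cardinal.lift.{u + 1} α.cof := by
  obtain ⟨s, hs, hcard⟩ := Order.exists_cof_eq (Iio α)
  refine ⟨(↑) '' s, ⟨?_, fun p hp => ?_⟩, ?_⟩
  · rintro _ ⟨x, -, rfl⟩
    exact x.2
  · obtain ⟨q, hq, hpq⟩ := hs ⟨p, hp⟩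
    exact ⟨q, mem_image_of_mem _ hq, hpq⟩
  · rw [mk_image_eq Subtype.val_injective, hcard, cof_Iio, lift_cof]

/-- Every ordinal below the successor of a singular cardinal `c` has cofinality below `c`. -/
theorem cof_lt_of_lt_ord_succ {c : Cardinal.{u}} (hc : c.ord.cof < c) {α : Ordinal.{u}}
    (hα : α < (Order.succ c).ord) : α.cof < c := by
  refine lt_of_le_of_ne ((cof_le_card α).trans (Order.lt_succ_iff.1 (lt_ord.1 hα))) fun h => ?_
  have := cof_ord_cof α
  rw [h] at this
  exact hc.ne this

theorem C_sequence_from_club_guessing (lam : Cardinal.{0})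
    (h1 : Cardinal.aleph0 < lam.ord.cof) (h2 : lam.ord.cof < lam)
    (e : Ordinal.{0} → Set Ordinal.{0})
    (he1 : ∀ δ, δ < (Order.succ lam).ord → Ordinal.cof δ = lam.ord.cof →
      IsClubIn (e δ) δ ∧ Nonempty ((e δ) ≃o Set.Iio lam.ord.cof.ord))
    (he2 : ∀ E : Set Ordinal, IsClubIn E (Order.succ lam).ord →
      IsStationaryIn
        {δ | δ < (Order.succ lam).ord ∧ Ordinal.cof δ = lam.ord.cof ∧
          sSup (Ordinal.cof '' (e δ ∩ E)) = lam}
        (Order.succ lam).ord) :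
    ∃ C : Ordinal.{0} → Set Ordinal.{0},
      ∀ α, α < (Order.succ lam).ord →
        -- (i) `max (C (α+1)) = α`
        IsGreatest (C (α + 1)) α ∧
        -- (ii) `C α` is a club in `α` of cardinality `< λ`
        IsClubIn (C α) α ∧ Cardinal.mk (C α) < Cardinal.lift.{1} lam ∧
        -- (iii) coherence with the club guessing sequence
        (∀ δ ∈ C α, Ordinal.cof δ = lam.ord.cof → e δ ⊆ C α) := by
  have hlam : ℵ₀ ≤ lam := (h1.trans h2).le
  have key (α : Ordinal.{0}) : ∃ C : Set Ordinal.{0}, α < (Order.succ lam).ord →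
      IsClubIn C α ∧ #C < Cardinal.lift.{1} lam ∧ ∀ δ ∈ C, δ.cof = lam.ord.cof → e δ ⊆ C := by
    by_cases hα : α < (Order.succ lam).ord
    · obtain ⟨D, ⟨hDα, hD⟩, hDcard⟩ := exists_isCofinalIn_mk_eq_cof α
      obtain ⟨C, hDC, hCα, hclosed, hcard, hCe⟩ := exists_isClosedIn_superset h1 (e := e)
        (μ := Cardinal.lift.{1} (max α.cof lam.ord.cof)) (D := D) (α := α)
        (aleph0_le_lift.2 (h1.le.trans (le_max_right _ _))) hDα
        (hDcard.trans_le (Cardinal.lift_le.2 (le_max_left _ _)))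
        (fun δ hδ hcof => (he1 δ (hδ.trans hα) hcof).1.1)
        (fun δ hδ hcof => by
          obtain ⟨f⟩ := (he1 δ (hδ.trans hα) hcof).2
          rw [mk_congr f.toEquiv, Cardinal.mk_Iio_ordinal, card_ord]
          exact Cardinal.lift_le.2 (le_max_right _ _))
      refine ⟨C, fun _ => ⟨⟨hCα, hclosed, fun p hp => ?_⟩, hcard.trans_lt ?_, hCe⟩⟩
      · obtain ⟨q, hq, hpq⟩ := hD p hp
        exact ⟨q, hDC hq, hpq⟩
      · exact Cardinal.lift_lt.2 (max_lt (cof_lt_of_lt_ord_succ h2 hα) h2)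
    · exact ⟨∅, fun h => absurd h hα⟩
  choose C hC using key
  refine ⟨C, fun α hα => ⟨?_, hC α hα⟩⟩
  have hα' : α + 1 < (Order.succ lam).ord :=
    (isSuccLimit_ord (hlam.trans (Order.le_succ lam))).add_one_lt hα
  obtain ⟨hsub, -, hcof⟩ := (hC (α + 1) hα').1
  have hle : ∀ q ∈ C (α + 1), q ≤ α := fun q hq => Order.lt_add_one_iff.1 (hsub hq)
  obtain ⟨q, hq, hαq⟩ := hcof α (lt_add_one α)
  exact ⟨(hle q hq).antisymm hαq ▸ hq, hle⟩
end

section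
/- Suppose λ is a cardinal with λ > cf(λ) = ω. Then there exists a strictly increasing sequence of successor cardinals ⟨μ_m : m < ω⟩ with sup{μ_m : m < ω} = λ, and a matrix ⟨e^m_δ : δ ∈ E^{λ⁺}_{ω₁}, m < ω⟩ such that: (1) for each δ, ⟨e^m_δ : m < ω⟩ is an ⊆-increasing chain of club subsets of δ; (2) |e^m_δ| ≤ μ_m for all δ and m; and (3) for every club E ⊆ λ⁺, there are stationarily many δ ∈ E^{λ⁺}_{ω₁} such that for all m < ω, sup(e^m_δ ∩ E ∩ E^δ_{>μ_m}) = δ. -/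
open Ordinal Cardinal Set

/-- A choice of a cofinal sequence of length `cof β` below every ordinal `β`, extended by junk values
below `β`. -/
theorem exists_ladder_system : ∃ g : Ordinal.{0} → Ordinal.{0} → Ordinal.{0},
    (∀ β t, β ≠ 0 → g β t < β) ∧ ∀ β, ∀ ξ < β, ∃ t < β.cof.ord, ξ ≤ g β t := by
  have key : ∀ β : Ordinal.{0}, ∃ f : Ordinal.{0} → Ordinal.{0},
      (∀ t, β ≠ 0 → f t < β) ∧ ∀ ξ < β, ∃ t < β.cof.ord, ξ ≤ f t := by
    intro β
    obtain ⟨f, hf⟩ := Ordinal.exists_isFundamentalSeq (o := β) rfl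
    classical
    refine ⟨fun t => if h : t < β.cof.ord then (f ⟨t, h⟩).1 else 0, fun t hβ => ?_, fun ξ hξ => ?_⟩
    · dsimp only
      split_ifs with h
      · exact (f ⟨t, h⟩).2
      · exact pos_iff_ne_zero.2 hβ
    · obtain ⟨_, ⟨⟨t, ht⟩, rfl⟩, hle⟩ := hf.isCofinal_range ⟨ξ, hξ⟩
      refine ⟨t, ht, ?_⟩
      have ht' : t < β.cof.ord := ht
      simp only [dif_pos ht']
      exact hle
  choose g hg using key
  exact ⟨g, fun β => (hg β).1, fun β => (hg β).2⟩

/-- The iteration of `h` starting above `p`, taking suprema at limit stages. -/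
noncomputable def iterSup (h : Ordinal.{0} → Ordinal.{0}) (p : Ordinal.{0}) (i : Ordinal.{0}) :
    Ordinal.{0} :=
  max p (⨆ j : Set.Iio i, (max (iterSup h p j.1) (h (iterSup h p j.1)) + 1))
termination_by i
decreasing_by all_goals exact j.2

theorem max_lt_iterSup (h : Ordinal.{0} → Ordinal.{0}) (p : Ordinal.{0}) {i j : Ordinal.{0}}
    (hij : j < i) : max (iterSup h p j) (h (iterSup h p j)) < iterSup h p i := by
  conv_rhs => rw [iterSup]
  refine lt_max_of_lt_right (Order.add_one_le_iff.1 ?_)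
  exact Ordinal.le_iSup
    (fun j : Set.Iio i => max (iterSup h p j.1) (h (iterSup h p j.1)) + 1) ⟨j, hij⟩

theorem iSup_Iio_lt_ord {κ : Cardinal.{0}} (hκ : κ.IsRegular) {i : Ordinal.{0}} (hi : i.card < κ)
    {f : Set.Iio i → Ordinal.{0}} (hf : ∀ j, f j < κ.ord) : (⨆ j, f j) < κ.ord := by
  apply Ordinal.lift_iSup_lt_of_lt_cof _ hf
  rw [← Ordinal.lift_cof, hκ.cof_ord, Cardinal.mk_Iio_ordinal, Cardinal.lift_lift]
  exact Cardinal.lift_lt.2 hi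

theorem iterSup_lt_ord {κ : Cardinal.{0}} (hκ : κ.IsRegular) {h : Ordinal.{0} → Ordinal.{0}}
    (hh : ∀ r < κ.ord, h r < κ.ord) {p : Ordinal.{0}} (hp : p < κ.ord) (i : Ordinal.{0})
    (hi : i < κ.ord) : iterSup h p i < κ.ord := by
  induction i using WellFoundedLT.induction with
  | ind i ih =>
    rw [iterSup]
    refine max_lt hp (iSup_Iio_lt_ord hκ (Cardinal.lt_ord.1 hi) fun j => ?_)
    have hj := ih j.1 j.2 (lt_trans j.2 hi)
    exact (Cardinal.isSuccLimit_ord hκ.aleph0_le).add_one_lt (max_lt hj (hh _ hj))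

/-- Below a regular cardinal there are unboundedly many ordinals of any smaller regular cofinality
which are limits of points moved by `h`. -/
theorem exists_cof_eq_and_forall_lt {κ θ : Cardinal.{0}} (hκ : κ.IsRegular) (hθ : θ.IsRegular)
    (hlt : θ < κ) {h : Ordinal.{0} → Ordinal.{0}} (hh : ∀ r < κ.ord, h r < κ.ord)
    {p : Ordinal.{0}} (hp : p < κ.ord) :
    ∃ δ, p < δ ∧ δ < κ.ord ∧ δ.cof = θ ∧ ∀ q < δ, ∃ r, q ≤ r ∧ r < κ.ord ∧ h r < δ := by
  have hlim := Cardinal.isSuccLimit_ord hκ.aleph0_le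
  have hθlim := Cardinal.isSuccLimit_ord hθ.aleph0_le
  have hθκ : θ.ord < κ.ord := Cardinal.ord_lt_ord.2 hlt
  have hFlt : ∀ i < θ.ord, iterSup h p i < κ.ord := fun i hi =>
    iterSup_lt_ord hκ hh hp i (hi.trans hθκ)
  have hle : ∀ i < θ.ord, iterSup h p i < ⨆ i : Set.Iio θ.ord, (iterSup h p i.1 + 1) :=
    fun i hi => Order.add_one_le_iff.1
      (Ordinal.le_iSup (fun i : Set.Iio θ.ord => iterSup h p i.1 + 1) ⟨i, hi⟩)
  refine ⟨⨆ i : Set.Iio θ.ord, (iterSup h p i.1 + 1), ?_, ?_, ?_, fun q hq => ?_⟩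
  · refine lt_of_le_of_lt ?_ (hle 0 hθ.ord_pos)
    rw [iterSup]
    exact le_max_left _ _
  · exact iSup_Iio_lt_ord hκ (by simpa using hlt) fun i => hlim.add_one_lt (hFlt i.1 i.2)
  · rw [Ordinal.cof_iSup_Iio_add_one (f := fun i : Set.Iio θ.ord => iterSup h p i.1), hθ.cof_ord]
    exact fun i j hij => (le_max_left _ _).trans_lt (max_lt_iterSup h p hij)
  · obtain ⟨⟨i, hi⟩, hqi⟩ := (Ordinal.lt_iSup_iff).1 hq
    refine ⟨iterSup h p i, Order.lt_add_one_iff.1 hqi, hFlt i hi, ?_⟩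
    have hi' : i + 1 < θ.ord := hθlim.add_one_lt hi
    exact ((le_max_right _ _).trans_lt (max_lt_iterSup h p (lt_add_one i))).trans (hle _ hi')

theorem IsClubIn.exists_gt {κ : Cardinal.{0}} (hκ : κ.IsRegular) {C : Set Ordinal.{0}}
    (hC : IsClubIn C κ.ord) {p : Ordinal.{0}} (hp : p < κ.ord) : ∃ q ∈ C, p < q := by
  obtain ⟨q, hq, hpq⟩ := hC.2.2 _ ((Cardinal.isSuccLimit_ord hκ.aleph0_le).add_one_lt hp)
  exact ⟨q, hq, Order.add_one_le_iff.1 hpq⟩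

theorem IsClubIn.iInter {κ : Cardinal.{0}} (hκ : κ.IsRegular) (hκ' : Cardinal.aleph0 < κ)
    {i : Ordinal.{0}} (hi : i.card < κ) {C : Ordinal.{0} → Set Ordinal.{0}}
    (hC : ∀ j < i, IsClubIn (C j) κ.ord) :
    IsClubIn {x | x < κ.ord ∧ ∀ j < i, x ∈ C j} κ.ord := by
  refine ⟨fun x hx => hx.1, fun p hp hp0 hlim => ⟨hp, fun j hj => ?_⟩, fun p hp => ?_⟩
  · refine (hC j hj).2.1 p hp hp0 fun q hq => ?_
    obtain ⟨r, hr, hqr⟩ := hlim q hq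
    exact ⟨r, hr.2 j hj, hqr⟩
  · have hex : ∀ j : Set.Iio i, ∀ r : Ordinal.{0}, ∃ q, r < κ.ord → q ∈ C j.1 ∧ r < q := by
      intro j r
      by_cases hr : r < κ.ord
      · obtain ⟨q, hq⟩ := (hC j.1 j.2).exists_gt hκ hr
        exact ⟨q, fun _ => hq⟩
      · exact ⟨0, fun h => absurd h hr⟩
    choose n hn using hex
    obtain ⟨δ, hpδ, hδ, -, hδr⟩ := exists_cof_eq_and_forall_lt hκ Cardinal.isRegular_aleph0 hκ'
      (h := fun r => ⨆ j, n j r)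
      (fun r hr => iSup_Iio_lt_ord hκ hi fun j => (hC j.1 j.2).1 (hn j r hr).1) hp
    refine ⟨δ, ⟨hδ, fun j hj => ?_⟩, hpδ.le⟩
    refine (hC j hj).2.1 δ hδ (pos_of_gt hpδ).ne' fun q hq => ?_
    obtain ⟨r, hqr, hr, hrδ⟩ := hδr q hq
    obtain ⟨h1, h2⟩ := hn ⟨j, hj⟩ r hr
    exact ⟨_, h1, hqr.trans_lt h2, (Ordinal.le_iSup (fun j => n j r) ⟨j, hj⟩).trans_lt hrδ⟩

theorem IsClubIn.inter {κ : Cardinal.{0}} (hκ : κ.IsRegular) (hκ' : Cardinal.aleph0 < κ)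
    {A B : Set Ordinal.{0}} (hA : IsClubIn A κ.ord) (hB : IsClubIn B κ.ord) :
    IsClubIn (A ∩ B) κ.ord := by
  have h := IsClubIn.iInter hκ hκ' (i := 2) (C := fun j => if j = 0 then A else B)
    (by simpa using (Cardinal.natCast_lt_aleph0 (n := 2)).trans hκ')
    (fun j _ => by split_ifs <;> assumption)
  convert h using 1
  ext x
  constructor
  · rintro ⟨h1, h2⟩
    exact ⟨hA.1 h1, fun j _ => by split_ifs <;> assumption⟩
  · rintro ⟨-, h2⟩
    exact ⟨by simpa using h2 0 (by simp), by simpa using h2 1 (by simp)⟩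

theorem IsClubIn.exists_gt_lt_cof {κ ν : Cardinal.{0}} (hκ : κ.IsRegular)
    (hν : Cardinal.aleph0 ≤ ν) (hνκ : Order.succ ν < κ) {E : Set Ordinal.{0}}
    (hE : IsClubIn E κ.ord) {p : Ordinal.{0}} (hp : p < κ.ord) :
    ∃ q ∈ E, p < q ∧ ν < q.cof := by
  have hex : ∀ r : Ordinal.{0}, ∃ q, r < κ.ord → q ∈ E ∧ r < q := by
    intro r
    by_cases hr : r < κ.ord
    · obtain ⟨q, hq⟩ := hE.exists_gt hκ hr
      exact ⟨q, fun _ => hq⟩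
    · exact ⟨0, fun h => absurd h hr⟩
  choose n hn using hex
  obtain ⟨δ, hpδ, hδ, hcof, hδr⟩ := exists_cof_eq_and_forall_lt hκ (Cardinal.isRegular_succ hν) hνκ
    (h := n) (fun r hr => hE.1 (hn r hr).1) hp
  refine ⟨δ, hE.2.1 δ hδ (pos_of_gt hpδ).ne' fun q hq => ?_, hpδ, ?_⟩
  · obtain ⟨r, hqr, hr, hrδ⟩ := hδr q hq
    exact ⟨_, (hn r hr).1, hqr.trans_lt (hn r hr).2, hrδ⟩
  · rw [hcof]
    exact Order.lt_succ ν

theorem exists_mem_cof_eq_aleph_one {κ : Cardinal.{0}} (hκ : κ.IsRegular)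
    (hκ' : Cardinal.aleph 1 < κ) {μ : ℕ → Cardinal.{0}} (hμ : ∀ m, Cardinal.aleph0 ≤ μ m)
    (hμκ : ∀ m, Order.succ (μ m) < κ) {E : Set Ordinal.{0}} (hE : IsClubIn E κ.ord) :
    ∃ δ ∈ E, δ.cof = Cardinal.aleph 1 ∧
      ∀ m, ∀ q < δ, ∃ ξ ∈ E, q < ξ ∧ ξ < δ ∧ μ m < ξ.cof := by
  have hex : ∀ (m : ℕ) (r : Ordinal.{0}), ∃ q, r < κ.ord → q ∈ E ∧ r < q ∧ μ m < q.cof := by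
    intro m r
    by_cases hr : r < κ.ord
    · obtain ⟨q, hq⟩ := hE.exists_gt_lt_cof hκ (hμ m) (hμκ m) hr
      exact ⟨q, fun _ => hq⟩
    · exact ⟨0, fun h => absurd h hr⟩
  choose n hn using hex
  obtain ⟨δ, hpδ, hδ, hcof, hδr⟩ := exists_cof_eq_and_forall_lt hκ
    Cardinal.isRegular_aleph_one hκ' (h := fun r => ⨆ m, n m r)
    (fun r hr => Ordinal.iSup_lt_of_lt_cof (by
      rw [hκ.cof_ord, Cardinal.mk_nat]
      exact (Cardinal.aleph0_le_aleph 1).trans_lt hκ') fun m => hE.1 (hn m r hr).1) hκ.ord_pos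
  have hlim : ∀ m, ∀ q < δ, ∃ ξ ∈ E, q < ξ ∧ ξ < δ ∧ μ m < ξ.cof := by
    intro m q hq
    obtain ⟨r, hqr, hr, hrδ⟩ := hδr q hq
    obtain ⟨h1, h2, h3⟩ := hn m r hr
    exact ⟨_, h1, hqr.trans_lt h2, (Ordinal.le_iSup (fun m => n m r) m).trans_lt hrδ, h3⟩
  refine ⟨δ, hE.2.1 δ hδ hpδ.ne' fun q hq => ?_, hcof, hlim⟩
  obtain ⟨ξ, h1, h2, h3, -⟩ := hlim 0 q hq
  exact ⟨ξ, h1, h2, h3⟩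

/-- The largest element of `E` that is at most `α`, when `E` is closed. -/
noncomputable def proj (E : Set Ordinal.{0}) (α : Ordinal.{0}) : Ordinal.{0} :=
  sSup (E ∩ Set.Iic α)

theorem proj_le (E : Set Ordinal.{0}) (α : Ordinal.{0}) : proj E α ≤ α :=
  csSup_le' fun _ hx => hx.2

theorem bddAbove_inter_Iic (E : Set Ordinal.{0}) (α : Ordinal.{0}) : BddAbove (E ∩ Set.Iic α) :=
  ⟨α, fun _ hx => hx.2⟩

theorem le_proj {E : Set Ordinal.{0}} {ξ α : Ordinal.{0}} (hξ : ξ ∈ E) (h : ξ ≤ α) :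
    ξ ≤ proj E α :=
  le_csSup (bddAbove_inter_Iic E α) ⟨hξ, h⟩

theorem proj_anti {E E' : Set Ordinal.{0}} (h : E' ⊆ E) (α : Ordinal.{0}) :
    proj E' α ≤ proj E α :=
  csSup_le' fun _ hx => le_proj (h hx.1) hx.2

theorem proj_mem {o : Ordinal.{0}} {E : Set Ordinal.{0}} (hE : IsClosedIn E o) {ξ α : Ordinal.{0}}
    (hξ : ξ ∈ E) (h : ξ ≤ α) (hα : α < o) : proj E α ∈ E := by
  by_contra hmem
  have hξp := le_proj hξ h
  refine hmem (hE _ ((proj_le E α).trans_lt hα) (fun h0 => ?_) fun q hq => ?_)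
  · rw [h0] at hξp hmem
    exact hmem (nonpos_iff_eq_zero.1 hξp ▸ hξ)
  · have hne : (E ∩ Set.Iic α).Nonempty := ⟨ξ, hξ, h⟩
    obtain ⟨r, hr, hqr⟩ := exists_lt_of_lt_csSup hne hq
    refine ⟨r, hr.1, hqr, (le_proj hr.1 hr.2).lt_of_ne ?_⟩
    rintro rfl
    exact hmem hr.1

/-- The result of descending from `β` along the ladder system `g` at the positions listed, moving
down into `E` after every step. -/
noncomputable def walk (g : Ordinal.{0} → Ordinal.{0} → Ordinal.{0}) (E : Set Ordinal.{0})
    (β : Ordinal.{0}) (l : List Ordinal.{0}) : Ordinal.{0} :=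
  l.foldl (fun γ t => proj E (g γ t)) β

/-- The points below `δ` reached from `δ` by walks along positions below `c`, together with the
first `c` points of the ladder at `δ`. -/
def walkSet (g : Ordinal.{0} → Ordinal.{0} → Ordinal.{0}) (E : Set Ordinal.{0})
    (δ c : Ordinal.{0}) : Set Ordinal.{0} :=
  {x | ∃ l : List Ordinal.{0}, (∀ t ∈ l, t < c) ∧ walk g E δ l = x} ∪ g δ '' Set.Iio c

/-- The topological closure of `Y` in `δ`, with `0` added. -/
def closureIn (Y : Set Ordinal.{0}) (δ : Ordinal.{0}) : Set Ordinal.{0} :=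
  {p | p < δ ∧ ∀ q < p, ∃ r ∈ Y, q < r ∧ r ≤ p}

theorem walkSet_mono (g : Ordinal.{0} → Ordinal.{0} → Ordinal.{0}) (E : Set Ordinal.{0})
    (δ : Ordinal.{0}) {c d : Ordinal.{0}} (h : c ≤ d) : walkSet g E δ c ⊆ walkSet g E δ d := by
  rintro x (⟨l, hl, hx⟩ | hx)
  · exact Or.inl ⟨l, fun t ht => (hl t ht).trans_le h, hx⟩
  · exact Or.inr (Set.image_mono (Set.Iio_subset_Iio h) hx)

theorem closureIn_mono {Y Z : Set Ordinal.{0}} (h : Y ⊆ Z) (δ : Ordinal.{0}) :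
    closureIn Y δ ⊆ closureIn Z δ := by
  rintro p ⟨hp, hlim⟩
  refine ⟨hp, fun q hq => ?_⟩
  obtain ⟨r, hr, hqr⟩ := hlim q hq
  exact ⟨r, h hr, hqr⟩

theorem mem_closureIn {Y : Set Ordinal.{0}} {δ p : Ordinal.{0}} (hp : p ∈ Y) (hpδ : p < δ) :
    p ∈ closureIn Y δ :=
  ⟨hpδ, fun _ hq => ⟨p, hp, hq, le_rfl⟩⟩

theorem isClubIn_closureIn {Y : Set Ordinal.{0}} {δ : Ordinal.{0}}
    (hY : ∀ p < δ, ∃ y ∈ Y, p ≤ y ∧ y < δ) : IsClubIn (closureIn Y δ) δ := by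
  refine ⟨fun p hp => hp.1, fun p hp _ hlim => ⟨hp, fun q hq => ?_⟩, fun p hp => ?_⟩
  · obtain ⟨r, hr, hqr, hrp⟩ := hlim q hq
    obtain ⟨s, hs, hqs, hsr⟩ := hr.2 q hqr
    exact ⟨s, hs, hqs, hsr.trans hrp.le⟩
  · obtain ⟨y, hy, hpy, hyδ⟩ := hY p hp
    exact ⟨y, mem_closureIn hy hyδ, hpy⟩

theorem mk_closureIn_le {Y : Set Ordinal.{0}} {δ : Ordinal.{0}}
    (hY : ∀ p < δ, ∃ y ∈ Y, p ≤ y ∧ y < δ) {c : Cardinal.{1}} (hc : Cardinal.aleph0 ≤ c)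
    (hYc : Cardinal.mk Y ≤ c) : Cardinal.mk (closureIn Y δ) ≤ c := by
  classical
  have hmin : ∀ p : closureIn Y δ, ∃ y : Y, p.1 ≤ y.1 ∧ ∀ z ∈ Y, p.1 ≤ z → y.1 ≤ z := by
    intro p
    obtain ⟨y, hy, hpy, -⟩ := hY p.1 p.2.1
    have hne : {z | z ∈ Y ∧ p.1 ≤ z}.Nonempty := ⟨y, hy, hpy⟩
    have hm := csInf_mem hne
    exact ⟨⟨_, hm.1⟩, hm.2, fun z hz hpz => csInf_le' ⟨hz, hpz⟩⟩
  choose f hf hf' using hmin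
  have haux : ∀ p p' : closureIn Y δ, p.1 < p'.1 → f p = f p' → (f p').1 = p'.1 := by
    intro p p' hlt heq
    obtain ⟨r, hr, hpr, hrp⟩ := p'.2.2 p.1 hlt
    exact le_antisymm (heq ▸ (hf' p r hr hpr.le).trans hrp) (hf p')
  have hinj : Function.Injective fun p : closureIn Y δ =>
      ((f p, ⟨decide ((f p).1 = p.1)⟩) : Y × ULift.{1} Bool) := by
    intro p p' h
    simp only [Prod.mk.injEq, ULift.up.injEq, decide_eq_decide] at h
    obtain ⟨h1, h2⟩ := h
    by_contra hne
    rcases lt_or_gt_of_ne (fun h => hne (Subtype.ext h)) with hlt | hlt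
    · have h3 := haux p p' hlt h1
      have h4 := h2.2 h3
      rw [h1] at h4
      exact hlt.ne (h4.symm.trans h3)
    · have h3 := haux p' p hlt h1.symm
      have h4 := h2.1 h3
      rw [← h1] at h4
      exact hlt.ne (h4.symm.trans h3)
  refine (Cardinal.mk_le_of_injective hinj).trans ?_
  rw [Cardinal.mk_prod]
  simp only [Cardinal.lift_id, Cardinal.mk_uLift, Cardinal.mk_bool]
  refine Cardinal.mul_le_of_le hc hYc ?_
  simpa using (Cardinal.natCast_lt_aleph0 (n := 2)).le.trans hc

theorem mk_walkSet_le (g : Ordinal.{0} → Ordinal.{0} → Ordinal.{0}) (E : Set Ordinal.{0})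
    (δ : Ordinal.{0}) {ν : Cardinal.{0}} (hν : Cardinal.aleph0 ≤ ν) :
    Cardinal.mk (walkSet g E δ ν.ord) ≤ Cardinal.lift.{1} ν := by
  have hν' : Cardinal.aleph0 ≤ Cardinal.lift.{1} ν := by simpa using hν
  have hIio : Cardinal.mk (Set.Iio ν.ord) = Cardinal.lift.{1} ν := by
    rw [Cardinal.mk_Iio_ordinal, Cardinal.card_ord]
  refine (Cardinal.mk_union_le _ _).trans (Cardinal.add_le_of_le hν' ?_ ?_)
  · have hsub : {x | ∃ l : List Ordinal.{0}, (∀ t ∈ l, t < ν.ord) ∧ walk g E δ l = x} ⊆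
        Set.range fun l : List (Set.Iio ν.ord) => walk g E δ (l.map Subtype.val) := by
      rintro x ⟨l, hl, rfl⟩
      lift l to List (Set.Iio ν.ord) using hl
      exact ⟨l, rfl⟩
    refine (Cardinal.mk_le_mk_of_subset hsub).trans (Cardinal.mk_range_le.trans ?_)
    exact (Cardinal.mk_list_le_max _).trans (max_le hν' hIio.le)
  · exact Cardinal.mk_image_le.trans hIio.le

/-- If `ξ` has large cofinality and lies in all members of a decreasing family of closed sets, then
a walk towards `ξ` reaches a point of large cofinality, and this point does not depend on the member
of the family from some index on. -/
theorem exists_walk_eventually_eq {g : Ordinal.{0} → Ordinal.{0} → Ordinal.{0}}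
    (hg : ∀ β t, β ≠ 0 → g β t < β) (hg' : ∀ β, ∀ ξ < β, ∃ t < β.cof.ord, ξ ≤ g β t)
    {o θ : Ordinal.{0}} (hθ : 0 < θ) {F : Ordinal.{0} → Set Ordinal.{0}}
    (hF : ∀ i < θ, IsClosedIn (F i) o) (hanti : Antitone F) {ν : Cardinal.{0}} {ξ : Ordinal.{0}}
    (hξ : ∀ i < θ, ξ ∈ F i) (hξν : ν < ξ.cof) (β : Ordinal.{0}) (hξβ : ξ < β) (hβ : β < o)
    (hβν : β.cof ≤ ν) :
    ∃ i₀ < θ, ∃ l : List Ordinal.{0}, (∀ t ∈ l, t < ν.ord) ∧ ∃ x, ξ ≤ x ∧ x < β ∧ ν < x.cof ∧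
      ∀ i, i₀ ≤ i → i < θ → walk g (F i) β l = x ∧ x ∈ F i := by
  induction β using WellFoundedLT.induction with
  | ind β ih =>
    obtain ⟨t, ht, hξt⟩ := hg' β ξ hξβ
    have hαβ : g β t < β := hg β t (pos_of_gt hξβ).ne'
    have htν : t < ν.ord := ht.trans_le (Cardinal.ord_le_ord.2 hβν)
    obtain ⟨i₀, hi₀, hmin⟩ : ∃ i₀ < θ, ∀ i < θ, proj (F i₀) (g β t) ≤ proj (F i) (g β t) := by
      have hm := csInf_mem (s := (fun i => proj (F i) (g β t)) '' Set.Iio θ) ⟨_, 0, hθ, rfl⟩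
      obtain ⟨i₀, hi₀, h0⟩ := hm
      refine ⟨i₀, hi₀, fun i hi => ?_⟩
      have h0' : proj (F i₀) (g β t) = _ := h0
      rw [h0']
      exact csInf_le' ⟨i, hi, rfl⟩
    have hstab : ∀ i, i₀ ≤ i → i < θ → proj (F i) (g β t) = proj (F i₀) (g β t) :=
      fun i h1 h2 => le_antisymm (proj_anti (hanti h1) _) (hmin i h2)
    have hmem : ∀ i, i₀ ≤ i → i < θ → proj (F i₀) (g β t) ∈ F i := fun i h1 h2 =>
      hstab i h1 h2 ▸ proj_mem (hF i h2) (hξ i h2) hξt (hαβ.trans hβ)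
    have hξγ : ξ ≤ proj (F i₀) (g β t) := le_proj (hξ i₀ hi₀) hξt
    have hγβ : proj (F i₀) (g β t) < β := (proj_le _ _).trans_lt hαβ
    by_cases hcof : ν < (proj (F i₀) (g β t)).cof
    · refine ⟨i₀, hi₀, [t], by simpa using htν, _, hξγ, hγβ, hcof, fun i h1 h2 => ?_⟩
      exact ⟨hstab i h1 h2, hmem i h1 h2⟩
    · have hξγ' : ξ < proj (F i₀) (g β t) := hξγ.lt_of_ne fun h => hcof (h ▸ hξν)
      obtain ⟨i₁, hi₁, l, hl, x, hξx, hxγ, hx, hw⟩ :=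
        ih _ hγβ hξγ' (hγβ.trans hβ) (not_lt.1 hcof)
      refine ⟨max i₀ i₁, max_lt hi₀ hi₁, t :: l, ?_, x, hξx, hxγ.trans hγβ, hx, fun i h1 h2 => ?_⟩
      · simpa using ⟨htν, hl⟩
      · obtain ⟨h3, h4⟩ := hw i ((le_max_right _ _).trans h1) h2
        refine ⟨?_, h4⟩
        rw [← h3, ← hstab i ((le_max_left _ _).trans h1) h2]
        rfl

/-- The decreasing sequence of sets obtained by iterating `G` and intersecting. -/
def iterInter (o : Ordinal.{0}) (G : Set Ordinal.{0} → Set Ordinal.{0}) (i : Ordinal.{0}) :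
    Set Ordinal.{0} :=
  {x | x < o ∧ ∀ j, ∀ _ : j < i, x ∈ G (iterInter o G j)}
termination_by i

theorem iterInter_subset (o : Ordinal.{0}) (G : Set Ordinal.{0} → Set Ordinal.{0})
    {i j : Ordinal.{0}} (h : j < i) : iterInter o G i ⊆ G (iterInter o G j) := by
  intro x hx
  rw [iterInter] at hx
  exact hx.2 j h

theorem iterInter_antitone (o : Ordinal.{0}) (G : Set Ordinal.{0} → Set Ordinal.{0}) :
    Antitone (iterInter o G) := by
  intro i j hij x hx
  rw [iterInter] at hx ⊢
  exact ⟨hx.1, fun k hk => hx.2 k (hk.trans_le hij)⟩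

theorem isClubIn_iterInter {κ : Cardinal.{0}} (hκ : κ.IsRegular) (hκ' : Cardinal.aleph0 < κ)
    {G : Set Ordinal.{0} → Set Ordinal.{0}}
    (hG : ∀ E, IsClubIn E κ.ord → IsClubIn (G E) κ.ord) (i : Ordinal.{0}) (hi : i < κ.ord) :
    IsClubIn (iterInter κ.ord G i) κ.ord := by
  induction i using WellFoundedLT.induction with
  | ind i ih =>
    rw [iterInter]
    exact IsClubIn.iInter hκ hκ' (Cardinal.lt_ord.1 hi) (C := fun j => G (iterInter κ.ord G j))
      fun j hj => hG _ (ih j hj (hj.trans hi))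

/-- A version of off-center club guessing in which the witnesses come from walks, with respect to a
suitable club `E`. -/
theorem exists_isClubIn_guess {κ : Cardinal.{0}} (hκ : κ.IsRegular)
    (hκ2 : Order.succ (Cardinal.aleph 1) < κ) {μ : ℕ → Cardinal.{0}}
    (hμ : ∀ m, Cardinal.aleph 1 ≤ μ m) (hμκ : ∀ m, Order.succ (μ m) < κ)
    {g : Ordinal.{0} → Ordinal.{0} → Ordinal.{0}}
    (hg : ∀ β t, β ≠ 0 → g β t < β) (hg' : ∀ β, ∀ ξ < β, ∃ t < β.cof.ord, ξ ≤ g β t) :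
    ∃ E, ∀ E', IsClubIn E' κ.ord → ∀ D, IsClubIn D κ.ord → ∃ δ ∈ D, δ.cof = Cardinal.aleph 1 ∧
      ∀ m, ∀ ξ < δ, ∃ x ∈ closureIn (walkSet g E δ (μ m).ord) δ ∩ E' ∩ {α | μ m < α.cof},
        ξ < x := by
  by_contra! hcon
  have hκ1 : Cardinal.aleph 1 < κ := (Order.lt_succ _).trans hκ2
  have hκ0 : Cardinal.aleph0 < κ := (Cardinal.aleph0_le_aleph 1).trans_lt hκ1
  have hG : ∀ E, ∃ G, IsClubIn G κ.ord ∧ ∀ δ ∈ G, δ.cof = Cardinal.aleph 1 →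
      ∃ m, ∃ ξ < δ, ∀ x ∈ closureIn (walkSet g E δ (μ m).ord) δ, x ∈ G → μ m < x.cof → x ≤ ξ := by
    intro E
    obtain ⟨E', hE', D, hD, h⟩ := hcon E
    refine ⟨E' ∩ D, hE'.inter hκ hκ0 hD, fun δ hδ hcof => ?_⟩
    obtain ⟨m, ξ, hξ, hx⟩ := h δ hδ.2 hcof
    exact ⟨m, ξ, hξ, fun x h1 h2 h3 => hx x ⟨⟨h1, h2.1⟩, h3⟩⟩
  choose G hGclub hG using hG
  have hreg : (Order.succ (Cardinal.aleph 1)).IsRegular :=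
    Cardinal.isRegular_succ (Cardinal.aleph0_le_aleph 1)
  set θ : Ordinal.{0} := (Order.succ (Cardinal.aleph 1)).ord
  have hθκ : θ < κ.ord := Cardinal.ord_lt_ord.2 hκ2
  set F := iterInter κ.ord G
  have hF : ∀ i < κ.ord, IsClubIn (F i) κ.ord :=
    isClubIn_iterInter hκ hκ0 fun E _ => hGclub E
  have hanti : Antitone F := iterInter_antitone κ.ord G
  obtain ⟨δ, hδF, hcof, hδ⟩ := exists_mem_cof_eq_aleph_one hκ hκ1
    (fun m => (Cardinal.aleph0_le_aleph 1).trans (hμ m)) hμκ (hF θ hθκ)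
  have hδκ : δ < κ.ord := (hF θ hθκ).1 hδF
  have hδ0 : δ ≠ 0 := by
    rintro rfl
    rw [Ordinal.cof_zero] at hcof
    exact (Cardinal.aleph_pos 1).ne hcof
  have key : ∀ p : ℕ × (Cardinal.aleph.{0} 1).ord.ToType, ∃ i₀ < θ, ∃ x, g δ p.2.toOrd.1 < x ∧
      x < δ ∧ μ p.1 < x.cof ∧ ∀ i, i₀ ≤ i → i < θ → x ∈ walkSet g (F i) δ (μ p.1).ord ∧ x ∈ F i := by
    rintro ⟨m, t⟩
    obtain ⟨ξ, hξF, hξ, hξδ, hξν⟩ := hδ m _ (hg δ t.toOrd.1 hδ0)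
    obtain ⟨i₀, hi₀, l, hl, x, hξx, hxδ, hx, hw⟩ := exists_walk_eventually_eq hg hg'
      (o := κ.ord) (θ := θ) hreg.ord_pos (fun i hi => (hF i (hi.trans hθκ)).2.1) hanti
      (fun i hi => hanti hi.le hξF) hξν δ hξδ hδκ (hcof.trans_le (hμ m))
    exact ⟨i₀, hi₀, x, hξ.trans_le hξx, hxδ, hx, fun i h1 h2 =>
      ⟨Or.inl ⟨l, hl, (hw i h1 h2).1⟩, (hw i h1 h2).2⟩⟩
  choose i₀ hi₀ x hx hxδ hxν hxmem using key
  have hi : (⨆ p, i₀ p) < θ := by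
    refine Ordinal.iSup_lt_of_lt_cof ?_ hi₀
    rw [hreg.cof_ord]
    simp
  set i := ⨆ p, i₀ p
  have hi1 : i + 1 < θ := (Cardinal.isSuccLimit_ord hreg.aleph0_le).add_one_lt hi
  obtain ⟨m, ξ, hξ, hbd⟩ := hG (F i) δ (iterInter_subset κ.ord G hi hδF) hcof
  obtain ⟨t, ht, hξt⟩ := hg' δ ξ hξ
  rw [hcof] at ht
  have hle : ∀ p, i₀ p ≤ i := fun p => Ordinal.le_iSup i₀ p
  let p : ℕ × (Cardinal.aleph.{0} 1).ord.ToType := (m, Ordinal.ToType.mk ⟨t, ht⟩)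
  have hpt : g δ t < x p := by simpa [p] using hx p
  have h1 := (hxmem p i (hle p) hi).1
  have h2 := (hxmem p (i + 1) ((hle p).trans (le_add_of_nonneg_right zero_le_one)) hi1).2
  have h3 := hbd (x p) (mem_closureIn h1 (hxδ p))
    (iterInter_subset κ.ord G (lt_add_one i) h2) (hxν p)
  exact (hξt.trans_lt hpt).not_ge h3

theorem succ_lt_of_cof_eq_aleph0 {lam : Cardinal.{0}} (h1 : lam.ord.cof = Cardinal.aleph0)
    (h2 : Cardinal.aleph0 < lam) {ν : Cardinal.{0}} (hν : ν < lam) : Order.succ ν < lam := by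
  rcases lt_or_ge ν Cardinal.aleph0 with h | h
  · exact (Order.succ_le_of_lt h).trans_lt h2
  · refine (Order.succ_le_of_lt hν).lt_of_ne ?_
    rintro rfl
    rw [(Cardinal.isRegular_succ h).cof_ord] at h1
    exact h2.ne' h1

/-- The recursive construction of a strictly increasing sequence of successor cardinals dominating
`c`. -/
noncomputable def succSeq (c : ℕ → Cardinal.{0}) : ℕ → Cardinal.{0}
  | 0 => Order.succ Cardinal.aleph0
  | n + 1 => Order.succ (max (succSeq c n) (c n))

theorem exists_succ_cardinal_seq {lam : Cardinal.{0}} (h1 : lam.ord.cof = Cardinal.aleph0)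
    (h2 : Cardinal.aleph0 < lam) :
    ∃ μ : ℕ → Cardinal.{0}, StrictMono μ ∧
      (∀ m, ∃ ν : Cardinal, Cardinal.aleph0 ≤ ν ∧ μ m = Order.succ ν) ∧
      (⨆ m, μ m) = lam ∧ ∀ m, μ m < lam := by
  obtain ⟨g, hg, hg'⟩ := exists_ladder_system
  have hlam0 : lam.ord ≠ 0 := by
    rw [Ne, Cardinal.ord_eq_zero]
    exact (pos_of_gt h2).ne'
  set c : ℕ → Cardinal.{0} := fun n => (g lam.ord n).card
  have hclt : ∀ n, c n < lam := fun n => Cardinal.lt_ord.1 (hg lam.ord n hlam0)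
  have hlt : ∀ m, succSeq c m < lam := by
    intro m
    induction m with
    | zero => exact succ_lt_of_cof_eq_aleph0 h1 h2 h2
    | succ n ih => exact succ_lt_of_cof_eq_aleph0 h1 h2 (max_lt ih (hclt n))
  have hmono : StrictMono (succSeq c) :=
    strictMono_nat_of_lt_succ fun n => Order.lt_succ_of_le (le_max_left _ _)
  have hinf : ∀ m, Cardinal.aleph0 ≤ succSeq c m := fun m =>
    (Order.le_succ _).trans (hmono.monotone (Nat.zero_le m))
  refine ⟨succSeq c, hmono, fun m => ?_, le_antisymm (ciSup_le' fun m => (hlt m).le) ?_, hlt⟩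
  · cases m with
    | zero => exact ⟨_, le_rfl, rfl⟩
    | succ n => exact ⟨_, (hinf n).trans (le_max_left _ _), rfl⟩
  · by_contra! hsup
    have h3 := succ_lt_of_cof_eq_aleph0 h1 h2 hsup
    obtain ⟨t, ht, hle⟩ := hg' lam.ord _ (Cardinal.ord_lt_ord.2 h3)
    rw [h1, Cardinal.ord_aleph0] at ht
    obtain ⟨n, rfl⟩ := Ordinal.lt_omega0.1 ht
    have h4 : Order.succ (⨆ m, succSeq c m) ≤ c n := Cardinal.ord_le.1 hle
    have h5 : c n < succSeq c (n + 1) := Order.lt_succ_of_le (le_max_right _ _)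
    have h6 := le_ciSup (Cardinal.bddAbove_of_small (s := Set.range (succSeq c))) (n + 1)
    exact (h4.trans_lt h5).not_ge (h6.trans (Order.le_succ _))

theorem offcenter_club_guessing (lam : Cardinal.{0})
    (h1 : lam.ord.cof = Cardinal.aleph0) (h2 : Cardinal.aleph0 < lam) :
    ∃ μ : ℕ → Cardinal.{0}, ∃ e : Ordinal.{0} → ℕ → Set Ordinal.{0},
      -- `μ` is a strictly increasing sequence of successor cardinals with supremum `λ`
      StrictMono μ ∧
      (∀ m, ∃ ν : Cardinal, Cardinal.aleph0 ≤ ν ∧ μ m = Order.succ ν) ∧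
      (⨆ m, μ m) = lam ∧
      -- (1), (2): increasing chains of clubs `e δ m` in `δ` with `|e δ m| ≤ μ m`
      (∀ δ, δ < (Order.succ lam).ord → Ordinal.cof δ = Cardinal.aleph 1 →
        ∀ m : ℕ, IsClubIn (e δ m) δ ∧ e δ m ⊆ e δ (m + 1) ∧
          Cardinal.mk (e δ m) ≤ Cardinal.lift.{1} (μ m)) ∧
      -- (3): guessing
      (∀ E : Set Ordinal, IsClubIn E (Order.succ lam).ord →
        IsStationaryIn
          {δ | δ < (Order.succ lam).ord ∧ Ordinal.cof δ = Cardinal.aleph 1 ∧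
            ∀ m : ℕ, sSup (e δ m ∩ E ∩ {α | μ m < Ordinal.cof α}) = δ}
          (Order.succ lam).ord) := by
  obtain ⟨μ, hmono, hsucc, hsup, hlt⟩ := exists_succ_cardinal_seq h1 h2
  obtain ⟨g, hg, hg'⟩ := exists_ladder_system
  have hκ : (Order.succ lam).IsRegular := Cardinal.isRegular_succ h2.le
  have hμ : ∀ m, Cardinal.aleph 1 ≤ μ m := by
    intro m
    obtain ⟨ν, hν, h⟩ := hsucc m
    rw [h, ← Cardinal.succ_aleph0]
    exact Order.succ_le_succ hν
  have hμ0 : ∀ m, Cardinal.aleph0 ≤ μ m := fun m => (Cardinal.aleph0_le_aleph 1).trans (hμ m)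
  have hμκ : ∀ m, Order.succ (μ m) < Order.succ lam := fun m => Order.succ_lt_succ (hlt m)
  obtain ⟨E₀, hE₀⟩ := exists_isClubIn_guess hκ
    (Order.succ_lt_succ ((hμ 0).trans_lt (hlt 0))) hμ hμκ hg hg'
  refine ⟨μ, fun δ m => closureIn (walkSet g E₀ δ (μ m).ord) δ, hmono, hsucc, hsup,
    fun δ _ hcof m => ?_, fun E hE => ⟨fun δ hδ => hδ.1, fun D hD => ?_⟩⟩
  · have hY : ∀ p < δ, ∃ y ∈ walkSet g E₀ δ (μ m).ord, p ≤ y ∧ y < δ := by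
      intro p hp
      obtain ⟨t, ht, hpt⟩ := hg' δ p hp
      refine ⟨g δ t, Or.inr ⟨t, ?_, rfl⟩, hpt, hg δ t (pos_of_gt hp).ne'⟩
      exact ht.trans_le (Cardinal.ord_le_ord.2 (hcof.trans_le (hμ m)))
    refine ⟨isClubIn_closureIn hY, closureIn_mono (walkSet_mono g E₀ δ ?_) δ,
      mk_closureIn_le hY (by simpa using hμ0 m) (mk_walkSet_le g E₀ δ (hμ0 m))⟩
    exact Cardinal.ord_le_ord.2 (hmono (Nat.lt_succ_self m)).le
  · obtain ⟨δ, hδD, hcof, hδ⟩ := hE₀ E hE D hD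
    refine ⟨δ, ⟨hD.1 hδD, hcof, fun m => ?_⟩, hδD⟩
    refine le_antisymm (csSup_le' fun x hx => hx.1.1.1.le) (le_of_not_gt fun hlt => ?_)
    obtain ⟨x, hx, hlt'⟩ := hδ m _ hlt
    exact hlt'.not_ge (le_csSup ⟨δ, fun y hy => hy.1.1.1.le⟩ hx)
end

section
/- Let λ be a cardinal with λ > cf(λ) = ω, and let ⟨μ_m : m < ω⟩ and ⟨e^m_δ : δ ∈ E^{λ⁺}_{ω₁}, m < ω⟩ be as in Eisworth's off-center club guessing theorem (each ⟨e^m_δ : m < ω⟩ an ⊆-increasing chain of clubs in δ with |e^m_δ| ≤ μ_m, the μ_m an increasing sequence of successor cardinals with supremum λ, and for every club E ⊆ λ⁺ stationarily many δ ∈ E^{λ⁺}_{ω₁} with sup(e^m_δ ∩ E ∩ E^δ_{>μ_m}) = δ for all m). Then there exists a matrix ⟨C^m_α : α < λ⁺, m < ω⟩ such that for every α < λ⁺: (i) max(C^m_{α+1}) = α for all m < ω; (ii) ⟨C^m_α : m < ω⟩ is an ⊆-increasing chain of club subsets of α; (iii) |C^m_α| ≤ max{μ_m, cf(α)}; and (iv)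 if δ ∈ C^m_α ∩ E^{λ⁺}_{ω₁}, then e^m_δ ⊆ C^m_α. -/
open Ordinal Cardinal Set

open scoped Cardinal

universe u

/-- The set of limit points of `A` together with `A` itself, cut off below `o`. -/
def closureBelow (o : Ordinal.{u}) (A : Set Ordinal.{u}) : Set Ordinal.{u} :=
  {p | p < o ∧ (p ∈ A ∨ p ≠ 0 ∧ ∀ q < p, ∃ r ∈ A, q < r ∧ r < p)}

theorem closureBelow_mono (o : Ordinal.{u}) {A B : Set Ordinal.{u}} (h : A ⊆ B) :
    closureBelow o A ⊆ closureBelow o B := by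
  rintro p ⟨hp, hA | ⟨h0, hl⟩⟩
  · exact ⟨hp, .inl (h hA)⟩
  · refine ⟨hp, .inr ⟨h0, fun q hq => ?_⟩⟩
    obtain ⟨r, hr, h1, h2⟩ := hl q hq
    exact ⟨r, h hr, h1, h2⟩

theorem subset_closureBelow {o : Ordinal.{u}} {A : Set Ordinal.{u}} (h : A ⊆ Iio o) :
    A ⊆ closureBelow o A :=
  fun _ hp => ⟨h hp, .inl hp⟩

theorem closureBelow_subset_Iio (o : Ordinal.{u}) (A : Set Ordinal.{u}) :
    closureBelow o A ⊆ Iio o :=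
  fun _ hp => hp.1

theorem isClosedIn_closureBelow (o : Ordinal.{u}) (A : Set Ordinal.{u}) :
    IsClosedIn (closureBelow o A) o := by
  intro p hp h0 hl
  refine ⟨hp, .inr ⟨h0, fun q hq => ?_⟩⟩
  obtain ⟨r, ⟨-, hr⟩, hqr, hrp⟩ := hl q hq
  obtain hr | ⟨-, hr⟩ := hr
  · exact ⟨r, hr, hqr, hrp⟩
  · obtain ⟨s, hs, hqs, hsr⟩ := hr q hqr
    exact ⟨s, hs, hqs, hsr.trans hrp⟩

theorem mk_closureBelow_le {o : Ordinal.{u}} {A : Set Ordinal.{u}} {κ : Cardinal.{u + 1}}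
    (hκ : ℵ₀ ≤ κ) (hA : #A ≤ κ) (hcof : ∀ p < o, ∃ q ∈ A, p ≤ q) :
    #(closureBelow o A) ≤ κ := by
  let L : Set Ordinal.{u} := {p | p < o ∧ ∀ q < p, ∃ r ∈ A, q < r ∧ r < p}
  have hnext (p : L) : sInf {r | r ∈ A ∧ p.1 ≤ r} ∈ {r | r ∈ A ∧ p.1 ≤ r} :=
    csInf_mem (hcof p.1 p.2.1)
  have hlt (p q : L) (hpq : p.1 < q.1) :
      sInf {r | r ∈ A ∧ p.1 ≤ r} < sInf {r | r ∈ A ∧ q.1 ≤ r} := by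
    obtain ⟨r, hr, hpr, hrq⟩ := q.2.2 p.1 hpq
    exact (csInf_le' (show r ∈ {r | r ∈ A ∧ p.1 ≤ r} from ⟨hr, hpr.le⟩)).trans_lt
      (hrq.trans_le (hnext q).2)
  have hL : #L ≤ κ := by
    refine le_trans (mk_le_of_injective (f := fun p : L => (⟨_, (hnext p).1⟩ : A)) ?_) hA
    intro p q hpq
    have hpq' := congrArg Subtype.val hpq
    obtain h | h | h := lt_trichotomy p.1 q.1
    · exact absurd hpq' (hlt p q h).ne
    · exact Subtype.ext h
    · exact absurd hpq' (hlt q p h).ne'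
  have hsub : closureBelow o A ⊆ A ∪ L := by
    rintro p ⟨hp, hp' | ⟨-, hp'⟩⟩
    · exact .inl hp'
    · exact .inr ⟨hp, hp'⟩
  exact (mk_le_mk_of_subset hsub).trans
    ((mk_union_le _ _).trans (add_le_of_le hκ hA hL))

theorem exists_cofinal_of_limit_iUnion {A : ℕ → Set Ordinal.{u}} {p : Ordinal.{u}}
    (hp : ℵ₀ < p.cof) (hlim : ∀ q < p, ∃ r ∈ ⋃ n, A n, q < r ∧ r < p) :
    ∃ n, ∀ q < p, ∃ r ∈ A n, q < r ∧ r < p := by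
  by_contra! h
  choose q hq hqA using h
  have hsup : ⨆ n, q n < p := by
    refine lift_iSup_lt_of_lt_cof ?_ hq
    simpa using hp
  obtain ⟨r, hr, hqr, hrp⟩ := hlim _ hsup
  obtain ⟨n, hn⟩ := mem_iUnion.1 hr
  exact (hqA n r hn ((Ordinal.le_iSup q n).trans_lt hqr)).not_gt hrp

theorem exists_cofinal_subset_Iio (o : Ordinal.{u}) :
    ∃ D ⊆ Iio o, (∀ p < o, ∃ q ∈ D, p ≤ q) ∧ #D = Cardinal.lift.{u + 1} o.cof := by
  obtain ⟨s, hs, hcard⟩ := Order.exists_cof_eq (Iio o)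
  refine ⟨Subtype.val '' s, ?_, fun p hp => ?_, ?_⟩
  · rintro _ ⟨x, -, rfl⟩
    exact x.2
  · obtain ⟨q, hq, hpq⟩ := hs ⟨p, hp⟩
    exact ⟨q, ⟨q, hq, rfl⟩, hpq⟩
  · rw [mk_image_eq Subtype.val_injective, hcard, cof_Iio, lift_cof]

/-- Add `f δ` to `A` for every `δ ∈ A` of cofinality `ℵ₁`. -/
def adjoinLadders (f : Ordinal.{u} → Set Ordinal.{u}) (A : Set Ordinal.{u}) : Set Ordinal.{u} :=
  A ∪ ⋃ δ ∈ {δ ∈ A | δ.cof = ℵ₁}, f δ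

/-- The finite stages in the generation of a closed set containing `D` and closed under `f`. -/
def ladderStage (o : Ordinal.{u}) (f : Ordinal.{u} → Set Ordinal.{u}) (D : Set Ordinal.{u}) :
    ℕ → Set Ordinal.{u}
  | 0 => D
  | n + 1 => closureBelow o (adjoinLadders f (ladderStage o f D n))

/-- The closed set generated by `D` under adjoining `f δ` for the members `δ` of cofinality
`ℵ₁`. -/
def ladderHull (o : Ordinal.{u}) (f : Ordinal.{u} → Set Ordinal.{u}) (D : Set Ordinal.{u}) :
    Set Ordinal.{u} :=
  closureBelow o (⋃ n, ladderStage o f D n)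

section ladderHull

variable {o : Ordinal.{u}} {f g : Ordinal.{u} → Set Ordinal.{u}} {D : Set Ordinal.{u}}

theorem adjoinLadders_subset_Iio (hf : ∀ δ < o, δ.cof = ℵ₁ → f δ ⊆ Iio δ) {A : Set Ordinal.{u}}
    (hA : A ⊆ Iio o) : adjoinLadders f A ⊆ Iio o := by
  refine union_subset hA (iUnion₂_subset fun δ hδ => ?_)
  exact (hf δ (hA hδ.1) hδ.2).trans (Iio_subset_Iio (hA hδ.1 : δ < o).le)

theorem ladderStage_subset_Iio (hD : D ⊆ Iio o) (n : ℕ) : ladderStage o f D n ⊆ Iio o := by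
  cases n with
  | zero => exact hD
  | succ n => exact closureBelow_subset_Iio _ _

theorem ladderStage_subset_succ (hD : D ⊆ Iio o) (n : ℕ) :
    ladderStage o f D n ⊆ ladderStage o f D (n + 1) :=
  fun _ hp => ⟨ladderStage_subset_Iio hD n hp, .inl (.inl hp)⟩

theorem subset_ladderStage (hD : D ⊆ Iio o) (n : ℕ) : D ⊆ ladderStage o f D n := by
  induction n with
  | zero => exact subset_rfl
  | succ n ih => exact ih.trans (ladderStage_subset_succ hD n)

theorem ladder_subset_ladderStage_succ (hD : D ⊆ Iio o)
    (hf : ∀ δ < o, δ.cof = ℵ₁ → f δ ⊆ Iio δ) {n : ℕ} {δ : Ordinal.{u}}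
    (hδ : δ ∈ ladderStage o f D n) (hcof : δ.cof = ℵ₁) : f δ ⊆ ladderStage o f D (n + 1) := by
  refine Subset.trans ?_
    (subset_closureBelow (adjoinLadders_subset_Iio hf (ladderStage_subset_Iio hD n)))
  exact (subset_biUnion_of_mem (u := f) (show δ ∈ {δ ∈ _ | δ.cof = ℵ₁} from ⟨hδ, hcof⟩)).trans
    subset_union_right

theorem ladderStage_subset_ladderHull (hD : D ⊆ Iio o) (n : ℕ) :
    ladderStage o f D n ⊆ ladderHull o f D :=
  (subset_iUnion _ n).trans
    (subset_closureBelow (iUnion_subset fun n => ladderStage_subset_Iio hD n))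

theorem isClubIn_ladderHull (hD : D ⊆ Iio o) (hcof : ∀ p < o, ∃ q ∈ D, p ≤ q) :
    IsClubIn (ladderHull o f D) o := by
  refine ⟨closureBelow_subset_Iio _ _, isClosedIn_closureBelow _ _, fun p hp => ?_⟩
  obtain ⟨q, hq, hpq⟩ := hcof p hp
  exact ⟨q, ladderStage_subset_ladderHull hD 0 hq, hpq⟩

/-- The last closing off only adds points of cofinality `ω`, so no further ladders are needed. -/
theorem ladder_subset_ladderHull (hD : D ⊆ Iio o) (hf : ∀ δ < o, δ.cof = ℵ₁ → f δ ⊆ Iio δ)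
    {δ : Ordinal.{u}} (hδ : δ ∈ ladderHull o f D) (hcof : δ.cof = ℵ₁) :
    f δ ⊆ ladderHull o f D := by
  obtain ⟨n, hn⟩ : ∃ n, δ ∈ ladderStage o f D n := by
    obtain ⟨hδo, hδ | ⟨h0, hlim⟩⟩ := hδ
    · exact mem_iUnion.1 hδ
    · obtain ⟨n, hn⟩ := exists_cofinal_of_limit_iUnion (hcof ▸ aleph0_lt_aleph_one) hlim
      refine ⟨n + 1, hδo, .inr ⟨h0, fun q hq => ?_⟩⟩
      obtain ⟨r, hr, h⟩ := hn q hq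
      exact ⟨r, .inl hr, h⟩
  exact (ladder_subset_ladderStage_succ hD hf hn hcof).trans (ladderStage_subset_ladderHull hD _)

theorem ladderStage_mono (hD : D ⊆ Iio o) (hfg : ∀ δ < o, δ.cof = ℵ₁ → f δ ⊆ g δ) (n : ℕ) :
    ladderStage o f D n ⊆ ladderStage o g D n := by
  induction n with
  | zero => exact subset_rfl
  | succ n ih =>
    refine closureBelow_mono o (union_subset_union ih ?_)
    refine iUnion₂_subset fun δ hδ => ?_
    exact (hfg δ (ladderStage_subset_Iio hD n hδ.1) hδ.2).trans
      (subset_biUnion_of_mem (u := g) (show δ ∈ {δ ∈ _ | δ.cof = ℵ₁} from ⟨ih hδ.1, hδ.2⟩))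

theorem ladderHull_mono (hD : D ⊆ Iio o) (hfg : ∀ δ < o, δ.cof = ℵ₁ → f δ ⊆ g δ) :
    ladderHull o f D ⊆ ladderHull o g D :=
  closureBelow_mono o (iUnion_mono fun n => ladderStage_mono hD hfg n)

theorem mk_ladderStage_le {κ : Cardinal.{u + 1}} (hκ : ℵ₀ ≤ κ) (hD : D ⊆ Iio o)
    (hcof : ∀ p < o, ∃ q ∈ D, p ≤ q) (hDκ : #D ≤ κ) (hf : ∀ δ < o, δ.cof = ℵ₁ → #(f δ) ≤ κ)
    (n : ℕ) : #(ladderStage o f D n) ≤ κ := by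
  induction n with
  | zero => exact hDκ
  | succ n ih =>
    refine mk_closureBelow_le hκ ?_ fun p hp => ?_
    · refine (mk_union_le _ _).trans (add_le_of_le hκ ih ?_)
      refine (mk_biUnion_le _ _).trans (mul_le_of_le hκ ?_ ?_)
      · exact (mk_le_mk_of_subset (sep_subset _ _)).trans ih
      · exact ciSup_le' fun δ => hf δ.1 (ladderStage_subset_Iio hD n δ.2.1) δ.2.2
    · obtain ⟨q, hq, hpq⟩ := hcof p hp
      exact ⟨q, .inl (subset_ladderStage hD n hq), hpq⟩

theorem mk_ladderHull_le {κ : Cardinal.{u + 1}} (hκ : ℵ₀ ≤ κ) (hD : D ⊆ Iio o)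
    (hcof : ∀ p < o, ∃ q ∈ D, p ≤ q) (hDκ : #D ≤ κ) (hf : ∀ δ < o, δ.cof = ℵ₁ → #(f δ) ≤ κ) :
    #(ladderHull o f D) ≤ κ := by
  refine mk_closureBelow_le hκ ?_ fun p hp => ?_
  · have h := mk_iUnion_le_lift (ladderStage o f D)
    rw [Cardinal.lift_id'.{0}] at h
    refine h.trans (mul_le_of_le hκ (by simpa using hκ) (ciSup_le' fun n => ?_))
    simpa using mk_ladderStage_le hκ hD hcof hDκ hf n
  · obtain ⟨q, hq, hpq⟩ := hcof p hp
    exact ⟨q, mem_iUnion.2 ⟨0, hq⟩, hpq⟩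

end ladderHull

theorem C_matrix_from_offcenter_club_guessing (lam : Cardinal.{0})
    (h1 : lam.ord.cof = Cardinal.aleph0) (h2 : Cardinal.aleph0 < lam)
    (μ : ℕ → Cardinal.{0}) (e : Ordinal.{0} → ℕ → Set Ordinal.{0})
    (hμ1 : StrictMono μ)
    (hμ2 : ∀ m, ∃ ν : Cardinal, Cardinal.aleph0 ≤ ν ∧ μ m = Order.succ ν)
    (hμ3 : (⨆ m, μ m) = lam)
    (he1 : ∀ δ, δ < (Order.succ lam).ord → Ordinal.cof δ = Cardinal.aleph 1 →
      ∀ m : ℕ, IsClubIn (e δ m) δ ∧ e δ m ⊆ e δ (m + 1) ∧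
        Cardinal.mk (e δ m) ≤ Cardinal.lift.{1} (μ m))
    (he2 : ∀ E : Set Ordinal, IsClubIn E (Order.succ lam).ord →
      IsStationaryIn
        {δ | δ < (Order.succ lam).ord ∧ Ordinal.cof δ = Cardinal.aleph 1 ∧
          ∀ m : ℕ, sSup (e δ m ∩ E ∩ {α | μ m < Ordinal.cof α}) = δ}
        (Order.succ lam).ord) :
    ∃ C : Ordinal.{0} → ℕ → Set Ordinal.{0},
      ∀ α, α < (Order.succ lam).ord → ∀ m : ℕ,
        -- (i) `max (C (α+1) m) = α`
        IsGreatest (C (α + 1) m) α ∧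
        -- (ii) an `⊆`-increasing chain of clubs in `α`
        IsClubIn (C α m) α ∧ C α m ⊆ C α (m + 1) ∧
        -- (iii) `|C α m| ≤ max (μ m) (cf α)`
        Cardinal.mk (C α m) ≤ Cardinal.lift.{1} (max (μ m) (Ordinal.cof α)) ∧
        -- (iv) coherence
        (∀ δ ∈ C α m, Ordinal.cof δ = Cardinal.aleph 1 → e δ m ⊆ C α m) := by
  choose D hD hDcof hDcard using exists_cofinal_subset_Iio.{0}
  refine ⟨fun α m => ladderHull α (fun δ => e δ m) (D α), fun α hα m => ?_⟩
  have he_sub (δ : Ordinal) (hδ : δ < α) (hcof : δ.cof = ℵ₁) : e δ m ⊆ Iio δ :=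
    (he1 δ (hδ.trans hα) hcof m).1.1
  have hκ : ℵ₀ ≤ Cardinal.lift.{1} (max (μ m) α.cof) := by
    obtain ⟨ν, hν, hμν⟩ := hμ2 m
    exact aleph0_le_lift.2 (le_max_of_le_left (hμν ▸ hν.trans (Order.le_succ ν)))
  refine ⟨⟨?_, fun p hp => ?_⟩, isClubIn_ladderHull (hD α) (hDcof α),
    ladderHull_mono (hD α) fun δ hδ hcof => (he1 δ (hδ.trans hα) hcof m).2.1,
    mk_ladderHull_le hκ (hD α) (hDcof α) ?_ fun δ hδ hcof => ?_,
    fun δ hδ hcof => ladder_subset_ladderHull (hD α) he_sub hδ hcof⟩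
  · have hclub := isClubIn_ladderHull (f := fun δ => e δ m) (hD (α + 1)) (hDcof (α + 1))
    obtain ⟨q, hq, hαq⟩ := hclub.2.2 α (lt_add_one α)
    exact hαq.antisymm (Order.lt_add_one_iff.1 (hclub.1 hq)) ▸ hq
  · exact Order.lt_add_one_iff.1 (closureBelow_subset_Iio _ _ hp)
  · exact (hDcard α).trans_le (lift_le.2 (le_max_right _ _))
  · exact (he1 δ (hδ.trans hα) hcof m).2.2.trans (lift_le.2 (le_max_left _ _))
end
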